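/- Let n ≥ 2 and N ≥ 1, let U ⊆ ℝⁿ be open and connected, and let (A₁,…,A_n, V) be a semilinear elliptic first-order system respecting the zero section on U. Let φ : U → ℝ^N be a smooth solution of ∑ⱼ Aⱼ(x)(∂φ/∂xⱼ)(x) + V(x, φ(x)) = 0, and let p ∈ U be a zero of φ of order exactly k with k ≥ 1. Then the (n−2)-dimensional upper Hausdorff density of the zero set N(φ) at p satisfies Θ^{*(n−2)}(N(φ), p) ≤ 2^{n−3} n (n−1) k³ / α(n−2). -/

import Mathlib

open MeasureTheory Metric Set Filter Topology ENNReal NNReal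

noncomputable section

/-- `m`-dimensional Euclidean space. -/
abbrev Euc (m : ℕ) := EuclideanSpace ℝ (Fin m)

/-- The semilinear first-order differential operator `φ ↦ ∑ⱼ Aⱼ(x) ∂φ/∂xⱼ + V(x, φ(x))`
applied to `φ` at the point `x`. -/
def semilinApply {n N : ℕ} (A : Fin n → Euc n → Matrix (Fin N) (Fin N) ℝ)
    (V : Euc n → (Fin N → ℝ) → (Fin N → ℝ)) (φ : Euc n → (Fin N → ℝ)) (x : Euc n) :
    Fin N → ℝ :=
  (∑ j, (A j x).mulVec (fderiv ℝ φ x (EuclideanSpace.single j 1))) + V x (φ x)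

/-- Ellipticity of the principal symbol `ξ ↦ ∑ⱼ ξⱼ Aⱼ(x)` at every point of `U`. -/
def IsElliptic {n N : ℕ} (A : Fin n → Euc n → Matrix (Fin N) (Fin N) ℝ)
    (U : Set (Euc n)) : Prop :=
  ∀ x ∈ U, ∀ ξ : Euc n, ξ ≠ 0 → IsUnit (∑ j, ξ j • A j x)

/-- A set `S ⊆ ℝⁿ` is countably `m`-`C^∞`-rectifiable if it is contained in a countable
union of ranges of smooth maps `ℝᵐ → ℝⁿ`. -/
def CountablyCinfRectifiable {n : ℕ} (m : ℕ) (S : Set (Euc n)) : Prop :=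
  ∃ g : ℕ → (Euc m → Euc n), (∀ i, ContDiff ℝ (⊤ : ℕ∞) (g i)) ∧ S ⊆ ⋃ i, range (g i)

/-- The Lebesgue volume `α(m)` of the unit ball in `ℝᵐ` (so `α(0) = 1`). -/
def unitBallVol (m : ℕ) : ℝ≥0∞ := volume (ball (0 : Euc m) 1)

/-- The `m`-dimensional upper Hausdorff density
`Θ^{*m}(S,p) = limsup_{r→0⁺} μH^m(S ∩ B(p,r))/(α(m) rᵐ)`. -/
def upperHausdorffDensity {n : ℕ} (m : ℕ) (S : Set (Euc n)) (p : Euc n) : ℝ≥0∞ :=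
  limsup (fun r : ℝ =>
      μH[(m : ℝ)] (S ∩ ball p r) / (unitBallVol m * ENNReal.ofReal (r ^ m)))
    (𝓝[>] (0 : ℝ))

/-- A form of the Cauchy–Binet formula for the Gram determinant. -/
theorem sum_det_submatrix_sq {m n : ℕ} (X : Matrix (Fin n) (Fin m) ℝ) :
    ∑ f : Fin m → Fin n, (X.submatrix f id).det ^ 2
      = (m.factorial : ℝ) * (X.transpose * X).det := by
  have key : (X.transpose * X).det =
      ∑ f : Fin m → Fin n, (∏ i, X (f i) i) * (X.submatrix f id).det := by
    have h1 : (X.transpose * X) = fun i => ∑ a, X a i • (fun l => X a l) := by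
      ext i l
      simp [Matrix.mul_apply]
    have h2 := (Matrix.detRowAlternating (R := ℝ) (n := Fin m)).toMultilinearMap.map_sum
      (g := fun (i : Fin m) (a : Fin n) => X a i • (fun l => X a l))
    have h3 : (X.transpose * X).det
        = Matrix.detRowAlternating (fun i => ∑ a, X a i • (fun l => X a l)) := by
      rw [← h1]; rfl
    rw [h3]
    refine h2.trans (Finset.sum_congr rfl fun f _ => ?_)
    refine (MultilinearMap.map_smul_univ _ _ _).trans ?_
    rfl
  have h4 : ∀ σ : Equiv.Perm (Fin m), (X.transpose * X).det =
      ∑ f : Fin m → Fin n, ((Equiv.Perm.sign σ : ℤ) : ℝ) * (∏ i, X (f (σ i)) i) *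
        (X.submatrix f id).det := by
    intro σ
    rw [key, ← (Equiv.arrowCongr σ.symm (Equiv.refl (Fin n))).sum_comp]
    refine Finset.sum_congr rfl fun f _ => ?_
    have : X.submatrix ((Equiv.arrowCongr σ.symm (Equiv.refl (Fin n))) f) id
        = (X.submatrix f id).submatrix σ id := by
      ext; simp [Equiv.arrowCongr]
    rw [this, Matrix.det_permute]
    simp [Equiv.arrowCongr]
    ring
  have h5 : ∑ σ : Equiv.Perm (Fin m), (X.transpose * X).det
      = (m.factorial : ℝ) * (X.transpose * X).det := by
    simp [Finset.card_univ, Fintype.card_perm]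
  rw [← h5, Finset.sum_congr rfl fun σ _ => h4 σ, Finset.sum_comm]
  refine Finset.sum_congr rfl fun f _ => ?_
  rw [← Finset.sum_mul, sq, Matrix.det_apply']
  rfl

/-- The projection of `ℝⁿ` to the coordinates selected by `f`. -/
def coordProj {m n : ℕ} (f : Fin m → Fin n) : Euc n →L[ℝ] Euc m :=
  LinearMap.toContinuousLinearMap
    ((WithLp.linearEquiv 2 ℝ (Fin m → ℝ)).symm.toLinearMap ∘ₗ
      (LinearMap.funLeft ℝ ℝ f) ∘ₗ (WithLp.linearEquiv 2 ℝ (Fin n → ℝ)).toLinearMap)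

@[simp] theorem coordProj_apply {m n : ℕ} (f : Fin m → Fin n) (x : Euc n) (i : Fin m) :
    coordProj f x i = x (f i) := rfl

theorem norm_coordProj_le {m n : ℕ} (f : Fin m ↪ Fin n) (x : Euc n) : ‖coordProj f x‖ ≤ ‖x‖ := by
  rw [EuclideanSpace.norm_eq, EuclideanSpace.norm_eq]
  apply Real.sqrt_le_sqrt
  simp only [coordProj_apply]
  rw [← Finset.sum_map Finset.univ f (fun a => ‖x a‖ ^ 2)]
  exact Finset.sum_le_sum_of_subset_of_nonneg (Finset.subset_univ _) fun _ _ _ => by positivity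

/-- `S` is, near `x`, arbitrarily Lipschitz-close to the `m`-plane parametrised by `ι`. -/
def HasTangentPlane {m n : ℕ} (S : Set (Euc n)) (x : Euc n) (ι : Euc m →ₗᵢ[ℝ] Euc n) : Prop :=
  ∀ η > (0 : ℝ), ∃ W : Set (Euc n), IsOpen W ∧ x ∈ W ∧ ∀ y ∈ S ∩ W, ∀ z ∈ S ∩ W,
    ‖(y - z) - ι (ι.toContinuousLinearMap.adjoint (y - z))‖ ≤ η * ‖y - z‖

theorem abs_det_le_one_of_contraction {m : ℕ} (T : Euc m →L[ℝ] Euc m) (hT : ∀ x, ‖T x‖ ≤ ‖x‖) :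
    |T.det| ≤ 1 := by
  have h := Measure.addHaar_image_continuousLinearMap (μ := (volume : Measure (Euc m))) T (ball 0 1)
  have h2 : T '' ball 0 1 ⊆ ball 0 1 := by
    rintro _ ⟨x, hx, rfl⟩
    simp only [mem_ball_zero_iff] at hx ⊢
    exact (hT x).trans_lt hx
  have h3 := measure_mono (μ := (volume : Measure (Euc m))) h2
  rw [h] at h3
  have hpos : volume (ball (0 : Euc m) 1) ≠ 0 := (measure_ball_pos _ _ one_pos).ne'
  have hfin : volume (ball (0 : Euc m) 1) ≠ ⊤ := measure_ball_lt_top.ne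
  have h4 : ENNReal.ofReal |T.det| ≤ 1 := by
    by_contra hc
    push Not at hc
    have := ENNReal.mul_lt_mul_left hpos hfin hc
    rw [one_mul] at this
    exact absurd h3 (not_le.mpr this)
  simpa using h4

theorem sum_abs_det_coordProj {m n : ℕ} (ι : Euc m →ₗᵢ[ℝ] Euc n) :
    (m.factorial : ℝ) ≤
      ∑ f : Fin m ↪ Fin n, |((coordProj f).comp ι.toContinuousLinearMap).det| := by
  classical
  set X : Matrix (Fin n) (Fin m) ℝ := fun a i => ι (EuclideanSpace.single i 1) a with hX
  have hXX : X.transpose * X = 1 := by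
    ext i l
    have : inner ℝ (ι (EuclideanSpace.single i 1)) (ι (EuclideanSpace.single l (1:ℝ)))
        = if i = l then (1:ℝ) else 0 := by
      rw [ι.inner_map_map]
      simp [EuclideanSpace.inner_single_left]
    rw [Matrix.mul_apply, Matrix.one_apply, ← this, PiLp.inner_apply]
    exact Finset.sum_congr rfl fun a _ => mul_comm _ _
  have hdet : ∀ f : Fin m → Fin n, ((coordProj f).comp ι.toContinuousLinearMap).det
      = (X.submatrix f id).det := by
    intro f
    rw [ContinuousLinearMap.det,
      ← LinearMap.det_toMatrix (EuclideanSpace.basisFun (Fin m) ℝ).toBasis]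
    congr 1
  have h := sum_det_submatrix_sq X
  rw [hXX, Matrix.det_one, mul_one] at h
  rw [← h]
  have h0 : ∑ f : Fin m → Fin n, (X.submatrix f id).det ^ 2
      = ∑ f : Fin m ↪ Fin n, (X.submatrix f id).det ^ 2 := by
    refine (Fintype.sum_of_injective (fun f : Fin m ↪ Fin n => (f : Fin m → Fin n))
      DFunLike.coe_injective _ _ (fun f hf => ?_) (fun f => rfl)).symm
    have hf' : ¬ Function.Injective f := fun hi => hf ⟨⟨f, hi⟩, rfl⟩
    simp only [Function.Injective, not_forall] at hf'
    obtain ⟨a, b, hab, hne⟩ := hf'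
    rw [Matrix.det_zero_of_row_eq hne (by ext i; simp [hab])]
    simp
  rw [h0]
  refine Finset.sum_le_sum fun f _ => ?_
  rw [← hdet]
  have h1 : |((coordProj f).comp ι.toContinuousLinearMap).det| ≤ 1 :=
    abs_det_le_one_of_contraction _ fun x => by
      simpa using norm_coordProj_le f (ι x)
  rw [← sq_abs]
  nlinarith [abs_nonneg ((coordProj f).comp ι.toContinuousLinearMap).det]

instance isAddHaarMeasure_hausdorff_euc (m : ℕ) :
    (μH[(m : ℝ)] : Measure (Euc m)).IsAddHaarMeasure := by
  simpa using isAddHaarMeasure_hausdorffMeasure (E := EuclideanSpace ℝ (Fin m))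

/-- Near a point with an `m`-dimensional tangent plane, the total measure of the coordinate
projections controls the `m`-dimensional Hausdorff measure. -/
theorem HasTangentPlane.hausdorffMeasure_le_sum_coordProj {m n : ℕ} {S : Set (Euc n)} {x : Euc n}
    {ι : Euc m →ₗᵢ[ℝ] Euc n} (h : HasTangentPlane S x ι) {c : ℝ≥0} (hc : c < m.factorial) :
    ∃ W : Set (Euc n), IsOpen W ∧ x ∈ W ∧ ∀ s ⊆ S ∩ W,
      (c : ℝ≥0∞) * μH[(m : ℝ)] s ≤ ∑ f : Fin m ↪ Fin n, μH[(m : ℝ)] (coordProj f '' s) := by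
  classical
  set A : (Fin m ↪ Fin n) → (Euc m →L[ℝ] Euc m) :=
    fun f => (coordProj f).comp ι.toContinuousLinearMap with hA
  obtain ⟨c', hcc', hc'⟩ := exists_between hc
  set ν : ℝ := ((Fintype.card (Fin m ↪ Fin n) : ℕ) : ℝ) with hν
  have hν0 : 0 ≤ ν := Nat.cast_nonneg _
  obtain ⟨ε, hε, hεc⟩ : ∃ ε : ℝ, 0 < ε ∧ (c' : ℝ) ≤ m.factorial - ν * ε := by
    have : (c' : ℝ) < m.factorial := by exact_mod_cast hc'
    refine ⟨(m.factorial - c') / (ν + 1), by apply div_pos <;> linarith, ?_⟩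
    have : ν * ((m.factorial - c') / (ν + 1)) ≤ m.factorial - c' := by
      rw [mul_div_assoc', div_le_iff₀ (by linarith)]
      nlinarith
    linarith
  set d : (Fin m ↪ Fin n) → ℝ≥0 := fun f => (|(A f).det| - ε).toNNReal with hd
  have hdsum : c' ≤ ∑ f, d f := by
    rw [← NNReal.coe_le_coe]
    refine hεc.trans ?_
    push_cast
    have h1 : ∑ f : Fin m ↪ Fin n, (|(A f).det| - ε) ≤ ∑ f, (d f : ℝ) :=
      Finset.sum_le_sum fun f _ => Real.le_coe_toNNReal _
    have h2 := sum_abs_det_coordProj ι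
    rw [Finset.sum_sub_distrib] at h1
    simp only [Finset.sum_const, Finset.card_univ, nsmul_eq_mul] at h1
    simp only [hA] at h1 ⊢
    linarith
  have hev : ∀ᶠ δ in 𝓝[>] (0 : ℝ≥0), ∀ f : Fin m ↪ Fin n, ∀ (s : Set (Euc m)) (g : Euc m → Euc m),
      ApproximatesLinearOn g (A f) s δ → (d f : ℝ≥0∞) * μH[(m : ℝ)] s ≤ μH[(m : ℝ)] (g '' s) := by
    rw [Filter.eventually_all]
    intro f
    by_cases hdet : |(A f).det| - ε ≤ 0
    · have : d f = 0 := Real.toNNReal_of_nonpos hdet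
      simp [this]
    · apply mul_le_addHaar_image_of_lt_det
      rw [← ENNReal.ofReal_coe_nnreal]
      push Not at hdet
      rw [ENNReal.ofReal_lt_ofReal_iff (by linarith), hd, Real.coe_toNNReal _ hdet.le]
      linarith
  have hev2 : ∀ᶠ δ in 𝓝[>] (0 : ℝ≥0), c * (1 + δ) ^ m < c' := by
    have : Tendsto (fun δ : ℝ≥0 => c * (1 + δ) ^ m) (𝓝 0) (𝓝 (c * (1 + 0) ^ m)) :=
      Continuous.tendsto (by fun_prop) 0
    apply nhdsWithin_le_nhds
    apply this.eventually_lt_const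
    simpa using hcc'
  have hev3 : ∀ᶠ δ in 𝓝[>] (0 : ℝ≥0), δ < 1 ∧ 0 < δ := by
    filter_upwards [nhdsWithin_le_nhds (Iio_mem_nhds (zero_lt_one : (0 : ℝ≥0) < 1)),
      self_mem_nhdsWithin] with δ h1 h2
    exact ⟨h1, h2⟩
  obtain ⟨δ, hδ, hδ2, hδ1, hδ0⟩ := (hev.and (hev2.and hev3)).exists
  have hδ1' : (δ : ℝ) < 1 := by exact_mod_cast hδ1
  have hδ0' : (0 : ℝ) < δ := by exact_mod_cast hδ0
  obtain ⟨W, hWo, hxW, hW⟩ := h (δ / 2) (by positivity)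
  refine ⟨W, hWo, hxW, fun s hs => ?_⟩
  set pr : Euc n →L[ℝ] Euc m := ι.toContinuousLinearMap.adjoint with hpr
  have hlow : ∀ y ∈ s, ∀ z ∈ s, ‖y - z‖ ≤ (1 + δ) * ‖pr y - pr z‖ := by
    intro y hy z hz
    have h1 := hW y (hs hy) z (hs hz)
    have h2 : ‖y - z‖ ≤ ‖ι (pr (y - z))‖ + ‖(y - z) - ι (pr (y - z))‖ := norm_le_insert' _ _
    rw [ι.norm_map, map_sub] at h2
    have h3 : (1 - δ / 2) * ‖y - z‖ ≤ ‖pr y - pr z‖ := by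
      rw [map_sub] at h1
      linarith
    have h4 : 1 ≤ (1 + δ : ℝ) * (1 - δ / 2) := by nlinarith
    calc ‖y - z‖ ≤ (1 + δ : ℝ) * (1 - δ / 2) * ‖y - z‖ := le_mul_of_one_le_left (norm_nonneg _) h4
      _ = (1 + δ : ℝ) * ((1 - δ / 2) * ‖y - z‖) := by ring
      _ ≤ _ := by gcongr
  have hinj : InjOn pr s := by
    intro y hy z hz hyz
    have := hlow y hy z hz
    rw [hyz, sub_self, norm_zero, mul_zero] at this
    exact sub_eq_zero.mp (norm_le_zero_iff.mp this)
  set g := Function.invFunOn pr s with hg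
  have hgl : ∀ y ∈ s, g (pr y) = y := fun y hy => hinj.leftInvOn_invFunOn hy
  have himg : g '' (pr '' s) = s := hinj.invFunOn_image subset_rfl
  have hμs : μH[(m : ℝ)] s ≤ ((1 + δ : ℝ≥0) : ℝ≥0∞) ^ m * μH[(m : ℝ)] (pr '' s) := by
    have hl : LipschitzOnWith (1 + δ) g (pr '' s) := by
      apply LipschitzOnWith.of_dist_le_mul
      rintro _ ⟨y, hy, rfl⟩ _ ⟨z, hz, rfl⟩
      rw [hgl y hy, hgl z hz, dist_eq_norm, dist_eq_norm]
      simpa using hlow y hy z hz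
    have := hl.hausdorffMeasure_image_le (d := m) (Nat.cast_nonneg _)
    rwa [himg, ENNReal.rpow_natCast] at this
  have happ : ∀ f : Fin m ↪ Fin n,
      ApproximatesLinearOn (fun a => coordProj f (g a)) (A f) (pr '' s) δ := by
    rintro f _ ⟨y, hy, rfl⟩ _ ⟨z, hz, rfl⟩
    beta_reduce
    rw [hgl y hy, hgl z hz]
    have h1 := hW y (hs hy) z (hs hz)
    have h2 : coordProj f y - coordProj f z - A f (pr y - pr z)
        = coordProj f ((y - z) - ι (pr (y - z))) := by
      simp [hA]
    rw [h2]
    refine (norm_coordProj_le f _).trans (h1.trans ?_)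
    have h3 := hlow y hy z hz
    have h4 : (δ / 2 : ℝ) * ‖y - z‖ ≤ δ / 2 * ((1 + δ) * ‖pr y - pr z‖) := by gcongr
    refine h4.trans ?_
    have : (δ / 2 : ℝ) * (1 + δ) ≤ δ := by nlinarith
    rw [← mul_assoc]
    gcongr
  have hper : ∀ f : Fin m ↪ Fin n,
      (d f : ℝ≥0∞) * μH[(m : ℝ)] (pr '' s) ≤ μH[(m : ℝ)] (coordProj f '' s) := by
    intro f
    have := hδ f _ _ (happ f)
    rwa [← image_image (fun a => coordProj f a) g, himg] at this
  calc (c : ℝ≥0∞) * μH[(m : ℝ)] s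
      ≤ c * (((1 + δ : ℝ≥0) : ℝ≥0∞) ^ m * μH[(m : ℝ)] (pr '' s)) := by gcongr
    _ = ((c * (1 + δ) ^ m : ℝ≥0) : ℝ≥0∞) * μH[(m : ℝ)] (pr '' s) := by push_cast; ring
    _ ≤ ((∑ f, d f : ℝ≥0) : ℝ≥0∞) * μH[(m : ℝ)] (pr '' s) := by
        gcongr
        exact hδ2.le.trans hdsum
    _ = ∑ f, (d f : ℝ≥0∞) * μH[(m : ℝ)] (pr '' s) := by
        push_cast
        rw [Finset.sum_mul]
    _ ≤ _ := Finset.sum_le_sum fun f _ => hper f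

theorem IsLocallyClosed.isSigmaCompact_euc {n : ℕ} {s : Set (Euc n)} (hs : IsLocallyClosed s) :
    IsSigmaCompact s := by
  rw [isSigmaCompact_iff_sigmaCompactSpace]
  have := hs.locallyCompactSpace
  infer_instance

theorem IsSigmaCompact.measurableSet_euc {n : ℕ} {s : Set (Euc n)} (hs : IsSigmaCompact s) :
    MeasurableSet s := by
  obtain ⟨K, hK, rfl⟩ := hs
  exact MeasurableSet.iUnion fun i => (hK i).measurableSet

/-- Pairwise disjoint sets whose images under `π` cover each point at most `M` times. -/
theorem tsum_measure_image_le {X Y κ : Type*} [MeasurableSpace Y] (μ : Measure Y) [Countable κ]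
    (π : X → Y) (s : κ → Set X) (hdisj : Pairwise (Function.onFun Disjoint s))
    (hmeas : ∀ i, MeasurableSet (π '' s i))
    (B : Set Y) (hB : ∀ i, π '' s i ⊆ B) (M : ℕ)
    (hM : ∀ c : Y, ∀ t : Finset X, (↑t ⊆ ⋃ i, s i) → (∀ y ∈ t, π y = c) → t.card ≤ M) :
    ∑' i, μ (π '' s i) ≤ M * μ B := by
  classical
  have h1 : ∑' i, μ (π '' s i) = ∫⁻ c, ∑' i, (π '' s i).indicator 1 c ∂μ := by
    rw [lintegral_tsum fun i => ((measurable_one.indicator (hmeas i)).aemeasurable)]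
    exact tsum_congr fun i => (lintegral_indicator_one (hmeas i)).symm
  rw [h1]
  have h2 : ∀ c, ∑' i, (π '' s i).indicator (1 : Y → ℝ≥0∞) c ≤
      B.indicator (fun _ => (M : ℝ≥0∞)) c := by
    intro c
    by_cases hc : c ∈ B
    · rw [indicator_of_mem hc, ENNReal.tsum_eq_iSup_sum]
      refine iSup_le fun F => ?_
      set F' := F.filter (fun i => c ∈ π '' s i) with hF'
      have h3 : ∑ i ∈ F, (π '' s i).indicator (1 : Y → ℝ≥0∞) c = F'.card := by
        simp [indicator_apply, hF']
      rw [h3]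
      have h4 : ∀ i : F', ∃ y ∈ s i, π y = c := fun i => (Finset.mem_filter.mp i.2).2
      choose y hy hyc using h4
      have hinj : Function.Injective y := by
        intro i l hil
        by_contra hne
        have hne' : (i : κ) ≠ l := fun h => hne (Subtype.ext h)
        exact (Set.disjoint_left.mp (hdisj hne') (hy i)) (hil ▸ hy l)
      have h5 := hM c (Finset.univ.image y)
        (by
          intro z hz
          obtain ⟨i, -, rfl⟩ := Finset.mem_image.mp (Finset.mem_coe.mp hz)
          exact mem_iUnion.mpr ⟨i, hy i⟩)
        (by
          intro z hz
          obtain ⟨i, -, rfl⟩ := Finset.mem_image.mp hz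
          exact hyc i)
      rw [Finset.card_image_of_injective _ hinj, Finset.card_univ, Fintype.card_coe] at h5
      exact_mod_cast h5
    · rw [indicator_of_notMem hc]
      simp only [nonpos_iff_eq_zero, ENNReal.tsum_eq_zero]
      intro i
      exact indicator_of_notMem (fun h => hc (hB i h)) _
  exact (lintegral_mono h2).trans (lintegral_indicator_const_le _ _)

/-- A set with `m`-dimensional tangent planes, all of whose coordinate fibres have at most
`M` points, has Hausdorff measure controlled by that of the `m`-dimensional ball. -/
theorem factorial_mul_hausdorffMeasure_le {m n : ℕ} {κ : Type*} [Countable κ]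
    (S : κ → Set (Euc n)) (hlc : ∀ j, IsLocallyClosed (S j))
    (hdisj : Pairwise (Function.onFun Disjoint S))
    (htan : ∀ j, ∀ x ∈ S j, ∃ ι : Euc m →ₗᵢ[ℝ] Euc n, HasTangentPlane (S j) x ι)
    (M : ℕ) (ρ : ℝ) (hb : ∀ j, S j ⊆ ball 0 ρ)
    (hM : ∀ f : Fin m ↪ Fin n, ∀ c : Euc m, ∀ t : Finset (Euc n), (↑t ⊆ ⋃ j, S j) →
      (∀ y ∈ t, coordProj f y = c) → t.card ≤ M) :
    (m.factorial : ℝ≥0∞) * μH[(m : ℝ)] (⋃ j, S j) ≤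
      (n.descFactorial m : ℝ≥0∞) * (M * μH[(m : ℝ)] (ball (0 : Euc m) ρ)) := by
  classical
  refine ENNReal.mul_le_of_forall_lt fun a' ha' b' hb' => ?_
  obtain ⟨c, rfl⟩ : ∃ c : ℝ≥0, (c : ℝ≥0∞) = a' :=
    ⟨a'.toNNReal, ENNReal.coe_toNNReal (ha'.trans_le le_top).ne⟩
  have hc : c < m.factorial := by exact_mod_cast ha'
  refine (mul_le_mul' le_rfl hb'.le).trans ?_
  have hcov : ∀ j, ∃ W : ℕ → Set (Euc n), (∀ i, IsOpen (W i) ∧ ∀ s ⊆ S j ∩ W i,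
      (c : ℝ≥0∞) * μH[(m : ℝ)] s ≤ ∑ f : Fin m ↪ Fin n, μH[(m : ℝ)] (coordProj f '' s)) ∧
      S j ⊆ ⋃ i, W i := by
    intro j
    have h1 : ∀ x : Euc n, ∃ W : Set (Euc n), (x ∈ S j → IsOpen W ∧ x ∈ W ∧ ∀ s ⊆ S j ∩ W,
        (c : ℝ≥0∞) * μH[(m : ℝ)] s ≤ ∑ f : Fin m ↪ Fin n, μH[(m : ℝ)] (coordProj f '' s)) := by
      intro x
      by_cases hx : x ∈ S j
      · obtain ⟨ι, hι⟩ := htan j x hx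
        obtain ⟨W, hW⟩ := hι.hausdorffMeasure_le_sum_coordProj hc
        exact ⟨W, fun _ => hW⟩
      · exact ⟨∅, fun h => absurd h hx⟩
    choose W hW using h1
    obtain ⟨t, htS, htc, ht⟩ := TopologicalSpace.countable_cover_nhdsWithin (s := S j) (f := W)
      fun x hx => mem_nhdsWithin_of_mem_nhds ((hW x hx).1.mem_nhds (hW x hx).2.1)
    obtain ⟨w, hw⟩ := ((htc.image W).insert ∅).exists_eq_range ⟨∅, mem_insert _ _⟩
    refine ⟨w, fun i => ?_, ?_⟩
    · have : w i ∈ insert ∅ (W '' t) := hw ▸ mem_range_self i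
      rcases this with h | ⟨x, hx, h⟩
      · rw [h]
        refine ⟨isOpen_empty, fun s hs => ?_⟩
        have : s = ∅ := by simpa using hs
        simp [this]
      · rw [← h]
        exact ⟨(hW x (htS hx)).1, (hW x (htS hx)).2.2⟩
    · intro y hy
      obtain ⟨x, hx, hyx⟩ := mem_iUnion₂.mp (ht hy)
      have : W x ∈ range w := hw ▸ mem_insert_of_mem _ (mem_image_of_mem W hx)
      obtain ⟨i, hi⟩ := this
      exact mem_iUnion.mpr ⟨i, hi ▸ hyx⟩
  choose W hW hWcov using hcov
  set s : κ × ℕ → Set (Euc n) := fun q => S q.1 ∩ disjointed (W q.1) q.2 with hs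
  have hsU : ⋃ q, s q = ⋃ j, S j := by
    ext y
    simp only [hs, mem_iUnion, Prod.exists, mem_inter_iff]
    constructor
    · rintro ⟨j, i, h, -⟩
      exact ⟨j, h⟩
    · rintro ⟨j, h⟩
      have := hWcov j h
      rw [← iUnion_disjointed, mem_iUnion] at this
      obtain ⟨i, hi⟩ := this
      exact ⟨j, i, h, hi⟩
  have hsdisj : Pairwise (Function.onFun Disjoint s) := by
    rintro ⟨j, i⟩ ⟨j', i'⟩ hne
    by_cases hj : j = j'
    · subst hj
      have hi : i ≠ i' := fun h => hne (by rw [h])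
      exact (disjoint_disjointed (W j) hi).mono inter_subset_right inter_subset_right
    · exact (hdisj hj).mono inter_subset_left inter_subset_left
  have hsσ : ∀ q, IsSigmaCompact (s q) := by
    rintro ⟨j, i⟩
    apply IsLocallyClosed.isSigmaCompact_euc
    refine (hlc j).inter ?_
    have : disjointed (W j) i = W j i ∩ (⋃ l < i, W j l)ᶜ := by
      rw [disjointed_eq_inter_compl, compl_iUnion₂]
    rw [this]
    exact ((hW j i).1.isLocallyClosed).inter
      (isClosed_compl_iff.mpr (isOpen_biUnion fun l _ => (hW j l).1)).isLocallyClosed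
  have hest : ∀ q, (c : ℝ≥0∞) * μH[(m : ℝ)] (s q) ≤
      ∑ f : Fin m ↪ Fin n, μH[(m : ℝ)] (coordProj f '' s q) := fun q =>
    (hW q.1 q.2).2 _ (inter_subset_inter_right _ (disjointed_subset _ _))
  calc (c : ℝ≥0∞) * μH[(m : ℝ)] (⋃ j, S j)
      ≤ c * ∑' q, μH[(m : ℝ)] (s q) := by
        rw [← hsU]
        gcongr
        exact measure_iUnion_le _
    _ = ∑' q, c * μH[(m : ℝ)] (s q) := ENNReal.tsum_mul_left.symm
    _ ≤ ∑' q, ∑ f : Fin m ↪ Fin n, μH[(m : ℝ)] (coordProj f '' s q) := ENNReal.tsum_le_tsum hest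
    _ = ∑ f : Fin m ↪ Fin n, ∑' q, μH[(m : ℝ)] (coordProj f '' s q) :=
        Summable.tsum_finsetSum fun _ _ => ENNReal.summable
    _ ≤ ∑ f : Fin m ↪ Fin n, (M * μH[(m : ℝ)] (ball (0 : Euc m) ρ)) := by
        refine Finset.sum_le_sum fun f _ => ?_
        refine tsum_measure_image_le _ _ s hsdisj
          (fun q => ((hsσ q).image (coordProj f).continuous).measurableSet_euc) _ ?_ M ?_
        · rintro ⟨j, i⟩ _ ⟨y, hy, rfl⟩
          have := hb j hy.1
          rw [mem_ball_zero_iff] at this ⊢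
          exact (norm_coordProj_le f y).trans_lt this
        · rw [hsU]
          exact hM f
    _ = _ := by
        rw [Finset.sum_const, Finset.card_univ, Fintype.card_embedding_eq]
        simp

theorem ediam_closedBall_le_ofReal {m : ℕ} (x : Euc m) {r : ℝ} (hr : 0 ≤ r) :
    ediam (closedBall x r) ≤ ENNReal.ofReal (2 * r) := by
  rw [← Metric.closedEBall_ofReal hr, ENNReal.ofReal_mul (by norm_num)]
  simpa using ediam_closedEBall_le (x := x) (r := ENNReal.ofReal r)

theorem hausdorffMeasure_ball_le (m : ℕ) {ρ : ℝ} (hρ : 0 < ρ) :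
    μH[(m : ℝ)] (ball (0 : Euc m) ρ) ≤ ENNReal.ofReal ((2 * ρ) ^ m) := by
  set μ : Measure (Euc m) := μH[(m : ℝ)] with hμ
  set B := ball (0 : Euc m) ρ with hB
  set b := μ (closedBall 0 1) with hb
  have hb0 : b ≠ 0 :=
    ((measure_ball_pos μ 0 one_pos).trans_le (measure_mono ball_subset_closedBall)).ne'
  have hbt : b ≠ ⊤ := (isCompact_closedBall _ _).measure_lt_top.ne
  have hcov : ∀ i : ℕ, ∃ (t : Set (Euc m)) (r : Euc m → ℝ), t.Countable ∧ t ⊆ B ∧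
      (∀ x ∈ t, r x ∈ {r | closedBall x r ⊆ B} ∩ Ioo 0 (1 / ((i : ℝ) + 1))) ∧
      μ (B \ ⋃ x ∈ t, closedBall x (r x)) = 0 ∧
      t.PairwiseDisjoint fun x => closedBall x (r x) := by
    intro i
    refine Besicovitch.exists_disjoint_closedBall_covering_ae μ
      (fun x => {r | closedBall x r ⊆ B}) B ?_
      (fun _ => 1 / ((i : ℝ) + 1)) (fun _ _ => by positivity)
    intro x hx δ hδ
    obtain ⟨ε, hε, h⟩ := nhds_basis_closedBall.mem_iff.mp (isOpen_ball.mem_nhds hx)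
    refine ⟨min ε (δ / 2), (closedBall_subset_closedBall (min_le_left _ _)).trans h, ?_, ?_⟩
    · exact lt_min hε (half_pos hδ)
    · exact (min_le_right _ _).trans_lt (half_lt_self hδ)
  choose t r htc htB hr hnull hdisj using hcov
  set Z := ⋃ i, (B \ ⋃ x ∈ t i, closedBall x (r i x)) with hZ
  have hZ0 : μ Z = 0 := measure_iUnion_null hnull
  have hBZ : μ B = μ (B \ Z) := (measure_sdiff_null hZ0).symm
  rw [hBZ]
  have : ∀ i, Countable (t i) := fun i => (htc i).to_subtype
  refine (Measure.hausdorffMeasure_le_liminf_tsum (l := atTop) (m : ℝ) (B \ Z)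
    (fun i : ℕ => ENNReal.ofReal (2 * (1 / ((i : ℝ) + 1)))) ?_
    (fun i (x : t i) => closedBall (x : Euc m) (r i x)) ?_ ?_).trans ?_
  · have : Tendsto (fun i : ℕ => 2 * (1 / ((i : ℝ) + 1))) atTop (𝓝 (2 * 0)) :=
      tendsto_one_div_add_atTop_nhds_zero_nat.const_mul 2
    simpa using ENNReal.tendsto_ofReal this
  · refine Eventually.of_forall fun i x => ?_
    have h0 := (hr i x x.2).2
    refine (ediam_closedBall_le_ofReal _ h0.1.le).trans (ENNReal.ofReal_le_ofReal ?_)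
    gcongr
    exact h0.2.le
  · refine Eventually.of_forall fun i y hy => ?_
    have h1 : y ∉ B \ ⋃ x ∈ t i, closedBall x (r i x) := fun h => hy.2 (mem_iUnion.mpr ⟨i, h⟩)
    have h2 : y ∈ ⋃ x ∈ t i, closedBall x (r i x) := by
      by_contra h
      exact h1 ⟨hy.1, h⟩
    rwa [biUnion_eq_iUnion] at h2
  · refine liminf_le_of_le (by isBoundedDefault) fun c hc => ?_
    obtain ⟨i, hi⟩ := hc.exists
    refine hi.trans ?_
    have hsum : ∑' x : t i, μ (closedBall (x : Euc m) (r i x)) ≤ μ (closedBall 0 ρ) := by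
      rw [← measure_biUnion (htc i) (hdisj i) fun x _ => measurableSet_closedBall]
      refine measure_mono (iUnion₂_subset fun x hx => ?_)
      exact (hr i x hx).1.trans ball_subset_closedBall
    rw [Measure.addHaar_closedBall' μ _ hρ.le, ← hb, finrank_euclideanSpace_fin] at hsum
    have hsum2 : (∑' x : t i, ENNReal.ofReal (r i x ^ m)) * b ≤ ENNReal.ofReal (ρ ^ m) * b := by
      rw [← ENNReal.tsum_mul_right]
      refine le_trans (le_of_eq (tsum_congr fun x => ?_)) hsum
      rw [Measure.addHaar_closedBall' μ _ (hr i x x.2).2.1.le, ← hb, finrank_euclideanSpace_fin]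
    have hsum3 := (ENNReal.mul_le_mul_iff_left hb0 hbt).mp hsum2
    calc _ ≤ ∑' x : t i, ENNReal.ofReal (2 ^ m) * ENNReal.ofReal (r i x ^ m) := by
          refine ENNReal.tsum_le_tsum fun x => ?_
          have h0 : 0 < r i x := (hr i x x.2).2.1
          rw [ENNReal.rpow_natCast, ← ENNReal.ofReal_mul (by positivity), ← mul_pow,
            ENNReal.ofReal_pow (by positivity)]
          gcongr
          exact ediam_closedBall_le_ofReal _ h0.le
      _ ≤ ENNReal.ofReal (2 ^ m) * ENNReal.ofReal (ρ ^ m) := by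
          rw [ENNReal.tsum_mul_left]
          gcongr
      _ = _ := by rw [← ENNReal.ofReal_mul (by positivity), mul_pow]

theorem exists_submodule_finrank_eq {V : Type*} [AddCommGroup V] [Module ℝ V]
    [FiniteDimensional ℝ V]
    (K : Submodule ℝ V) {m : ℕ} (hK : Module.finrank ℝ K ≤ m) (hm : m ≤ Module.finrank ℝ V) :
    ∃ K' : Submodule ℝ V, K ≤ K' ∧ Module.finrank ℝ K' = m := by
  induction m, hK using Nat.le_induction with
  | base => exact ⟨K, le_rfl, rfl⟩
  | succ m hKm ih =>
    obtain ⟨K', hK', hfin⟩ := ih (by omega)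
    have hlt : K' < ⊤ := Submodule.lt_top_of_finrank_lt_finrank (by omega)
    obtain ⟨v, -, hv⟩ := SetLike.exists_of_lt hlt
    refine ⟨K' ⊔ Submodule.span ℝ {v}, hK'.trans le_sup_left, ?_⟩
    have h1 : Module.finrank ℝ K' <
        Module.finrank ℝ (K' ⊔ Submodule.span ℝ {v} : Submodule ℝ V) := by
      apply Submodule.finrank_lt_finrank_of_lt
      refine lt_of_le_of_ne le_sup_left fun h => hv ?_
      rw [h]
      exact Submodule.mem_sup_right (Submodule.mem_span_singleton_self v)
    have h2 := Submodule.finrank_add_le_finrank_add_finrank K' (Submodule.span ℝ {v})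
    have h3 : Module.finrank ℝ (Submodule.span ℝ {v}) ≤ 1 :=
      (finrank_span_le_card {v}).trans (by simp)
    omega

/-- The zero set of a map with strict derivative of corank at most `m` has an `m`-dimensional
tangent plane. -/
theorem exists_hasTangentPlane {m n : ℕ} (hmn : m ≤ n) {F : Type*} [NormedAddCommGroup F]
    [NormedSpace ℝ F] [FiniteDimensional ℝ F] {S : Set (Euc n)} {x : Euc n} {Ψ : Euc n → F}
    {T : Euc n →L[ℝ] F} (hΨ : HasStrictFDerivAt Ψ T x) (hS : ∀ y ∈ S, Ψ y = 0)
    (hker : Module.finrank ℝ (LinearMap.ker T.toLinearMap) ≤ m) :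
    ∃ ι : Euc m →ₗᵢ[ℝ] Euc n, HasTangentPlane S x ι := by
  obtain ⟨K, hK, hKm⟩ := exists_submodule_finrank_eq _ hker (by simpa using hmn)
  set b := (stdOrthonormalBasis ℝ K).reindex (finCongr hKm) with hb
  set ι : Euc m →ₗᵢ[ℝ] Euc n := K.subtypeₗᵢ.comp b.repr.symm.toLinearIsometry with hι
  set pr := ι.toContinuousLinearMap.adjoint with hpr
  have hprι : ∀ a, pr (ι a) = a := fun a => by
    have := ι.adjoint_comp_self
    exact DFunLike.congr_fun this a
  have hKι : ∀ v ∈ K, ι (pr v) = v := by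
    intro v hv
    have : ι (b.repr ⟨v, hv⟩) = v := by simp [hι]
    rw [← this, hprι]
  have hcontr : ∀ w, ‖w - ι (pr w)‖ ≤ ‖w‖ := by
    intro w
    have h1 : inner ℝ (ι (pr w)) (w - ι (pr w)) = 0 := by
      have : inner ℝ (ι.toContinuousLinearMap (pr w)) (w - ι (pr w)) = 0 := by
        rw [← ContinuousLinearMap.adjoint_inner_right, map_sub]
        change inner ℝ (pr w) (pr w - pr (ι (pr w))) = 0
        rw [hprι, sub_self, inner_zero_right]
      exact this
    have h2 := norm_add_sq_eq_norm_sq_add_norm_sq_real h1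
    rw [add_sub_cancel] at h2
    nlinarith [norm_nonneg w, norm_nonneg (w - ι (pr w)), norm_nonneg (ι (pr w))]
  refine ⟨ι, fun η hη => ?_⟩
  obtain ⟨C, hC0, hC⟩ : ∃ C > 0, ∀ v, ∃ k ∈ LinearMap.ker T.toLinearMap, ‖v - k‖ ≤ C * ‖T v‖ := by
    obtain ⟨C, hC0, hC⟩ := ContinuousLinearMap.exists_preimage_norm_le
      (LinearMap.toContinuousLinearMap T.toLinearMap.rangeRestrict) (by
        intro y
        obtain ⟨x, hx⟩ := T.toLinearMap.surjective_rangeRestrict y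
        exact ⟨x, hx⟩)
    refine ⟨C, hC0, fun v => ?_⟩
    obtain ⟨x, hx, hxn⟩ := hC (T.toLinearMap.rangeRestrict v)
    have hx' : T x = T v := congrArg Subtype.val hx
    refine ⟨v - x, by simp [hx'], ?_⟩
    simpa using hxn
  have hev := hΨ.isLittleO.def (c := η / C) (by positivity)
  rw [nhds_prod_eq, Filter.Eventually, Filter.mem_prod_self_iff] at hev
  obtain ⟨W, hW, hWs⟩ := hev
  obtain ⟨W', hW'W, hW'o, hxW'⟩ := _root_.mem_nhds_iff.mp hW
  refine ⟨W', hW'o, hxW', fun y hy z hz => ?_⟩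
  have h1 : ‖T (y - z)‖ ≤ η / C * ‖y - z‖ := by
    have := hWs (show (y, z) ∈ W ×ˢ W from ⟨hW'W hy.2, hW'W hz.2⟩)
    simpa [hS y hy.1, hS z hz.1, norm_sub_rev (T z)] using this
  obtain ⟨k, hk, hkn⟩ := hC (y - z)
  have h2 : (y - z) - ι (pr (y - z)) = ((y - z) - k) - ι (pr ((y - z) - k)) := by
    rw [map_sub pr (y - z) k, map_sub ι, hKι k (hK hk)]
    abel
  change ‖(y - z) - ι (pr (y - z))‖ ≤ _
  rw [h2]
  calc _ ≤ ‖(y - z) - k‖ := hcontr _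
    _ ≤ C * ‖T (y - z)‖ := hkn
    _ ≤ C * (η / C * ‖y - z‖) := by gcongr
    _ = η * ‖y - z‖ := by field_simp

open LineDeriv SchwartzMap FourierTransform

/-- The polynomial function on `Euc n` defined by a multivariate polynomial. -/
def polyFun {n : ℕ} (T : MvPolynomial (Fin n) ℝ) (x : Euc n) : ℝ :=
  MvPolynomial.eval (fun i => x i) T

section polyFun

variable {n : ℕ}

@[simp] lemma polyFun_C (a : ℝ) (x : Euc n) : polyFun (MvPolynomial.C a) x = a := by
  simp [polyFun]

@[simp] lemma polyFun_X (i : Fin n) (x : Euc n) : polyFun (MvPolynomial.X i) x = x i := by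
  simp [polyFun]

@[simp] lemma polyFun_add (S T : MvPolynomial (Fin n) ℝ) (x : Euc n) :
    polyFun (S + T) x = polyFun S x + polyFun T x := by
  simp [polyFun]

@[simp] lemma polyFun_mul (S T : MvPolynomial (Fin n) ℝ) (x : Euc n) :
    polyFun (S * T) x = polyFun S x * polyFun T x := by
  simp [polyFun]

@[simp] lemma polyFun_pow (S : MvPolynomial (Fin n) ℝ) (d : ℕ) (x : Euc n) :
    polyFun (S ^ d) x = polyFun S x ^ d := by
  simp [polyFun]

@[simp] lemma polyFun_zero (x : Euc n) : polyFun (0 : MvPolynomial (Fin n) ℝ) x = 0 := by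
  simp [polyFun]

@[simp] lemma polyFun_one (x : Euc n) : polyFun (1 : MvPolynomial (Fin n) ℝ) x = 1 := by
  simp [polyFun]

@[simp] lemma polyFun_sum {κ : Type*} (s : Finset κ) (T : κ → MvPolynomial (Fin n) ℝ)
    (x : Euc n) : polyFun (∑ i ∈ s, T i) x = ∑ i ∈ s, polyFun (T i) x := by
  simp [polyFun]

lemma hasTemperateGrowth_polyFun (T : MvPolynomial (Fin n) ℝ) :
    (polyFun T).HasTemperateGrowth := by
  induction T using MvPolynomial.induction_on with
  | C a =>
    rw [funext (polyFun_C (n := n) a)]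
    exact Function.HasTemperateGrowth.const a
  | add p q hp hq =>
    rw [funext (polyFun_add p q)]
    exact hp.add hq
  | mul_X p i hp =>
    have : (fun x : Euc n => x i).HasTemperateGrowth :=
      (EuclideanSpace.proj i : Euc n →L[ℝ] ℝ).hasTemperateGrowth
    simp only [funext (polyFun_mul p _), polyFun_X]
    exact hp.mul this

lemma contDiff_polyFun (T : MvPolynomial (Fin n) ℝ) {m : ℕ∞} : ContDiff ℝ m (polyFun T) :=
  (hasTemperateGrowth_polyFun T).1.of_le (by exact_mod_cast le_top)

lemma continuous_polyFun (T : MvPolynomial (Fin n) ℝ) : Continuous (polyFun T) :=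
  (contDiff_polyFun T (m := 0)).continuous

lemma hasFDerivAt_polyFun (T : MvPolynomial (Fin n) ℝ) (x : Euc n) :
    HasFDerivAt (polyFun T) (∑ j, polyFun (MvPolynomial.pderiv j T) x •
      (EuclideanSpace.proj j : Euc n →L[ℝ] ℝ)) x := by
  induction T using MvPolynomial.induction_on with
  | C a => simpa [funext (polyFun_C (n := n) a)] using hasFDerivAt_const a x
  | add p q hp hq =>
    rw [funext (polyFun_add p q)]
    refine (hp.add hq).congr_fderiv ?_
    simp [add_smul, Finset.sum_add_distrib]
  | mul_X p i hp =>
    have h := hp.mul (EuclideanSpace.proj i : Euc n →L[ℝ] ℝ).hasFDerivAt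
    rw [funext (polyFun_mul p _)]
    simp only [polyFun_X]
    refine h.congr_fderiv ?_
    ext v
    simp [MvPolynomial.pderiv_X, Pi.single_apply, Finset.mul_sum, add_mul,
      Finset.sum_add_distrib]
    congr 1
    · refine Eq.symm ((Finset.sum_eq_single i (fun b _ hb => ?_) (by simp)).trans (by simp))
      simp [Ne.symm hb]
    · exact Finset.sum_congr rfl fun _ _ => by ring

lemma fderiv_polyFun_single (T : MvPolynomial (Fin n) ℝ) (x : Euc n) (j : Fin n) :
    fderiv ℝ (polyFun T) x (EuclideanSpace.single j 1) = polyFun (MvPolynomial.pderiv j T) x := by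
  rw [(hasFDerivAt_polyFun T x).fderiv]
  simp

/-- Multiplication of complex Schwartz functions by a real polynomial. -/
def polyMul (T : MvPolynomial (Fin n) ℝ) : 𝓢(Euc n, ℂ) →ₗ[ℝ] 𝓢(Euc n, ℂ) :=
  (smulLeftCLM ℂ (polyFun T)).toLinearMap

@[simp] lemma polyMul_apply (T : MvPolynomial (Fin n) ℝ) (f : 𝓢(Euc n, ℂ)) (x : Euc n) :
    polyMul T f x = polyFun T x • f x :=
  smulLeftCLM_apply_apply (hasTemperateGrowth_polyFun T) f x

lemma integrable_polyFun_smul (T : MvPolynomial (Fin n) ℝ) (f : 𝓢(Euc n, ℂ)) :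
    Integrable (fun x => polyFun T x • f x) := by
  refine ((polyMul T f).integrable (μ := volume)).congr (ae_of_all _ fun x => ?_)
  exact polyMul_apply T f x

/-- A measurable function dominated by a polynomial is integrable against Schwartz functions. -/
lemma integrable_smul_of_le_polyFun {w : Euc n → ℝ} (hw : AEStronglyMeasurable w volume)
    (R : MvPolynomial (Fin n) ℝ) (hR : ∀ x, |w x| ≤ |polyFun R x|) (f : 𝓢(Euc n, ℂ)) :
    Integrable (fun x => w x • f x) := by
  refine (integrable_polyFun_smul R f).mono (hw.smul f.continuous.aestronglyMeasurable)
    (ae_of_all _ fun x => ?_)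
  rw [norm_smul, norm_smul]
  exact mul_le_mul_of_nonneg_right (hR x) (norm_nonneg _)

lemma polyFun_ne_zero {T : MvPolynomial (Fin n) ℝ} (hT : T ≠ 0) : ∃ x, polyFun T x ≠ 0 := by
  by_contra! h
  exact hT (MvPolynomial.funext fun v => by simpa [polyFun] using h (WithLp.toLp 2 v))

lemma polyFun_smul {T : MvPolynomial (Fin n) ℝ} {d : ℕ} (hT : T.IsHomogeneous d) (c : ℝ)
    (x : Euc n) : polyFun T (c • x) = c ^ d * polyFun T x := by
  simp only [polyFun, MvPolynomial.eval_eq', Finset.mul_sum]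
  refine Finset.sum_congr rfl fun α hα => ?_
  have h : ∑ i, α i = d := by
    rw [← hT (MvPolynomial.mem_support_iff.1 hα), Finsupp.weight_apply, Finsupp.sum_fintype] <;>
    simp
  simp only [PiLp.smul_apply, smul_eq_mul, mul_pow, Finset.prod_mul_distrib,
    Finset.prod_pow_eq_pow_sum, h]
  ring

lemma ae_polyFun_ne_zero {T : MvPolynomial (Fin n) ℝ} {d : ℕ} (hd : T.IsHomogeneous d)
    (hT : T ≠ 0) : ∀ᵐ x, polyFun T x ≠ 0 := by
  obtain ⟨v, hv⟩ := polyFun_ne_zero hT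
  have hs : MeasurableSet {x : Euc n | polyFun T x ≠ 0} :=
    ((continuous_polyFun T).isOpen_preimage _ isOpen_ne).measurableSet
  refine ae_mem_of_ae_add_linearMap_mem (LinearMap.toSpanSingleton ℝ (Euc n) v) volume volume
    hs fun y => ?_
  set q : Polynomial ℝ :=
    MvPolynomial.aeval (fun i => Polynomial.C (y i) + Polynomial.X * Polynomial.C (v i)) T
  have hq : ∀ t, q.eval t = polyFun T (y + t • v) := fun t => by
    simp only [q, polyFun]
    rw [← Polynomial.coe_evalRingHom, MvPolynomial.aeval_def, MvPolynomial.hom_eval₂,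
      MvPolynomial.eval]
    simp only [MvPolynomial.coe_eval₂Hom]
    congr 1
    · ext; simp
    · ext i; simp; ring
  have hq0 : q ≠ 0 := fun h0 => by
    have h1 : ∀ s : ℝ, s ≠ 0 → polyFun T (v + s • y) = 0 := fun s hs => by
      have e : v + s • y = s • (y + s⁻¹ • v) := by
        rw [smul_add, smul_smul, mul_inv_cancel₀ hs, one_smul, add_comm]
      rw [e, polyFun_smul hd, ← hq, h0]
      simp
    have hc : Continuous fun s : ℝ => polyFun T (v + s • y) :=
      (continuous_polyFun T).comp (by fun_prop)
    have h2 : Tendsto (fun s : ℝ => polyFun T (v + s • y)) (𝓝[≠] 0) (𝓝 (polyFun T v)) := by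
      simpa using (hc.tendsto 0).mono_left nhdsWithin_le_nhds
    refine hv (tendsto_nhds_unique h2 (tendsto_const_nhds.congr' ?_))
    filter_upwards [self_mem_nhdsWithin] with s hs
    exact (h1 s hs).symm
  have hfin : {t : ℝ | q.IsRoot t}.Finite := Polynomial.finite_setOfPred_isRoot hq0
  filter_upwards [hfin.measure_zero volume |> measure_eq_zero_iff_ae_notMem.1] with t ht
  change ¬ polyFun T (y + t • v) = 0
  simpa [Polynomial.IsRoot, hq] using ht

end polyFun

section WeakEquation

lemma abs_half_log_le {a δ : ℝ} (hδ : 0 < δ) (hδ1 : δ ≤ 1) :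
    |1 / 2 * Real.log (a ^ 2 + δ)| ≤ (1 + |Real.log δ|) * (1 + a ^ 2) := by
  have h1 : Real.log (a ^ 2 + δ) ≤ a ^ 2 + δ - 1 := Real.log_le_sub_one_of_pos (by positivity)
  have h2 : Real.log δ ≤ Real.log (a ^ 2 + δ) := Real.log_le_log hδ (by nlinarith [sq_nonneg a])
  have h3 := neg_abs_le (Real.log δ)
  have h4 := abs_nonneg (Real.log δ)
  rw [abs_le]
  constructor <;> nlinarith [sq_nonneg a, mul_nonneg h4 (sq_nonneg a)]

lemma abs_mul_half_log_le {a δ : ℝ} (hδ : 0 ≤ δ) (hδ1 : δ ≤ 1) :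
    |a * (1 / 2 * Real.log (a ^ 2 + δ))| ≤ 2 * (1 + a ^ 2) ^ 2 := by
  rcases eq_or_ne a 0 with rfl | ha
  · simp
  have ha2 : 0 < a ^ 2 := by positivity
  have habs : |a| ≤ 1 + a ^ 2 := by
    rw [abs_le]; constructor <;> nlinarith [sq_nonneg (a - 1), sq_nonneg (a + 1)]
  rw [abs_mul, abs_mul, abs_of_pos (by norm_num : (0 : ℝ) < 1 / 2)]
  rcases le_total 1 (a ^ 2 + δ) with h | h
  · have h1 : Real.log (a ^ 2 + δ) ≤ a ^ 2 + δ - 1 := Real.log_le_sub_one_of_pos (by positivity)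
    rw [abs_of_nonneg (Real.log_nonneg h)]
    calc |a| * (1 / 2 * Real.log (a ^ 2 + δ)) ≤ (1 + a ^ 2) * (1 / 2 * a ^ 2) := by
          gcongr
          · exact mul_nonneg (by norm_num) (Real.log_nonneg h)
          · linarith
      _ ≤ _ := by nlinarith
  · have h1 : |Real.log (a ^ 2 + δ)| ≤ |Real.log (a ^ 2)| := by
      have : Real.log (a ^ 2) ≤ Real.log (a ^ 2 + δ) := Real.log_le_log ha2 (by linarith)
      have h3 : Real.log (a ^ 2 + δ) ≤ 0 := Real.log_nonpos (by positivity) h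
      rw [abs_of_nonpos h3, abs_of_nonpos (this.trans h3)]
      linarith
    have h2 : abs (Real.log |a| * |a|) < 1 :=
      Real.abs_log_mul_self_lt _ (abs_pos.2 ha) (by
        rw [abs_le]; constructor <;> nlinarith)
    rw [abs_mul, abs_abs] at h2
    have h4 : |Real.log (a ^ 2)| = 2 * abs (Real.log |a|) := by
      rw [← sq_abs, Real.log_pow, abs_mul]; simp
    rw [h4] at h1
    calc |a| * (1 / 2 * |Real.log (a ^ 2 + δ)|) ≤ |a| * (1 / 2 * (2 * abs (Real.log |a|))) := by
          gcongr
      _ ≤ _ := by nlinarith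

variable {n : ℕ}

lemma abs_mul_log_polyFun_le (h Q : MvPolynomial (Fin n) ℝ) {δ : ℝ} (hδ : 0 ≤ δ) (hδ1 : δ ≤ 1)
    (x : Euc n) :
    |polyFun (h * Q) x * (1 / 2 * Real.log (polyFun h x ^ 2 + δ))| ≤
      |polyFun (MvPolynomial.C 2 * (1 + h ^ 2) ^ 2 * Q) x| := by
  have := abs_mul_half_log_le (a := polyFun h x) hδ hδ1
  simp only [polyFun_mul, polyFun_C, polyFun_pow, polyFun_add, polyFun_one]
  rw [mul_right_comm, abs_mul, abs_mul _ (polyFun Q x),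
    abs_of_nonneg (by positivity : 0 ≤ 2 * (1 + polyFun h x ^ 2) ^ 2)]
  exact mul_le_mul_of_nonneg_right this (abs_nonneg _)

/-- The logarithmic weight `hQ · log |h|`. -/
def logWeight (h Q : MvPolynomial (Fin n) ℝ) (x : Euc n) : ℝ :=
  polyFun (h * Q) x * Real.log (polyFun h x)

lemma logWeight_eq (h Q : MvPolynomial (Fin n) ℝ) (x : Euc n) :
    logWeight h Q x = polyFun (h * Q) x * (1 / 2 * Real.log (polyFun h x ^ 2 + 0)) := by
  simp [logWeight, Real.log_pow]

lemma integrable_logWeight_smul (h Q : MvPolynomial (Fin n) ℝ) (f : 𝓢(Euc n, ℂ)) :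
    Integrable (fun x => logWeight h Q x • f x) := by
  refine integrable_smul_of_le_polyFun ?_ (MvPolynomial.C 2 * (1 + h ^ 2) ^ 2 * Q)
    (fun x => ?_) f
  · exact ((continuous_polyFun _).measurable.mul
      (Real.measurable_log.comp (continuous_polyFun h).measurable)).aestronglyMeasurable
  · exact (logWeight_eq h Q x) ▸ abs_mul_log_polyFun_le h Q le_rfl zero_le_one x

lemma contDiff_half_log (h : MvPolynomial (Fin n) ℝ) {δ : ℝ} (hδ : 0 < δ) :
    ContDiff ℝ 1 (fun x => 1 / 2 * Real.log (polyFun h x ^ 2 + δ)) := by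
  refine contDiff_const.mul (ContDiff.log (((contDiff_polyFun h (m := 1)).pow 2).add
    contDiff_const) fun x => ?_)
  positivity

lemma fderiv_half_log (h : MvPolynomial (Fin n) ℝ) {δ : ℝ} (hδ : 0 < δ) (x : Euc n) (j : Fin n) :
    fderiv ℝ (fun x => 1 / 2 * Real.log (polyFun h x ^ 2 + δ)) x (EuclideanSpace.single j 1) =
      polyFun h x * polyFun (MvPolynomial.pderiv j h) x / (polyFun h x ^ 2 + δ) := by
  have hpos : polyFun h x ^ 2 + δ ≠ 0 := by positivity
  have h1 := ((((hasFDerivAt_polyFun h x).pow 2).add_const δ).log hpos).const_mul (1 / 2)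
  rw [h1.fderiv]
  simp
  ring

lemma sum_integral_half_log (h : MvPolynomial (Fin n) ℝ) (Q : Fin n → MvPolynomial (Fin n) ℝ)
    (hdiv : ∑ j, MvPolynomial.pderiv j (h * Q j) = 0) (ψ : 𝓢(Euc n, ℂ))
    {δ : ℝ} (hδ : 0 < δ) (hδ1 : δ ≤ 1) :
    ∑ j, ∫ x, (polyFun (h * Q j) x * (1 / 2 * Real.log (polyFun h x ^ 2 + δ))) •
        ∂_{EuclideanSpace.single j (1 : ℝ)} ψ x =
      - ∫ x, (polyFun h x ^ 2 / (polyFun h x ^ 2 + δ) *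
        polyFun (∑ j, MvPolynomial.pderiv j h * Q j) x) • ψ x := by
  set u : Euc n → ℝ := fun x => 1 / 2 * Real.log (polyFun h x ^ 2 + δ) with hu
  have huc : ContDiff ℝ 1 u := contDiff_half_log h hδ
  have hub : ∀ x, |u x| ≤ (1 + |Real.log δ|) * (1 + polyFun h x ^ 2) := fun x =>
    abs_half_log_le hδ hδ1
  have hpos : ∀ x, 0 < polyFun h x ^ 2 + δ := fun x => by positivity
  have hint1 : ∀ (T : MvPolynomial (Fin n) ℝ) (f : 𝓢(Euc n, ℂ)),
      Integrable (fun x => (polyFun T x * u x) • f x) := fun T f => by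
    refine integrable_smul_of_le_polyFun (w := fun x => polyFun T x * u x)
      ((continuous_polyFun T).mul huc.continuous).aestronglyMeasurable
      (MvPolynomial.C (1 + |Real.log δ|) * (1 + h ^ 2) * T) (fun x => ?_) f
    simp only [polyFun_mul, polyFun_C, polyFun_pow, polyFun_add, polyFun_one]
    rw [mul_comm, abs_mul, abs_mul _ (polyFun T x),
      abs_of_nonneg (by positivity : 0 ≤ (1 + |Real.log δ|) * (1 + polyFun h x ^ 2))]
    exact mul_le_mul_of_nonneg_right (hub x) (abs_nonneg _)
  have hint2 : ∀ (T : MvPolynomial (Fin n) ℝ) (f : 𝓢(Euc n, ℂ)),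
      Integrable (fun x => (polyFun h x ^ 2 / (polyFun h x ^ 2 + δ) * polyFun T x) • f x) :=
    fun T f => by
    refine integrable_smul_of_le_polyFun (Continuous.aestronglyMeasurable ?_) T (fun x => ?_) f
    · exact (((continuous_polyFun h).pow 2).div (((continuous_polyFun h).pow 2).add
        continuous_const) fun x => (hpos x).ne').mul (continuous_polyFun T)
    · rw [abs_mul]
      refine mul_le_of_le_one_left (abs_nonneg _) ?_
      rw [abs_of_nonneg (by have := hpos x; positivity), div_le_one (hpos x)]
      linarith
  have hder : ∀ j x, fderiv ℝ (fun x => polyFun (h * Q j) x * u x) x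
      (EuclideanSpace.single j 1) = polyFun (MvPolynomial.pderiv j (h * Q j)) x * u x +
      polyFun h x ^ 2 / (polyFun h x ^ 2 + δ) * polyFun (MvPolynomial.pderiv j h * Q j) x := by
    intro j x
    have h1 := (hasFDerivAt_polyFun (h * Q j) x).differentiableAt
    have h2 := huc.differentiable (by norm_num) x
    have h3 := fderiv_half_log h hδ x j
    have h4 := fderiv_polyFun_single (h * Q j) x j
    rw [fderiv_fun_mul h1 h2]
    simp only [_root_.add_apply, _root_.smul_apply, smul_eq_mul]
    rw [h3, h4]
    simp only [polyFun_mul]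
    ring
  have hibp : ∀ j, ∫ x, (polyFun (h * Q j) x * u x) •
        ∂_{EuclideanSpace.single j (1 : ℝ)} ψ x =
      - ((∫ x, (polyFun (MvPolynomial.pderiv j (h * Q j)) x * u x) • ψ x) +
        ∫ x, (polyFun h x ^ 2 / (polyFun h x ^ 2 + δ) *
          polyFun (MvPolynomial.pderiv j h * Q j) x) • ψ x) := by
    intro j
    have hf : Differentiable ℝ (fun x => polyFun (h * Q j) x * u x) := fun x =>
      ((hasFDerivAt_polyFun (h * Q j) x).differentiableAt).mul
        (huc.differentiable (by norm_num) x)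
    have := integral_smul_fderiv_eq_neg_fderiv_smul_of_integrable (μ := volume)
      (f := fun x => polyFun (h * Q j) x * u x) (g := ψ) (v := EuclideanSpace.single j (1 : ℝ))
      (by
        simp only [hder, add_smul]
        exact (hint1 _ ψ).add (hint2 _ ψ))
      (by simpa only [lineDerivOp_apply_eq_fderiv] using
        hint1 (h * Q j) (∂_{EuclideanSpace.single j (1 : ℝ)} ψ)) (hint1 _ ψ)
      (fun x _ => hf x) (fun x _ => ψ.differentiableAt)
    simp only [lineDerivOp_apply_eq_fderiv]
    rw [this]
    simp only [hder, add_smul]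
    rw [integral_add (hint1 _ ψ) (hint2 _ ψ)]
  rw [Finset.sum_congr rfl fun j _ => hibp j, Finset.sum_neg_distrib, Finset.sum_add_distrib,
    ← integral_finsetSum _ fun j _ => hint1 _ ψ, ← integral_finsetSum _ fun j _ => hint2 _ ψ]
  simp only [← Finset.sum_smul, ← Finset.sum_mul, ← Finset.mul_sum, ← polyFun_sum, hdiv]
  simp

/-- If `∑ⱼ ∂ⱼ(hQⱼ) = 0` then `∑ⱼ ∂ⱼ(hQⱼ log |h|) = ∑ⱼ Qⱼ ∂ⱼh` weakly. -/
lemma sum_integral_logWeight {h : MvPolynomial (Fin n) ℝ} {d : ℕ} (hd : h.IsHomogeneous d)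
    (h0 : h ≠ 0) (Q : Fin n → MvPolynomial (Fin n) ℝ)
    (hdiv : ∑ j, MvPolynomial.pderiv j (h * Q j) = 0) (ψ : 𝓢(Euc n, ℂ)) :
    ∑ j, ∫ x, logWeight h (Q j) x • ∂_{EuclideanSpace.single j (1 : ℝ)} ψ x =
      - ∫ x, polyFun (∑ j, MvPolynomial.pderiv j h * Q j) x • ψ x := by
  have hev : ∀ᶠ δ : ℝ in 𝓝[>] 0, 0 < δ ∧ δ ≤ 1 := by
    filter_upwards [Ioc_mem_nhdsGT zero_lt_one] with δ hδ using hδ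
  have hpos : ∀ x {δ : ℝ}, 0 < δ → 0 < polyFun h x ^ 2 + δ := fun x δ hδ => by positivity
  have hL : Tendsto (fun δ : ℝ => ∑ j, ∫ x, (polyFun (h * Q j) x *
      (1 / 2 * Real.log (polyFun h x ^ 2 + δ))) • ∂_{EuclideanSpace.single j (1 : ℝ)} ψ x)
      (𝓝[>] 0)
      (𝓝 (∑ j, ∫ x, logWeight h (Q j) x • ∂_{EuclideanSpace.single j (1 : ℝ)} ψ x)) := by
    refine tendsto_finsetSum _ fun j _ => ?_
    refine tendsto_integral_filter_of_dominated_convergence _ ?_ ?_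
      (integrable_polyFun_smul (MvPolynomial.C 2 * (1 + h ^ 2) ^ 2 * Q j)
        (∂_{EuclideanSpace.single j (1 : ℝ)} ψ)).norm ?_
    · filter_upwards [hev] with δ hδ
      exact (((continuous_polyFun _).mul (contDiff_half_log h hδ.1).continuous).smul
        (SchwartzMap.continuous _)).aestronglyMeasurable
    · filter_upwards [hev] with δ hδ
      refine ae_of_all _ fun x => ?_
      rw [norm_smul, norm_smul]
      exact mul_le_mul_of_nonneg_right
        (abs_mul_log_polyFun_le h (Q j) hδ.1.le hδ.2 x) (norm_nonneg _)
    · refine ae_of_all _ fun x => ?_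
      simp only [logWeight_eq]
      refine Tendsto.smul_const ?_ _
      rcases eq_or_ne (polyFun h x) 0 with hx | hx
      · simp [hx]
      · refine (tendsto_const_nhds.mul (tendsto_const_nhds.mul ?_))
        refine Tendsto.log ?_ (by positivity)
        exact tendsto_const_nhds.add (tendsto_id.mono_left nhdsWithin_le_nhds)
  have hR : Tendsto (fun δ : ℝ => - ∫ x, (polyFun h x ^ 2 / (polyFun h x ^ 2 + δ) *
        polyFun (∑ j, MvPolynomial.pderiv j h * Q j) x) • ψ x) (𝓝[>] 0)
      (𝓝 (- ∫ x, polyFun (∑ j, MvPolynomial.pderiv j h * Q j) x • ψ x)) := by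
    refine Tendsto.neg ?_
    refine tendsto_integral_filter_of_dominated_convergence _ ?_ ?_
      (integrable_polyFun_smul (∑ j, MvPolynomial.pderiv j h * Q j) ψ).norm ?_
    · filter_upwards [hev] with δ hδ
      exact (((((continuous_polyFun h).pow 2).div (((continuous_polyFun h).pow 2).add
        continuous_const) fun x => (hpos x hδ.1).ne').mul (continuous_polyFun _)).smul
        ψ.continuous).aestronglyMeasurable
    · filter_upwards [hev] with δ hδ
      refine ae_of_all _ fun x => ?_
      have := hpos x hδ.1
      rw [norm_smul, norm_smul, norm_mul]
      refine mul_le_mul_of_nonneg_right (mul_le_of_le_one_left (norm_nonneg _) ?_) (norm_nonneg _)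
      rw [Real.norm_of_nonneg (by positivity), div_le_one this]
      linarith [hδ.1]
    · filter_upwards [ae_polyFun_ne_zero hd h0] with x hx
      refine Tendsto.smul_const ?_ _
      have h1 : Tendsto (fun δ : ℝ => polyFun h x ^ 2 / (polyFun h x ^ 2 + δ)) (𝓝[>] 0)
          (𝓝 (polyFun h x ^ 2 / (polyFun h x ^ 2 + 0))) :=
        tendsto_const_nhds.div
          (tendsto_const_nhds.add (tendsto_id.mono_left nhdsWithin_le_nhds)) (by positivity)
      rw [add_zero, div_self (by positivity)] at h1
      simpa using h1.mul_const (polyFun (∑ j, MvPolynomial.pderiv j h * Q j) x)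
  refine tendsto_nhds_unique hL (hR.congr' ?_)
  filter_upwards [hev] with δ hδ
  exact (sum_integral_half_log h Q hdiv ψ hδ.1 hδ.2).symm

end WeakEquation

section FourierSupport

variable {n : ℕ}

/-- Integration of Schwartz functions against a polynomial. -/
def polyPairing (T : MvPolynomial (Fin n) ℝ) : 𝓢(Euc n, ℂ) →ₗ[ℂ] ℂ where
  toFun f := ∫ x, polyFun T x • f x
  map_add' f g := by
    simp only [_root_.add_apply, smul_add]
    exact integral_add (integrable_polyFun_smul T f) (integrable_polyFun_smul T g)
  map_smul' c f := by
    simp only [_root_.smul_apply, smul_comm _ c, RingHom.id_apply]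
    exact integral_smul c _

/-- Integration of Schwartz functions against a logarithmic weight. -/
def logPairing (h Q : MvPolynomial (Fin n) ℝ) : 𝓢(Euc n, ℂ) →ₗ[ℂ] ℂ where
  toFun f := ∫ x, logWeight h Q x • f x
  map_add' f g := by
    simp only [_root_.add_apply, smul_add]
    exact integral_add (integrable_logWeight_smul h Q f) (integrable_logWeight_smul h Q g)
  map_smul' c f := by
    simp only [_root_.smul_apply, smul_comm _ c, RingHom.id_apply]
    exact integral_smul c _

lemma polyPairing_apply (T : MvPolynomial (Fin n) ℝ) (f : 𝓢(Euc n, ℂ)) :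
    polyPairing T f = ∫ x, polyFun T x • f x := rfl

lemma logPairing_apply (h Q : MvPolynomial (Fin n) ℝ) (f : 𝓢(Euc n, ℂ)) :
    logPairing h Q f = ∫ x, logWeight h Q x • f x := rfl

lemma polyPairing_add (S T : MvPolynomial (Fin n) ℝ) (f : 𝓢(Euc n, ℂ)) :
    polyPairing (S + T) f = polyPairing S f + polyPairing T f := by
  simp only [polyPairing_apply, polyFun_add, add_smul]
  exact integral_add (integrable_polyFun_smul S f) (integrable_polyFun_smul T f)

lemma polyPairing_C_mul (c : ℝ) (T : MvPolynomial (Fin n) ℝ) (f : 𝓢(Euc n, ℂ)) :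
    polyPairing (MvPolynomial.C c * T) f = c • polyPairing T f := by
  simp only [polyPairing_apply, polyFun_mul, polyFun_C, mul_smul]
  exact integral_smul c _

lemma polyPairing_sum {κ : Type*} (s : Finset κ) (T : κ → MvPolynomial (Fin n) ℝ)
    (f : 𝓢(Euc n, ℂ)) : polyPairing (∑ i ∈ s, T i) f = ∑ i ∈ s, polyPairing (T i) f := by
  simp only [polyPairing_apply, polyFun_sum, Finset.sum_smul]
  exact integral_finsetSum _ fun i _ => integrable_polyFun_smul (T i) f

lemma logPairing_sum {κ : Type*} (s : Finset κ) (h : MvPolynomial (Fin n) ℝ) (b : κ → ℝ)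
    (Q : κ → MvPolynomial (Fin n) ℝ) (f : 𝓢(Euc n, ℂ)) :
    logPairing h (∑ i ∈ s, MvPolynomial.C (b i) * Q i) f =
      ∑ i ∈ s, b i • logPairing h (Q i) f := by
  have (x : Euc n) : logWeight h (∑ i ∈ s, MvPolynomial.C (b i) * Q i) x =
      ∑ i ∈ s, b i * logWeight h (Q i) x := by
    simp only [logWeight, polyFun_mul, polyFun_sum, polyFun_C, Finset.mul_sum, Finset.sum_mul]
    exact Finset.sum_congr rfl fun _ _ => by ring
  simp only [logPairing_apply, this, Finset.sum_smul, mul_smul, ← integral_smul]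
  exact integral_finsetSum _ fun i _ => (integrable_logWeight_smul h (Q i) f).smul (b i)

lemma polyMul_mul (S T : MvPolynomial (Fin n) ℝ) (f : 𝓢(Euc n, ℂ)) :
    polyMul (S * T) f = polyMul S (polyMul T f) := by
  ext x; simp [mul_assoc]

lemma polyMul_sum {κ : Type*} (s : Finset κ) (T : κ → MvPolynomial (Fin n) ℝ)
    (f : 𝓢(Euc n, ℂ)) : polyMul (∑ i ∈ s, T i) f = ∑ i ∈ s, polyMul (T i) f := by
  ext x
  simp only [polyMul_apply, polyFun_sum, _root_.sum_apply, Finset.sum_smul]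

lemma inner_euc_single (x : Euc n) (j : Fin n) :
    inner ℝ x (EuclideanSpace.single j (1 : ℝ)) = x j := by
  rw [EuclideanSpace.inner_single_right]; simp

lemma fourier_lineDerivOp_single (f : 𝓢(Euc n, ℂ)) (j : Fin n) :
    𝓕 (∂_{EuclideanSpace.single j (1 : ℝ)} f) =
      (2 * Real.pi * Complex.I) • polyMul (MvPolynomial.X j) (𝓕 f) := by
  rw [SchwartzMap.fourier_lineDerivOp_eq]
  congr 1
  ext x
  rw [smulLeftCLM_apply_apply (by fun_prop), inner_euc_single]
  simp

lemma lineDerivOp_single_fourier (f : 𝓢(Euc n, ℂ)) (j : Fin n) :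
    ∂_{EuclideanSpace.single j (1 : ℝ)} (𝓕 f) =
      (-(2 * Real.pi * Complex.I)) • 𝓕 (polyMul (MvPolynomial.X j) f) := by
  rw [SchwartzMap.lineDerivOp_fourier_eq, ← FourierTransform.fourier_smul]
  congr 2
  ext x
  rw [smulLeftCLM_apply_apply (by fun_prop), inner_euc_single]
  simp

lemma two_pi_I_ne_zero : (2 * Real.pi * Complex.I : ℂ) ≠ 0 := Complex.two_pi_I_ne_zero

lemma polyPairing_mul_X (T : MvPolynomial (Fin n) ℝ) (j : Fin n) (f : 𝓢(Euc n, ℂ)) :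
    polyPairing (T * MvPolynomial.X j) (𝓕 f) =
      (2 * Real.pi * Complex.I)⁻¹ *
        polyPairing T (𝓕 (∂_{EuclideanSpace.single j (1 : ℝ)} f)) := by
  rw [fourier_lineDerivOp_single, map_smul, smul_eq_mul, inv_mul_cancel_left₀ two_pi_I_ne_zero]
  simp [polyPairing_apply, mul_assoc]

lemma polyPairing_one (f : 𝓢(Euc n, ℂ)) : polyPairing 1 (𝓕 f) = f 0 := by
  have h : 𝓕⁻ (𝓕 f) = f := by simp
  conv_rhs => rw [← h]
  rw [fourierInv_coe, Real.fourierInv_eq]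
  simp [polyPairing_apply]

lemma eventuallyEq_zero_lineDerivOp {f : 𝓢(Euc n, ℂ)} (hf : f =ᶠ[𝓝 0] 0) (v : Euc n) :
    (∂_{v} f : 𝓢(Euc n, ℂ)) =ᶠ[𝓝 0] 0 := by
  filter_upwards [hf.fderiv (𝕜 := ℝ)] with x hx
  rw [lineDerivOp_apply_eq_fderiv, hx]
  simp

lemma polyPairing_fourier_eq_zero (T : MvPolynomial (Fin n) ℝ) {f : 𝓢(Euc n, ℂ)}
    (hf : f =ᶠ[𝓝 0] 0) : polyPairing T (𝓕 f) = 0 := by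
  induction T using MvPolynomial.induction_on generalizing f with
  | C a =>
    rw [← mul_one (MvPolynomial.C a), polyPairing_C_mul, polyPairing_one, hf.self_of_nhds]
    simp
  | add p q hp hq => rw [polyPairing_add, hp hf, hq hf, add_zero]
  | mul_X p i hp =>
    rw [polyPairing_mul_X, hp (eventuallyEq_zero_lineDerivOp hf _), mul_zero]

lemma lineDerivOp_polyMul (p : MvPolynomial (Fin n) ℝ) (f : 𝓢(Euc n, ℂ)) (j : Fin n) :
    ∂_{EuclideanSpace.single j (1 : ℝ)} (polyMul p f) =
      polyMul (MvPolynomial.pderiv j p) f +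
        polyMul p (∂_{EuclideanSpace.single j (1 : ℝ)} f) := by
  ext x
  rw [lineDerivOp_apply_eq_fderiv]
  have e : (polyMul p f : Euc n → ℂ) = fun x => polyFun p x • f x := by
    ext x; exact polyMul_apply p f x
  rw [e, fderiv_fun_smul (hasFDerivAt_polyFun p x).differentiableAt f.differentiableAt]
  simp only [_root_.add_apply, polyMul_apply, lineDerivOp_apply_eq_fderiv,
    ContinuousLinearMap.smulRight_apply, _root_.smul_apply, fderiv_polyFun_single]
  rw [add_comm]

/-- The pairing of a monomial with the Fourier transform of a cut-off polynomial extracts a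
coefficient. -/
lemma exists_polyPairing_monomial (η : 𝓢(Euc n, ℂ)) (hη : η =ᶠ[𝓝 0] 1) (α : Fin n →₀ ℕ) :
    ∃ K : ℂ, K ≠ 0 ∧ ∀ p : MvPolynomial (Fin n) ℝ,
      polyPairing (MvPolynomial.monomial α 1) (𝓕 (polyMul p η)) =
        K * (MvPolynomial.coeff α p : ℝ) := by
  induction hd : α.degree generalizing α with
  | zero =>
    obtain rfl : α = 0 := (Finsupp.degree_eq_zero_iff α).1 hd
    refine ⟨1, one_ne_zero, fun p => ?_⟩
    rw [show MvPolynomial.monomial (0 : Fin n →₀ ℕ) (1 : ℝ) = 1 from rfl, polyPairing_one,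
      polyMul_apply, hη.self_of_nhds, ← MvPolynomial.constantCoeff_eq]
    simp [polyFun, ← Pi.zero_def, MvPolynomial.eval_zero]
  | succ d ih =>
    obtain ⟨j, hj⟩ : ∃ j, α j ≠ 0 := by
      by_contra! h
      rw [show α = 0 from Finsupp.ext h] at hd
      simp at hd
    set β := α - Finsupp.single j 1
    have hβ : β + Finsupp.single j 1 = α := by
      refine tsub_add_cancel_of_le ?_
      simpa using Nat.one_le_iff_ne_zero.2 hj
    obtain ⟨K, hK, hKp⟩ := ih β (by
      have := congrArg Finsupp.degree hβ
      rw [map_add, hd] at this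
      simpa using this)
    have hη' : (∂_{EuclideanSpace.single j (1 : ℝ)} η : 𝓢(Euc n, ℂ)) =ᶠ[𝓝 0] 0 := by
      filter_upwards [hη.fderiv (𝕜 := ℝ)] with x hx
      rw [lineDerivOp_apply_eq_fderiv, hx]
      simp
    refine ⟨(2 * Real.pi * Complex.I)⁻¹ * K * (β j + 1), mul_ne_zero
      (mul_ne_zero (inv_ne_zero two_pi_I_ne_zero) hK) (Nat.cast_add_one_ne_zero (β j)),
      fun p => ?_⟩
    have e : MvPolynomial.monomial α (1 : ℝ) = MvPolynomial.monomial β 1 * MvPolynomial.X j := by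
      rw [MvPolynomial.X, MvPolynomial.monomial_mul, hβ, mul_one]
    have hz : polyMul p (∂_{EuclideanSpace.single j (1 : ℝ)} η) =ᶠ[𝓝 0] 0 := by
      filter_upwards [hη'] with x hx
      rw [polyMul_apply, hx]
      simp
    rw [e, polyPairing_mul_X, lineDerivOp_polyMul, FourierTransform.fourier_add, map_add,
      polyPairing_fourier_eq_zero _ hz, add_zero, hKp, MvPolynomial.coeff_pderiv, hβ]
    push_cast
    ring

lemma polyPairing_eq_zero_imp {P : MvPolynomial (Fin n) ℝ} (η : 𝓢(Euc n, ℂ))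
    (hη : η =ᶠ[𝓝 0] 1)
    (h : ∀ β ∈ P.support, polyPairing P (𝓕 (polyMul (MvPolynomial.monomial β 1) η)) = 0) :
    P = 0 := by
  by_contra hP
  obtain ⟨β, hβ⟩ := MvPolynomial.support_nonempty.2 hP
  have h1 := h β hβ
  rw [← MvPolynomial.support_sum_monomial_coeff P, polyPairing_sum,
    Finset.sum_eq_single β] at h1
  · obtain ⟨K, hK, hKp⟩ := exists_polyPairing_monomial η hη β
    rw [← mul_one (MvPolynomial.coeff β P), ← MvPolynomial.C_mul_monomial, polyPairing_C_mul,
      hKp] at h1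
    simp [hK] at h1
    exact MvPolynomial.mem_support_iff.1 hβ h1
  · intro γ _ hγ
    obtain ⟨K, hK, hKp⟩ := exists_polyPairing_monomial η hη γ
    rw [← mul_one (MvPolynomial.coeff γ P), ← MvPolynomial.C_mul_monomial, polyPairing_C_mul,
      hKp]
    simp [MvPolynomial.coeff_monomial, hγ.symm]
  · exact fun h => absurd hβ h

end FourierSupport

/-- A factor of a nonzero homogeneous polynomial is homogeneous. -/
lemma MvPolynomial.IsHomogeneous.of_mul_left_of_ne_zero {σ R : Type*} [CommRing R] [IsDomain R]
    {a b : MvPolynomial σ R} {k : ℕ} (h : (a * b).IsHomogeneous k) (h0 : a * b ≠ 0) :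
    a.IsHomogeneous a.totalDegree := by
  have ha : a ≠ 0 := left_ne_zero_of_mul h0
  have hb : b ≠ 0 := right_ne_zero_of_mul h0
  have hdeg := MvPolynomial.totalDegree_mul_of_isDomain ha hb
  rw [h.totalDegree h0] at hdeg
  have hord := MvPowerSeries.order_mul (a : MvPowerSeries σ R) (b : MvPowerSeries σ R)
  rw [← MvPolynomial.coe_mul] at hord
  have hle : ∀ c : MvPolynomial σ R, c ≠ 0 →
      (c : MvPowerSeries σ R).order ≤ c.totalDegree := fun c hc => by
    obtain ⟨d, hd⟩ := MvPolynomial.support_nonempty.2 hc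
    refine (MvPowerSeries.order_le (d := d) ?_).trans ?_
    · rw [MvPolynomial.coeff_coe]; exact MvPolynomial.mem_support_iff.1 hd
    · exact_mod_cast MvPolynomial.le_totalDegree hd
  have hk : (k : ℕ∞) ≤ ((a * b : MvPolynomial σ R) : MvPowerSeries σ R).order := by
    refine MvPowerSeries.le_order fun d hd => ?_
    rw [MvPolynomial.coeff_coe]
    exact h.coeff_eq_zero (by exact_mod_cast hd.ne)
  rw [hord] at hk
  have hle' := hk.trans (add_le_add_right (hle b hb) _)
  intro d hd
  have h1 : (a : MvPowerSeries σ R).order ≤ d.degree :=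
    MvPowerSeries.order_le (by rwa [MvPolynomial.coeff_coe])
  have h2 : d.degree ≤ a.totalDegree :=
    MvPolynomial.le_totalDegree (MvPolynomial.mem_support_iff.2 hd)
  have h3 := hle'.trans (add_le_add_left h1 _)
  have h4 : k ≤ d.degree + b.totalDegree := by exact_mod_cast h3
  have h5 : Finsupp.weight 1 d = d.degree := by rw [Finsupp.degree_eq_weight_one]; rfl
  omega

section NoCommonFactor

variable {n N : ℕ}

lemma sum_logPairing_row (h : MvPolynomial (Fin n) ℝ) {d : ℕ} (hd : h.IsHomogeneous d)
    (h0 : h ≠ 0) (b : Fin n → Fin N → ℝ) (Q : Fin N → MvPolynomial (Fin n) ℝ)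
    (hb : ∑ j, ∑ l, MvPolynomial.C (b j l) * MvPolynomial.pderiv j (h * Q l) = 0)
    {κ : 𝓢(Euc n, ℂ)} (hκ : κ =ᶠ[𝓝 0] 0) :
    ∑ l, logPairing h (Q l)
      (𝓕 (polyMul (∑ j, MvPolynomial.C (b j l) * MvPolynomial.X j) κ)) = 0 := by
  have h1 := sum_integral_logWeight hd h0 (fun j => ∑ l, MvPolynomial.C (b j l) * Q l) (by
    rw [← hb]
    refine Finset.sum_congr rfl fun j _ => ?_
    rw [Finset.mul_sum, map_sum]
    refine Finset.sum_congr rfl fun l _ => ?_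
    rw [mul_left_comm, MvPolynomial.pderiv_C_mul]) (𝓕 κ)
  simp only [← logPairing_apply, ← polyPairing_apply, polyPairing_fourier_eq_zero _ hκ,
    logPairing_sum, neg_zero, lineDerivOp_single_fourier, map_smul] at h1
  have h2 : ∀ l, logPairing h (Q l)
      (𝓕 (polyMul (∑ j, MvPolynomial.C (b j l) * MvPolynomial.X j) κ)) =
      ∑ j, b j l • logPairing h (Q l) (𝓕 (polyMul (MvPolynomial.X j) κ)) := fun l => by
    have : polyMul (∑ j, MvPolynomial.C (b j l) * MvPolynomial.X j) κ =
        ∑ j, ((b j l : ℝ) : ℂ) • polyMul (MvPolynomial.X j) κ := by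
      ext x
      simp [Finset.sum_mul, _root_.sum_apply, mul_assoc]
    rw [this, ← fourierCLM_apply (R := ℂ), map_sum, map_sum]
    simp
  simp only [h2]
  have h3 : -(2 * Real.pi * Complex.I) * ∑ l, ∑ j,
      b j l • logPairing h (Q l) (𝓕 (polyMul (MvPolynomial.X j) κ)) = 0 := by
    rw [Finset.sum_comm, ← h1]
    simp only [Finset.mul_sum, smul_eq_mul, Complex.real_smul]
  exact (mul_eq_zero.1 h3).resolve_left (neg_ne_zero.2 two_pi_I_ne_zero)

/-- The symbol of a constant coefficient first-order operator as a matrix of linear forms. -/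
def symbolMatrix (B : Fin n → Matrix (Fin N) (Fin N) ℝ) :
    Matrix (Fin N) (Fin N) (MvPolynomial (Fin n) ℝ) :=
  Matrix.of fun i l => ∑ j, MvPolynomial.C (B j i l) * MvPolynomial.X j

lemma polyFun_det_symbolMatrix (B : Fin n → Matrix (Fin N) (Fin N) ℝ) (ξ : Euc n) :
    polyFun (symbolMatrix B).det ξ = (∑ j, ξ j • B j).det := by
  rw [polyFun, RingHom.map_det]
  congr 1
  ext i l
  simp [symbolMatrix, Matrix.sum_apply, mul_comm]

lemma logPairing_det_eq_zero (h : MvPolynomial (Fin n) ℝ) {d : ℕ} (hd : h.IsHomogeneous d)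
    (h0 : h ≠ 0) (B : Fin n → Matrix (Fin N) (Fin N) ℝ) (Q : Fin N → MvPolynomial (Fin n) ℝ)
    (hB : ∀ i, ∑ j, ∑ l, MvPolynomial.C (B j i l) * MvPolynomial.pderiv j (h * Q l) = 0)
    {κ : 𝓢(Euc n, ℂ)} (hκ : κ =ᶠ[𝓝 0] 0) (m : Fin N) :
    logPairing h (Q m) (𝓕 (polyMul (symbolMatrix B).det κ)) = 0 := by
  have h1 : ∀ i, ∑ l, logPairing h (Q l) (𝓕 (polyMul
      ((symbolMatrix B).adjugate m i * symbolMatrix B i l) κ)) = 0 := fun i => by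
    have hκ' : polyMul ((symbolMatrix B).adjugate m i) κ =ᶠ[𝓝 0] 0 := by
      filter_upwards [hκ] with x hx
      rw [polyMul_apply, hx]; simp
    have := sum_logPairing_row h hd h0 (fun j l => B j i l) Q (hB i) hκ'
    simp only [← polyMul_mul, mul_comm _ ((symbolMatrix B).adjugate m i)] at this
    exact this
  have h2 : ∀ l, ∑ i, logPairing h (Q l) (𝓕 (polyMul
      ((symbolMatrix B).adjugate m i * symbolMatrix B i l) κ)) =
      if l = m then logPairing h (Q m) (𝓕 (polyMul (symbolMatrix B).det κ)) else 0 := fun l => by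
    have e : ∑ i, (symbolMatrix B).adjugate m i * symbolMatrix B i l =
        if l = m then (symbolMatrix B).det else 0 := by
      have := congrFun (congrFun (Matrix.adjugate_mul (symbolMatrix B)) m) l
      rw [Matrix.mul_apply] at this
      rw [this]
      simp [Matrix.one_apply, eq_comm]
    rw [← map_sum]
    have e2 : ∑ i, 𝓕 (polyMul ((symbolMatrix B).adjugate m i * symbolMatrix B i l) κ) =
        𝓕 (polyMul (if l = m then (symbolMatrix B).det else 0) κ) := by
      rw [← e, polyMul_sum]
      simp only [← fourierCLM_apply (R := ℂ), map_sum]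
    rw [e2]
    split_ifs with hl
    · rw [hl]
    · have : polyMul (0 : MvPolynomial (Fin n) ℝ) κ = 0 := by ext x; simp
      rw [this, ← fourierCLM_apply (R := ℂ), map_zero, map_zero]
  have h3 := Finset.sum_eq_zero fun i (_ : i ∈ Finset.univ) => h1 i
  rw [Finset.sum_comm] at h3
  simpa [h2] using h3

lemma exists_schwartzMap_eq {g : Euc n → ℂ} (hgc : HasCompactSupport g)
    (hgs : ContDiff ℝ (⊤ : ℕ∞) g) : ∃ f : 𝓢(Euc n, ℂ), ⇑f = g :=
  ⟨hgc.toSchwartzMap hgs, rfl⟩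

lemma contDiff_inv_polyFun_smul {D : MvPolynomial (Fin n) ℝ}
    (hD : ∀ ξ : Euc n, ξ ≠ 0 → polyFun D ξ ≠ 0) {κ : Euc n → ℂ} (hκ : κ =ᶠ[𝓝 0] 0)
    (hs : ContDiff ℝ (⊤ : ℕ∞) κ) :
    ContDiff ℝ (⊤ : ℕ∞) fun x => (polyFun D x)⁻¹ • κ x := by
  rw [contDiff_iff_contDiffAt]
  intro x
  rcases eq_or_ne x 0 with rfl | hx
  · refine (contDiffAt_const (c := (0 : ℂ))).congr_of_eventuallyEq ?_
    filter_upwards [hκ] with x hx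
    simp [hx]
  · exact ((contDiff_polyFun D).contDiffAt.inv (hD x hx)).smul hs.contDiffAt

/-- Test functions supported away from the origin can be divided by a polynomial vanishing only
at the origin. -/
lemma exists_polyMul_eq {D : MvPolynomial (Fin n) ℝ} (hD : ∀ ξ : Euc n, ξ ≠ 0 → polyFun D ξ ≠ 0)
    {κ : 𝓢(Euc n, ℂ)} (hκ : κ =ᶠ[𝓝 0] 0) (hc : HasCompactSupport κ) :
    ∃ κ' : 𝓢(Euc n, ℂ), κ' =ᶠ[𝓝 0] 0 ∧ polyMul D κ' = κ := by
  obtain ⟨f, hf⟩ := exists_schwartzMap_eq (g := fun x => (polyFun D x)⁻¹ • κ x)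
    (hc.smul_left (f := fun x => (polyFun D x)⁻¹))
    (contDiff_inv_polyFun_smul hD hκ (κ.smooth _))
  refine ⟨f, ?_, ?_⟩
  · filter_upwards [hκ] with x hx
    rw [hf]
    simp [hx]
  · ext x
    rw [polyMul_apply, hf]
    rcases eq_or_ne x 0 with rfl | hx
    · simp only [hκ.self_of_nhds]; simp
    · exact smul_inv_smul₀ (hD x hx) _

/-- The logarithmic weights are annihilated by transforms of test functions supported away from
the origin. -/
lemma logPairing_fourier_eq_zero (h : MvPolynomial (Fin n) ℝ) {d : ℕ} (hd : h.IsHomogeneous d)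
    (h0 : h ≠ 0) (B : Fin n → Matrix (Fin N) (Fin N) ℝ)
    (hell : ∀ ξ : Euc n, ξ ≠ 0 → IsUnit (∑ j, ξ j • B j))
    (Q : Fin N → MvPolynomial (Fin n) ℝ)
    (hB : ∀ i, ∑ j, ∑ l, MvPolynomial.C (B j i l) * MvPolynomial.pderiv j (h * Q l) = 0)
    {κ : 𝓢(Euc n, ℂ)} (hκ : κ =ᶠ[𝓝 0] 0) (hc : HasCompactSupport κ) (m : Fin N) :
    logPairing h (Q m) (𝓕 κ) = 0 := by
  obtain ⟨κ', hz, e⟩ := exists_polyMul_eq (D := (symbolMatrix B).det) (fun ξ hξ => by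
    rw [polyFun_det_symbolMatrix]
    exact ((Matrix.isUnit_iff_isUnit_det _).1 (hell ξ hξ)).ne_zero) hκ hc
  rw [← e]
  exact logPairing_det_eq_zero h hd h0 B Q hB hz m

lemma integral_smul_fourier_comp_two_smul (w : Euc n → ℝ) {f g : 𝓢(Euc n, ℂ)}
    (hg : ∀ x, g x = f ((2 : ℝ) • x)) :
    ∫ x, w x • 𝓕 g x = ∫ y, w ((2 : ℝ) • y) • 𝓕 f y := by
  have h1 : ∀ x, 𝓕 g x = |((2 : ℝ) ^ Module.finrank ℝ (Euc n))⁻¹| • 𝓕 f ((2⁻¹ : ℝ) • x) := by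
    intro x
    rw [fourier_coe, fourier_coe, Real.fourier_eq, Real.fourier_eq,
      ← Measure.integral_comp_smul]
    refine integral_congr_ae (ae_of_all _ fun v => ?_)
    simp only [hg, inner_smul_left, inner_smul_right]
    congr 3
    simp
  have h2 := Measure.integral_comp_smul volume
    (fun y : Euc n => w ((2 : ℝ) • y) • 𝓕 f y) (2⁻¹ : ℝ)
  simp only [smul_inv_smul₀ (two_ne_zero' ℝ)] at h2
  have h3 : ∀ x, w x • 𝓕 g x = |((2 : ℝ) ^ Module.finrank ℝ (Euc n))⁻¹| •
      (w x • 𝓕 f ((2⁻¹ : ℝ) • x)) := fun x => by rw [h1, smul_comm]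
  simp_rw [h3]
  rw [integral_smul, h2, smul_smul, ← abs_mul, inv_pow, inv_inv,
    inv_mul_cancel₀ (by positivity), abs_one, one_smul]

lemma logWeight_two_smul {h Q : MvPolynomial (Fin n) ℝ} {d k : ℕ} (hd : h.IsHomogeneous d)
    (hk : (h * Q).IsHomogeneous k) (x : Euc n) :
    logWeight h Q ((2 : ℝ) • x) =
      2 ^ k * logWeight h Q x + 2 ^ k * (d * Real.log 2) * polyFun (h * Q) x := by
  rw [logWeight, logWeight, polyFun_smul hk, polyFun_smul hd]
  rcases eq_or_ne (polyFun h x) 0 with hx | hx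
  · simp [hx]
  · rw [Real.log_mul (by positivity) hx, Real.log_pow]
    ring

lemma exists_schwartzMap_bump (n : ℕ) :
    ∃ η : 𝓢(Euc n, ℂ), η =ᶠ[𝓝 0] 1 ∧ HasCompactSupport η := by
  let b : ContDiffBump (0 : Euc n) := ⟨1, 2, one_pos, one_lt_two⟩
  have hc : HasCompactSupport fun x => (b x : ℂ) :=
    b.hasCompactSupport.comp_left (g := fun r : ℝ => (r : ℂ)) (by simp)
  obtain ⟨f, hf⟩ := exists_schwartzMap_eq hc (Complex.ofRealCLM.contDiff.comp b.contDiff)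
  refine ⟨f, ?_, by rwa [hf]⟩
  filter_upwards [b.eventuallyEq_one] with x hx
  rw [hf]
  simp [hx]

/-- The components of a nonzero homogeneous polynomial solution of a constant coefficient elliptic
first-order system have no common factor. -/
theorem isUnit_of_dvd_elliptic_solution (B : Fin n → Matrix (Fin N) (Fin N) ℝ)
    (hell : ∀ ξ : Euc n, ξ ≠ 0 → IsUnit (∑ j, ξ j • B j))
    (P : Fin N → MvPolynomial (Fin n) ℝ) {k : ℕ} (hP : ∀ l, (P l).IsHomogeneous k)
    (hB : ∀ i, ∑ j, ∑ l, MvPolynomial.C (B j i l) * MvPolynomial.pderiv j (P l) = 0)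
    {m : Fin N} (hm : P m ≠ 0) {h : MvPolynomial (Fin n) ℝ} (hdvd : ∀ l, h ∣ P l) :
    IsUnit h := by
  choose Q hQ using hdvd
  obtain rfl : P = fun l => h * Q l := funext hQ
  have hd : h.IsHomogeneous h.totalDegree := (hP m).of_mul_left_of_ne_zero hm
  have h0 : h ≠ 0 := left_ne_zero_of_mul hm
  rcases Nat.eq_zero_or_pos h.totalDegree with hz | hpos
  · rw [MvPolynomial.totalDegree_eq_zero_iff_eq_C.1 hz] at h0 ⊢
    exact (isUnit_iff_ne_zero.2 (by simpa using h0)).map MvPolynomial.C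
  refine absurd ?_ hm
  obtain ⟨η, hη, hηc⟩ := exists_schwartzMap_bump n
  refine polyPairing_eq_zero_imp η hη fun β hβ => ?_
  have hβk : ((MvPolynomial.monomial β) (1 : ℝ)).IsHomogeneous k :=
    MvPolynomial.isHomogeneous_monomial _ (by
      have := hP m (MvPolynomial.mem_support_iff.1 hβ)
      rwa [Finsupp.degree_eq_weight_one])
  obtain ⟨ζ, hζ⟩ : ∃ ζ, ζ = polyMul (MvPolynomial.monomial β 1) η := ⟨_, rfl⟩
  rw [← hζ]
  have hζc : HasCompactSupport ζ := by
    have : (ζ : Euc n → ℂ) = fun x => polyFun (MvPolynomial.monomial β 1) x • η x := by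
      rw [hζ]; ext x; simp
    rw [this]
    exact hηc.smul_left (f := fun x => polyFun (MvPolynomial.monomial β 1) x)
  have hζc' := hζc.comp_smul (two_ne_zero' ℝ)
  obtain ⟨ζ₂, hζ₂⟩ := exists_schwartzMap_eq hζc'
    ((ζ.smooth _).comp (contDiff_const_smul (2 : ℝ)))
  have hζ₂' : ∀ x, ζ₂ x = ζ ((2 : ℝ) • x) := fun x => by rw [hζ₂]
  have hz : (((2 : ℂ) ^ k) • ζ - ζ₂ : 𝓢(Euc n, ℂ)) =ᶠ[𝓝 0] 0 := by
    have hη2 : ∀ᶠ x in 𝓝 (0 : Euc n), η ((2 : ℝ) • x) = 1 := by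
      have : Tendsto (fun x : Euc n => (2 : ℝ) • x) (𝓝 0) (𝓝 0) := by
        simpa using (continuous_const_smul (2 : ℝ)).tendsto (0 : Euc n)
      exact this.eventually hη
    filter_upwards [hη, hη2] with x h1 h2
    simp only [_root_.sub_apply, _root_.smul_apply, hζ₂', hζ, polyMul_apply,
      polyFun_smul hβk, h1, h2]
    simp
  have hcs : HasCompactSupport (((2 : ℂ) ^ k) • ζ - ζ₂ : 𝓢(Euc n, ℂ)) := by
    refine HasCompactSupport.sub (f := fun x => (2 : ℂ) ^ k • ζ x) (f' := ζ₂) ?_ ?_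
    · exact hζc.smul_left (f := fun _ => (2 : ℂ) ^ k)
    · rw [hζ₂]; exact hζc'
  have key := logPairing_fourier_eq_zero h hd h0 B hell Q hB hz hcs m
  rw [← fourierCLM_apply (R := ℂ), map_sub, map_smul, map_sub, map_smul, fourierCLM_apply,
    fourierCLM_apply, logPairing_apply, logPairing_apply,
    integral_smul_fourier_comp_two_smul _ hζ₂'] at key
  have hsplit : ∀ x : Euc n, logWeight h (Q m) ((2 : ℝ) • x) • 𝓕 ζ x =
      (2 : ℝ) ^ k • (logWeight h (Q m) x • 𝓕 ζ x) +
        ((2 : ℝ) ^ k * (h.totalDegree * Real.log 2)) • (polyFun (h * Q m) x • 𝓕 ζ x) := fun x => by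
    rw [logWeight_two_smul hd (hP m), add_smul, mul_smul, mul_smul _ (polyFun _ _)]
  have hlog_int : ∫ x, logWeight h (Q m) ((2 : ℝ) • x) • 𝓕 ζ x =
      (2 : ℝ) ^ k • logPairing h (Q m) (𝓕 ζ) +
        ((2 : ℝ) ^ k * (h.totalDegree * Real.log 2)) • polyPairing (h * Q m) (𝓕 ζ) := by
    simp only [hsplit, logPairing_apply, polyPairing_apply]
    rw [← integral_smul, ← integral_smul]
    exact integral_add ((integrable_logWeight_smul h (Q m) (𝓕 ζ)).smul ((2 : ℝ) ^ k))
      ((integrable_polyFun_smul (h * Q m) (𝓕 ζ)).smul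
        ((2 : ℝ) ^ k * (h.totalDegree * Real.log 2)))
  rw [hlog_int, ← logPairing_apply] at key
  have hlog : Real.log 2 ≠ 0 := (Real.log_pos one_lt_two).ne'
  have hdeg : (h.totalDegree : ℝ) ≠ 0 := by exact_mod_cast hpos.ne'
  have key' : ((2 : ℝ) ^ k * (h.totalDegree * Real.log 2)) •
      polyPairing (h * Q m) (𝓕 ζ) = 0 := by
    rw [← neg_eq_zero, ← key]
    simp only [Complex.real_smul, smul_eq_mul]
    push_cast
    ring
  exact (smul_eq_zero.1 key').resolve_left (by positivity)

end NoCommonFactor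

/-- If the components of a vector of polynomials have no common factor, a given nonzero component
is relatively prime to some linear combination of all components. -/
lemma exists_isRelPrime_linear_combination {σ : Type*} {N : ℕ}
    (P : Fin N → MvPolynomial σ ℝ) {m : Fin N} (hm : P m ≠ 0)
    (hP : ∀ h, (∀ l, h ∣ P l) → IsUnit h) :
    ∃ b : Fin N → ℝ, IsRelPrime (P m) (∑ l, MvPolynomial.C (b l) * P l) := by
  classical
  let T : (Fin N → ℝ) →ₗ[ℝ] MvPolynomial σ ℝ :=
    ∑ l, (LinearMap.proj l : (Fin N → ℝ) →ₗ[ℝ] ℝ).smulRight (P l)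
  have hT : ∀ b, T b = ∑ l, MvPolynomial.C (b l) * P l := fun b => by
    simp [T, MvPolynomial.smul_eq_C_mul]
  let W : MvPolynomial σ ℝ → Submodule ℝ (Fin N → ℝ) := fun q =>
    ((Ideal.span {q}).restrictScalars ℝ).comap T
  have hW : ∀ q b, b ∈ W q ↔ q ∣ T b := fun q b => by
    simp [W, Ideal.mem_span_singleton]
  have key := Subspace.biUnion_ne_univ_of_top_notMem (k := ℝ)
    (s := (UniqueFactorizationMonoid.factors (P m)).toFinset.image W) (by
      simp only [Finset.mem_image, Multiset.mem_toFinset, not_exists, not_and]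
      intro q hq htop
      refine (UniqueFactorizationMonoid.irreducible_of_factor q hq).not_isUnit
        (hP q fun l => ?_)
      have : Pi.single l 1 ∈ W q := htop ▸ Submodule.mem_top
      rw [hW, hT, Finset.sum_eq_single l (fun j _ hj => by simp [hj]) (by simp)] at this
      simpa using this)
  obtain ⟨b, hb⟩ := (Set.ne_univ_iff_exists_notMem _).1 key
  refine ⟨b, fun d hd hd' => ?_⟩
  rw [← hT] at hd'
  by_contra hu
  obtain ⟨q, hq, hqd⟩ := WfDvdMonoid.exists_irreducible_factor hu (ne_zero_of_dvd_ne_zero hm hd)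
  obtain ⟨q', hq', ha⟩ :=
    UniqueFactorizationMonoid.exists_mem_factors_of_dvd hm hq (hqd.trans hd)
  refine hb (Set.mem_biUnion (x := W q') ?_ ((hW q' b).2 (ha.symm.dvd.trans (hqd.trans hd'))))
  simpa using ⟨q', hq', rfl⟩

lemma coeff_prod_sum_of_natDegree_le {ι A : Type*} [CommRing A] (s : Finset ι)
    (F : ι → Polynomial A) (d : ι → ℕ) (h : ∀ i, (F i).natDegree ≤ d i) :
    (∏ i ∈ s, F i).coeff (∑ i ∈ s, d i) = ∏ i ∈ s, (F i).coeff (d i) := by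
  classical
  induction s using Finset.induction_on with
  | empty => simp
  | insert i s hi ih =>
    rw [Finset.prod_insert hi, Finset.sum_insert hi, Finset.prod_insert hi, ← ih]
    exact Polynomial.coeff_mul_add_eq_of_natDegree_le (h i)
      ((Polynomial.natDegree_prod_le _ _).trans (Finset.sum_le_sum fun j _ => h j))

section LineRestrict

variable {σ : Type*} {A B : Type*} [CommRing A] [Algebra ℝ A] [CommRing B] [Algebra ℝ B]

/-- Restriction of a polynomial to the line `t ↦ a + t b`, as a polynomial in `t`. -/
def lineRestrict (a b : σ → A) : MvPolynomial σ ℝ →ₐ[ℝ] Polynomial A :=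
  MvPolynomial.aeval fun i => Polynomial.C (a i) + Polynomial.C (b i) * Polynomial.X

lemma map_lineRestrict (φ : A →ₐ[ℝ] B) (a b : σ → A) (f : MvPolynomial σ ℝ) :
    (lineRestrict a b f).map (φ : A →+* B) = lineRestrict (φ ∘ a) (φ ∘ b) f := by
  have : (Polynomial.mapAlgHom φ).comp (lineRestrict a b) = lineRestrict (φ ∘ a) (φ ∘ b) := by
    ext i : 1
    simp [lineRestrict]
  exact DFunLike.congr_fun this f

lemma eval_lineRestrict (a b : σ → A) (f : MvPolynomial σ ℝ) (t : A) :
    (lineRestrict a b f).eval t = MvPolynomial.aeval (fun i => a i + b i * t) f := by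
  have : ((Polynomial.aeval t : Polynomial A →ₐ[A] A).restrictScalars ℝ).comp
      (lineRestrict a b) = MvPolynomial.aeval (fun i => a i + b i * t) := by
    ext i : 1
    simp [lineRestrict]
  exact DFunLike.congr_fun this f

lemma natDegree_lineRestrict_le_and_coeff (a b : σ → A) {f : MvPolynomial σ ℝ} {k : ℕ}
    (hf : f.IsHomogeneous k) :
    (lineRestrict a b f).natDegree ≤ k ∧
      (lineRestrict a b f).coeff k = MvPolynomial.aeval b f := by
  have h1 : ∀ α ∈ f.support, (∏ i ∈ α.support,
        (Polynomial.C (a i) + Polynomial.C (b i) * Polynomial.X) ^ α i).natDegree ≤ k ∧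
      (∏ i ∈ α.support,
        (Polynomial.C (a i) + Polynomial.C (b i) * Polynomial.X) ^ α i).coeff k =
        ∏ i ∈ α.support, b i ^ α i := by
    intro α hα
    have hk : ∑ i ∈ α.support, α i = k := by
      have := hf (MvPolynomial.mem_support_iff.1 hα)
      have h1 : Finsupp.weight 1 α = α.degree := by rw [Finsupp.degree_eq_weight_one]; rfl
      rw [h1] at this
      exact this
    have h1 : ∀ i, (Polynomial.C (a i) + Polynomial.C (b i) * Polynomial.X).natDegree ≤ 1 :=
      fun i => by rw [add_comm]; exact Polynomial.natDegree_linear_le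
    have h2 : ∀ i, ((Polynomial.C (a i) + Polynomial.C (b i) * Polynomial.X) ^ α i).natDegree ≤
        α i := fun i => by
      simpa using Polynomial.natDegree_pow_le_of_le (α i) (h1 i)
    constructor
    · rw [← hk]
      exact (Polynomial.natDegree_prod_le _ _).trans (Finset.sum_le_sum fun i _ => h2 i)
    · rw [← hk, coeff_prod_sum_of_natDegree_le _ _ _ h2]
      refine Finset.prod_congr rfl fun i _ => ?_
      have := Polynomial.coeff_pow_of_natDegree_le (m := α i) (h1 i)
      simpa using this
  have h2 : lineRestrict a b f = ∑ α ∈ f.support, Polynomial.C (algebraMap ℝ A (f.coeff α)) *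
      ∏ i ∈ α.support, (Polynomial.C (a i) + Polynomial.C (b i) * Polynomial.X) ^ α i := by
    rw [lineRestrict, MvPolynomial.aeval_def, MvPolynomial.eval₂_eq]
    rfl
  rw [h2]
  constructor
  · exact Polynomial.natDegree_sum_le_of_forall_le _ _ fun α hα =>
      (Polynomial.natDegree_C_mul_le _ _).trans (h1 α hα).1
  · rw [Polynomial.finsetSum_coeff, MvPolynomial.aeval_def, MvPolynomial.eval₂_eq]
    refine Finset.sum_congr rfl fun α hα => ?_
    rw [Polynomial.coeff_C_mul, (h1 α hα).2]

/-- Relatively prime polynomials stay relatively prime when restricted to the generic line in a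
fixed direction. -/
lemma IsRelPrime.lineRestrict_generic {f g : MvPolynomial σ ℝ} (hfg : IsRelPrime f g)
    (hf : f ≠ 0) (v : σ → ℝ) :
    IsRelPrime (lineRestrict MvPolynomial.X (fun i => MvPolynomial.C (v i)) f)
      (lineRestrict MvPolynomial.X (fun i => MvPolynomial.C (v i)) g) := by
  let Φ : (σ → ℝ) → Polynomial (MvPolynomial σ ℝ) →+* Polynomial (MvPolynomial σ ℝ) := fun v =>
    Polynomial.eval₂RingHom
      (lineRestrict MvPolynomial.X (fun i => MvPolynomial.C (v i))).toRingHom Polynomial.X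
  have hΦ : ∀ v w, v + w = 0 → (Φ v).comp (Φ w) = RingHom.id _ := by
    intro v w hvw
    have hc : ∀ i, (MvPolynomial.C (v i) : MvPolynomial σ ℝ) = - MvPolynomial.C (w i) :=
      fun i => by rw [← map_neg, eq_neg_of_add_eq_zero_left hvw]; rfl
    ext1
    · ext i : 2
      · simp [Φ, lineRestrict]
      · simp [Φ, lineRestrict, hc]
    · simp [Φ]
  have hC : ∀ p, Φ (-v) (lineRestrict MvPolynomial.X (fun i => MvPolynomial.C (v i)) p) =
      Polynomial.C p := fun p => by
    have : Φ v (Polynomial.C p) =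
        lineRestrict MvPolynomial.X (fun i => MvPolynomial.C (v i)) p := by simp [Φ]
    rw [← this]
    exact DFunLike.congr_fun (hΦ (-v) v (by simp)) _
  intro d hdf hdg
  have h1 := map_dvd (Φ (-v)) hdf
  have h2 := map_dvd (Φ (-v)) hdg
  rw [hC] at h1 h2
  obtain ⟨e, he⟩ : ∃ e, Φ (-v) d = Polynomial.C e := by
    refine ⟨_, Polynomial.eq_C_of_natDegree_eq_zero ?_⟩
    have := Polynomial.natDegree_le_of_dvd h1 (by simpa using hf)
    simpa using this
  rw [he] at h1 h2
  have hu : IsUnit e := by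
    refine hfg ?_ ?_
    · simpa using (Polynomial.C_dvd_iff_dvd_coeff _ _).1 h1 0
    · simpa using (Polynomial.C_dvd_iff_dvd_coeff _ _).1 h2 0
  have h3 : Φ v (Φ (-v) d) = d := DFunLike.congr_fun (hΦ v (-v) (by simp)) _
  rw [← h3, he]
  exact (hu.map Polynomial.C).map (Φ v)

end LineRestrict

/-- Relative primality of a monic polynomial with another one passes to the fraction field. -/
lemma IsRelPrime.isCoprime_map_fractionRing {R K : Type*} [CommRing R] [IsDomain R]
    [IsIntegrallyClosed R] [Field K] [Algebra R K] [IsFractionRing R K] {F G : Polynomial R}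
    (hF : IsUnit F.leadingCoeff) (h : IsRelPrime F G) :
    IsCoprime (F.map (algebraMap R K)) (G.map (algebraMap R K)) := by
  refine IsRelPrime.isCoprime fun p hp hp' => ?_
  obtain ⟨c, hc⟩ := hF
  let F' := Polynomial.C (↑c⁻¹ : R) * F
  have hF' : F'.Monic := by
    rw [Polynomial.Monic, Polynomial.leadingCoeff_mul, Polynomial.leadingCoeff_C, ← hc]
    simp
  have hFF' : F' ∣ F := ⟨Polynomial.C (c : R), by
    rw [mul_right_comm, ← Polynomial.C_mul]; simp⟩
  have hpF : p ∣ F'.map (algebraMap R K) := by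
    rw [Polynomial.map_mul]; exact hp.mul_left _
  obtain ⟨p', hp1⟩ := IsIntegrallyClosed.eq_map_mul_C_of_dvd K hF' hpF
  have hp0 : p ≠ 0 := ne_zero_of_dvd_ne_zero
    ((Polynomial.map_ne_zero_iff (IsFractionRing.injective R K)).2 hF'.ne_zero) hpF
  have hlc : p.leadingCoeff ≠ 0 := Polynomial.leadingCoeff_ne_zero.2 hp0
  have hu : IsUnit (Polynomial.C p.leadingCoeff) := (isUnit_iff_ne_zero.2 hlc).map Polynomial.C
  have hmon : p'.Monic := by
    have := congrArg Polynomial.leadingCoeff hp1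
    rw [Polynomial.leadingCoeff_mul, Polynomial.leadingCoeff_C,
      Polynomial.leadingCoeff_map_of_injective (IsFractionRing.injective R K)] at this
    have h2 := mul_right_cancel₀ hlc (this.trans (one_mul _).symm)
    exact IsFractionRing.injective R K (h2.trans (map_one _).symm)
  have hdvd : ∀ q : Polynomial R, p ∣ q.map (algebraMap R K) → p' ∣ q := fun q hq => by
    rw [← Polynomial.map_dvd_map _ (IsFractionRing.injective R K) hmon]
    exact (Dvd.intro _ hp1).trans hq
  have := h ((hdvd _ hpF).trans hFF') (hdvd _ hp')
  rw [← hp1]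
  exact (this.map (Polynomial.mapRingHom _)).mul hu

section GenericPlane

variable {n k : ℕ}

lemma exists_resultant_lineRestrict_ne_zero {f g : MvPolynomial (Fin n) ℝ}
    (hf : f.IsHomogeneous k) (hg : g.IsHomogeneous k) (hf0 : f ≠ 0) (hfg : IsRelPrime f g) :
    ∃ u v : Fin n → ℝ, (lineRestrict u v f).resultant (lineRestrict u v g) k k ≠ 0 := by
  obtain ⟨v, hv⟩ : ∃ v, MvPolynomial.eval v f ≠ 0 := by
    by_contra! h
    exact hf0 (MvPolynomial.funext fun v => by simpa using h v)
  have hF := natDegree_lineRestrict_le_and_coeff (A := MvPolynomial (Fin n) ℝ) MvPolynomial.X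
    (fun i => MvPolynomial.C (v i)) hf
  have hG := natDegree_lineRestrict_le_and_coeff (A := MvPolynomial (Fin n) ℝ) MvPolynomial.X
    (fun i => MvPolynomial.C (v i)) hg
  have hrel := hfg.lineRestrict_generic hf0 v
  set F := lineRestrict MvPolynomial.X (fun i => (MvPolynomial.C (v i) : MvPolynomial (Fin n) ℝ)) f
    with hFdef
  set G := lineRestrict MvPolynomial.X (fun i => (MvPolynomial.C (v i) : MvPolynomial (Fin n) ℝ)) g
    with hGdef
  have hc : F.coeff k = MvPolynomial.C (MvPolynomial.eval v f) := by
    rw [hF.2, MvPolynomial.aeval_def, MvPolynomial.eval, MvPolynomial.coe_eval₂Hom,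
      MvPolynomial.hom_eval₂]
    rfl
  have hcu : IsUnit (F.coeff k) := by
    rw [hc]; exact (isUnit_iff_ne_zero.2 hv).map MvPolynomial.C
  have hFk : F.natDegree = k := le_antisymm hF.1 (Polynomial.le_natDegree_of_ne_zero hcu.ne_zero)
  have hcop := hrel.isCoprime_map_fractionRing (K := FractionRing (MvPolynomial (Fin n) ℝ)) (by
    rwa [Polynomial.leadingCoeff, hFk])
  have hinj := IsFractionRing.injective (MvPolynomial (Fin n) ℝ)
    (FractionRing (MvPolynomial (Fin n) ℝ))
  have hres : F.resultant G k k ≠ 0 := by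
    intro h0
    have h1 := Polynomial.resultant_map_map F G k k
      (algebraMap (MvPolynomial (Fin n) ℝ) (FractionRing (MvPolynomial (Fin n) ℝ)))
    rw [h0, map_zero] at h1
    obtain ⟨e, he⟩ := Nat.exists_eq_add_of_le hG.1
    have h2 := Polynomial.resultant_add_right_deg (F.map (algebraMap _ _)) (G.map (algebraMap _
      (FractionRing (MvPolynomial (Fin n) ℝ)))) k G.natDegree e Polynomial.natDegree_map_le
    rw [← he, h1, Polynomial.coeff_map] at h2
    have h3 := (mul_eq_zero.1 h2.symm).resolve_left (pow_ne_zero _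
      ((map_ne_zero_iff _ hinj).2 hcu.ne_zero))
    have h4 := Polynomial.natDegree_map_eq_of_injective hinj F
    have h5 := Polynomial.natDegree_map_eq_of_injective hinj G
    rw [← h5, ← hFk, ← h4] at h3
    exact (Polynomial.resultant_eq_zero_iff.1 h3).2 hcop
  obtain ⟨u, hu⟩ : ∃ u, MvPolynomial.aeval (R := ℝ) (S₁ := ℝ) u (F.resultant G k k) ≠ 0 := by
    by_contra! h
    exact hres (MvPolynomial.funext fun v => by
      simpa only [map_zero] using
        (DFunLike.congr_fun (MvPolynomial.coe_aeval_eq_eval v) _).symm.trans (h v))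
  refine ⟨u, v, ?_⟩
  have h := Polynomial.resultant_map_map F G k k
    ((MvPolynomial.aeval u : MvPolynomial (Fin n) ℝ →ₐ[ℝ] ℝ) : MvPolynomial (Fin n) ℝ →+* ℝ)
  rw [hFdef, hGdef, map_lineRestrict, map_lineRestrict] at h
  have e1 : (MvPolynomial.aeval u : MvPolynomial (Fin n) ℝ →ₐ[ℝ] ℝ) ∘ MvPolynomial.X = u := by
    ext i; simp
  have e2 : ((MvPolynomial.aeval u : MvPolynomial (Fin n) ℝ →ₐ[ℝ] ℝ) ∘
      fun i => MvPolynomial.C (v i)) = v := by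
    ext i; simp
  rw [e1, e2] at h
  rw [h]
  exact hu

/-- For a generic linear change of coordinates, two relatively prime forms restrict to relatively
prime binary forms on all coordinate planes. -/
theorem exists_matrix_resultant_ne_zero {f g : MvPolynomial (Fin n) ℝ}
    (hf : f.IsHomogeneous k) (hg : g.IsHomogeneous k) (hf0 : f ≠ 0) (hfg : IsRelPrime f g)
    {U : Set (Matrix (Fin n) (Fin n) ℝ)} (hU : U ∈ 𝓝 1) :
    ∃ L ∈ U, ∀ i j, i ≠ j →
      (lineRestrict (L.col i) (L.col j) f).resultant (lineRestrict (L.col i) (L.col j) g) k k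
        ≠ 0 := by
  obtain ⟨u, v, huv⟩ := exists_resultant_lineRestrict_ne_zero hf hg hf0 hfg
  let A := MvPolynomial (Fin n × Fin n) ℝ
  let c : Fin n → Fin n → A := fun j i => MvPolynomial.X (i, j)
  let D : Fin n → Fin n → A := fun i j =>
    (lineRestrict (c i) (c j) f).resultant (lineRestrict (c i) (c j) g) k k
  have hD : ∀ i j (L : Fin n × Fin n → ℝ), MvPolynomial.eval L (D i j) =
      (lineRestrict (fun l => L (l, i)) (fun l => L (l, j)) f).resultant
        (lineRestrict (fun l => L (l, i)) (fun l => L (l, j)) g) k k := fun i j L => by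
    have h := Polynomial.resultant_map_map (lineRestrict (c i) (c j) f)
      (lineRestrict (c i) (c j) g) k k ((MvPolynomial.aeval L : A →ₐ[ℝ] ℝ) : A →+* ℝ)
    rw [map_lineRestrict, map_lineRestrict] at h
    have e : ∀ j, (MvPolynomial.aeval L : A →ₐ[ℝ] ℝ) ∘ c j = fun l => L (l, j) := fun j => by
      ext i; simp [c]
    rw [e, e] at h
    rw [h]
    exact (DFunLike.congr_fun (MvPolynomial.coe_aeval_eq_eval L) (D i j)).symm
  have hD0 : ∀ i j, i ≠ j → D i j ≠ 0 := fun i j hij h0 => by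
    obtain ⟨M, hMi, hMj⟩ : ∃ M : Fin n × Fin n → ℝ,
        (fun l => M (l, i)) = u ∧ (fun l => M (l, j)) = v :=
      ⟨fun q => if q.2 = i then u q.1 else v q.1, funext fun l => if_pos rfl,
        funext fun l => if_neg hij.symm⟩
    have := hD i j M
    rw [h0, map_zero, hMi, hMj] at this
    exact huv this.symm
  let E : A := ∏ q ∈ (Finset.univ : Finset (Fin n × Fin n)).filter (fun q => q.1 ≠ q.2), D q.1 q.2
  have hE : E ≠ 0 := Finset.prod_ne_zero_iff.2 fun q hq => hD0 _ _ (Finset.mem_filter.1 hq).2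
  have hU' : {M : Fin n × Fin n → ℝ | Matrix.of (fun i j => M (i, j)) ∈ U} ∈
      𝓝 (fun q : Fin n × Fin n => (1 : Matrix (Fin n) (Fin n) ℝ) q.1 q.2) := by
    have hcont : Continuous fun M : Fin n × Fin n → ℝ =>
        (Matrix.of (fun i j => M (i, j)) : Matrix (Fin n) (Fin n) ℝ) :=
      continuous_matrix fun i j => continuous_apply (i, j)
    exact hcont.continuousAt.preimage_mem_nhds hU
  obtain ⟨ε, hε, hball⟩ := Metric.mem_nhds_iff.1 hU'
  by_contra! hcon
  refine hE (MvPolynomial.funext_set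
    (fun q => Metric.ball ((1 : Matrix (Fin n) (Fin n) ℝ) q.1 q.2) ε)
    (fun q => infinite_of_mem_nhds _ (Metric.ball_mem_nhds _ hε)) fun M hM => ?_)
  rw [← ball_pi _ hε] at hM
  obtain ⟨i, j, hij, hz⟩ := hcon _ (hball hM)
  rw [map_zero, map_prod]
  refine Finset.prod_eq_zero (i := (i, j)) (by simpa using hij) ?_
  rw [hD]
  exact hz

/-- If two binary forms of degree `k` have nonzero resultant, all monomials of degree `2 * k - 1`
belong to the ideal they generate. -/
theorem exists_mul_add_mul_eq_monomial {f g : MvPolynomial (Fin n) ℝ}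
    (hf : f.IsHomogeneous k) (hg : g.IsHomogeneous k) {u v : Fin n → ℝ}
    (hres : (lineRestrict u v f).resultant (lineRestrict u v g) k k ≠ 0) (a b : ℕ)
    (hab : a + b + 1 = 2 * k) :
    ∃ q q' : ℝ × ℝ → ℝ, ContDiff ℝ (⊤ : ℕ∞) q ∧ ContDiff ℝ (⊤ : ℕ∞) q' ∧ ∀ z : ℝ × ℝ,
      z.1 ^ a * z.2 ^ b = q z * MvPolynomial.eval (z.1 • u + z.2 • v) f +
        q' z * MvPolynomial.eval (z.1 • u + z.2 • v) g := by
  have hF := (natDegree_lineRestrict_le_and_coeff u v hf).1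
  have hG := (natDegree_lineRestrict_le_and_coeff u v hg).1
  have heval : ∀ {p : MvPolynomial (Fin n) ℝ}, p.IsHomogeneous k → ∀ z : ℝ × ℝ, z.1 ≠ 0 →
      MvPolynomial.eval (z.1 • u + z.2 • v) p =
        z.1 ^ k * (lineRestrict u v p).eval (z.2 / z.1) := fun {p} hp z hz => by
    have h1 := polyFun_smul hp z.1 (WithLp.toLp 2 (u + (z.2 / z.1) • v))
    have h2 : z.1 • u + z.2 • v = z.1 • (u + (z.2 / z.1) • v) := by
      rw [smul_add, smul_smul, mul_div_cancel₀ _ hz]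
    rw [h2, eval_lineRestrict]
    refine Eq.trans ?_ (h1.trans ?_)
    · rfl
    · congr 1
      rw [MvPolynomial.aeval_eq_eval]
      simp [polyFun, mul_comm]
  let r := (lineRestrict u v f).resultant (lineRestrict u v g) k k
  let w := Polynomial.adjSylvester (m := k) (n := k) (lineRestrict u v f) (lineRestrict u v g)
    ⟨Polynomial.X ^ b, by
      rw [Polynomial.mem_degreeLT, Polynomial.degree_X_pow]
      exact_mod_cast (by omega : b < k + k)⟩
  have hw : lineRestrict u v f * (w.2 : Polynomial ℝ) + lineRestrict u v g * (w.1 : Polynomial ℝ)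
      = r • Polynomial.X ^ b :=
    congrArg Subtype.val (LinearMap.congr_fun
      (Polynomial.sylveserMap_comp_adjSylvester _ _ hF hG) _)
  let hom : Polynomial ℝ → ℝ × ℝ → ℝ := fun p z =>
    r⁻¹ * ∑ i ∈ Finset.range k, p.coeff i * z.1 ^ (k - 1 - i) * z.2 ^ i
  have hsm : ∀ p, ContDiff ℝ (⊤ : ℕ∞) (hom p) := fun p => by
    refine contDiff_const.mul (ContDiff.sum fun i _ => ?_)
    exact (contDiff_const.mul (contDiff_fst.pow _)).mul (contDiff_snd.pow _)
  have hhom : ∀ p ∈ Polynomial.degreeLT ℝ k, ∀ z : ℝ × ℝ, z.1 ≠ 0 →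
      hom p z = r⁻¹ * (z.1 ^ (k - 1) * p.eval (z.2 / z.1)) := fun p hp z hz => by
    simp only [hom]
    rw [Polynomial.mem_degreeLT] at hp
    rw [Polynomial.eval_eq_sum_range' (n := k) (by
      rcases eq_or_ne p 0 with rfl | hp0
      · simp; omega
      · exact (Polynomial.natDegree_lt_iff_degree_lt hp0).2 hp), Finset.mul_sum _ _ (z.1 ^ (k - 1))]
    refine congrArg (r⁻¹ * ·) (Finset.sum_congr rfl fun i hi => ?_)
    have : k - 1 = (k - 1 - i) + i := by have := Finset.mem_range.1 hi; omega
    rw [this, pow_add, div_pow, Nat.add_sub_cancel]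
    field_simp
  refine ⟨hom w.2, hom w.1, hsm _, hsm _, fun z => ?_⟩
  have hcont : ∀ p : MvPolynomial (Fin n) ℝ,
      Continuous fun z : ℝ × ℝ => MvPolynomial.eval (z.1 • u + z.2 • v) p := fun p =>
    (MvPolynomial.continuous_eval p).comp (by fun_prop)
  have hdense : Dense {z : ℝ × ℝ | z.1 ≠ 0} :=
    (dense_compl_singleton (0 : ℝ)).preimage isOpenMap_fst
  refine congrFun (Continuous.ext_on (f := fun z : ℝ × ℝ => z.1 ^ a * z.2 ^ b) hdense
    (by fun_prop) (((hsm w.2).continuous.mul (hcont f)).add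
      ((hsm w.1).continuous.mul (hcont g))) fun z hz => ?_) z
  have hz' : z.1 ≠ 0 := hz
  have hwt := congrArg (Polynomial.eval (z.2 / z.1)) hw
  simp only [Polynomial.eval_add, Polynomial.eval_mul, Polynomial.eval_smul, Polynomial.eval_pow,
    Polynomial.eval_X, smul_eq_mul] at hwt
  simp only [Pi.add_apply, Pi.mul_apply, hhom _ w.2.2 z hz', hhom _ w.1.2 z hz',
    heval hf z hz', heval hg z hz']
  have hsum : r⁻¹ * (z.1 ^ (k - 1) * z.1 ^ k) *
      (r * (z.2 / z.1) ^ b) = z.1 ^ a * z.2 ^ b := by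
    have : k - 1 + k = a + b := by omega
    rw [← pow_add, this, pow_add, div_pow]
    have hr : r ≠ 0 := hres
    field_simp
  rw [← hsum, ← hwt]
  ring

end GenericPlane

section ParametricIntegral

variable {E : Type} [NormedAddCommGroup E] [NormedSpace ℝ E] [FiniteDimensional ℝ E]

theorem hasFDerivAt_parametric_intervalIntegral {F : Type} [NormedAddCommGroup F]
    [NormedSpace ℝ F] {f : E × ℝ → F} (hf : ContDiff ℝ 1 f) (x : E) :
    HasFDerivAt (fun e => ∫ t in (0 : ℝ)..1, f (e, t))
      (∫ t in (0 : ℝ)..1, (fderiv ℝ f (x, t)).comp (ContinuousLinearMap.inl ℝ E ℝ)) x := by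
  have hc : Continuous fun z : E × ℝ =>
      (fderiv ℝ f z).comp (ContinuousLinearMap.inl ℝ E ℝ) :=
    (hf.continuous_fderiv one_ne_zero).clm_comp continuous_const
  have hcompact : IsCompact (closedBall x 1 ×ˢ Icc (0 : ℝ) 1) :=
    (isCompact_closedBall x 1).prod isCompact_Icc
  obtain ⟨C, hC⟩ := hcompact.exists_bound_of_continuousOn hc.continuousOn
  refine intervalIntegral.hasFDerivAt_integral_of_dominated_of_fderiv_le
    (F' := fun e t => (fderiv ℝ f (e, t)).comp (ContinuousLinearMap.inl ℝ E ℝ))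
    (bound := fun _ => C) (closedBall_mem_nhds x one_pos) ?_ ?_ ?_ ?_ ?_ ?_
  · exact Eventually.of_forall fun e =>
      (hf.continuous.comp (by fun_prop : Continuous fun t : ℝ => (e, t))).aestronglyMeasurable
  · exact (hf.continuous.comp
      (by fun_prop : Continuous fun t : ℝ => (x, t))).intervalIntegrable _ _
  · exact (hc.comp (by fun_prop : Continuous fun t : ℝ => (x, t))).aestronglyMeasurable
  · refine Eventually.of_forall fun t ht e he => hC (e, t) ⟨he, ?_⟩
    rw [uIoc_of_le zero_le_one] at ht
    exact Ioc_subset_Icc_self ht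
  · exact intervalIntegrable_const
  · refine Eventually.of_forall fun t _ e _ => ?_
    exact (hf.differentiable one_ne_zero (e, t)).hasFDerivAt.comp e (hasFDerivAt_prodMk_left e t)

theorem contDiff_nat_parametric_intervalIntegral (m : ℕ) :
    ∀ {F : Type} [NormedAddCommGroup F] [NormedSpace ℝ F] {f : E × ℝ → F},
      ContDiff ℝ m f → ContDiff ℝ m fun e => ∫ t in (0 : ℝ)..1, f (e, t) := by
  induction m with
  | zero =>
    intro F _ _ f hf
    rw [Nat.cast_zero, contDiff_zero] at hf ⊢
    exact intervalIntegral.continuous_parametric_intervalIntegral_of_continuous'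
      (f := fun e t => f (e, t)) hf 0 1
  | succ m ih =>
    intro F _ _ f hf
    rw [Nat.cast_add, Nat.cast_one] at hf ⊢
    rw [contDiff_succ_iff_hasFDerivAt]
    refine ⟨_, ih (f := fun z => (fderiv ℝ f z).comp (ContinuousLinearMap.inl ℝ E ℝ)) ?_,
      fun x => hasFDerivAt_parametric_intervalIntegral (hf.of_le le_add_self) x⟩
    exact (hf.fderiv_right le_rfl).clm_comp contDiff_const

theorem contDiff_parametric_intervalIntegral {F : Type} [NormedAddCommGroup F]
    [NormedSpace ℝ F] {f : E × ℝ → F} (hf : ContDiff ℝ (⊤ : ℕ∞) f) :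
    ContDiff ℝ (⊤ : ℕ∞) fun e => ∫ t in (0 : ℝ)..1, f (e, t) :=
  contDiff_infty.2 fun m => contDiff_nat_parametric_intervalIntegral m (contDiff_infty.1 hf m)

/-- Hadamard's lemma: a smooth function is smoothly divisible by `t` up to its value at `t = 0`. -/
theorem exists_hadamard_quotient {F : Type} [NormedAddCommGroup F] [NormedSpace ℝ F]
    [CompleteSpace F] {f : E × ℝ → F} (hf : ContDiff ℝ (⊤ : ℕ∞) f) :
    ∃ g : E × ℝ → F, ContDiff ℝ (⊤ : ℕ∞) g ∧ ∀ e t, f (e, t) = f (e, 0) + t • g (e, t) := by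
  let D : E × ℝ → F := fun z => fderiv ℝ f z (0, 1)
  have hD : ContDiff ℝ (⊤ : ℕ∞) D :=
    (hf.fderiv_right (m := (⊤ : ℕ∞)) le_rfl).clm_apply contDiff_const
  let G : (E × ℝ) × ℝ → F := fun z => D (z.1.1, z.2 * z.1.2)
  have hG : ContDiff ℝ (⊤ : ℕ∞) G :=
    hD.comp ((contDiff_fst.comp contDiff_fst).prodMk
      (contDiff_snd.mul (contDiff_snd.comp contDiff_fst)))
  refine ⟨fun z => ∫ s in (0 : ℝ)..1, G (z, s),
    contDiff_parametric_intervalIntegral hG, fun e t => ?_⟩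
  have hder : ∀ s ∈ uIcc (0 : ℝ) 1,
      HasDerivAt (fun s : ℝ => f (e, s * t)) (t • G ((e, t), s)) s := by
    intro s _
    have h1 : HasDerivAt (fun s : ℝ => (e, s * t)) ((0 : E), t) s := by
      simpa using (hasDerivAt_const s e).prodMk ((hasDerivAt_id s).mul_const t)
    have h2 := (hf.differentiable (by simp) (e, s * t)).hasFDerivAt.comp_hasDerivAt s h1
    refine h2.congr_deriv ?_
    change _ = t • fderiv ℝ f (e, s * t) (0, 1)
    rw [← ContinuousLinearMap.map_smul]
    simp
  have hcont : Continuous fun s : ℝ => t • G ((e, t), s) :=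
    continuous_const.smul (hG.continuous.comp (by fun_prop))
  have := intervalIntegral.integral_eq_sub_of_hasDerivAt hder (hcont.intervalIntegrable _ _)
  rw [intervalIntegral.integral_smul] at this
  simp only [one_mul, zero_mul] at this
  rw [this]
  abel

/-- A continuous function `g` with `t • g t = 0` for all real `t` vanishes. -/
theorem eq_zero_of_forall_smul_eq_zero {F : Type*} [NormedAddCommGroup F] [NormedSpace ℝ F]
    {g : ℝ → F} (hg : Continuous g) (h : ∀ t, t • g t = 0) (t : ℝ) : g t = 0 := by
  have hd : Dense {t : ℝ | t ≠ 0} := dense_compl_singleton (0 : ℝ)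
  have : g = fun _ => 0 := hg.ext_on hd continuous_const fun t ht =>
    (smul_eq_zero.1 (h t)).resolve_left ht
  exact congrFun this t

end ParametricIntegral

section Interpolation

/-- First-order expansion of a smooth function of two real variables around a moving base point,
with smooth remainders which vanish wherever the function does. -/
theorem exists_two_variable_expansion {X : Type} [NormedAddCommGroup X] [NormedSpace ℝ X]
    [FiniteDimensional ℝ X] {H : X × (ℝ × ℝ) → ℝ} (hH : ContDiff ℝ (⊤ : ℕ∞) H) :
    ∃ H₁ H₂ : (X × (ℝ × ℝ)) × (ℝ × ℝ) → ℝ, ContDiff ℝ (⊤ : ℕ∞) H₁ ∧ ContDiff ℝ (⊤ : ℕ∞) H₂ ∧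
      (∀ θ z x, H (θ, x) = H (θ, z) + (x.1 - z.1) * H₁ ((θ, z), x)
        + (x.2 - z.2) * H₂ ((θ, z), x)) ∧
      ∀ θ, (∀ x, H (θ, x) = 0) → ∀ z x, H₁ ((θ, z), x) = 0 ∧ H₂ ((θ, z), x) = 0 := by
  obtain ⟨G₁, hG₁, h₁⟩ := exists_hadamard_quotient
    (f := fun w : (X × (ℝ × ℝ)) × ℝ => H (w.1.1, (w.1.2.1 + w.2, w.1.2.2)))
    (hH.comp (by fun_prop))
  obtain ⟨G₂, hG₂, h₂⟩ := exists_hadamard_quotient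
    (f := fun w : (X × (ℝ × ℝ)) × ℝ => H (w.1.1, (w.1.2.1, w.1.2.2 + w.2)))
    (hH.comp (by fun_prop))
  refine ⟨fun w => G₁ ((w.1.1, (w.1.2.1, w.2.2)), w.2.1 - w.1.2.1),
    fun w => G₂ (w.1, w.2.2 - w.1.2.2), hG₁.comp (by fun_prop), hG₂.comp (by fun_prop), ?_, ?_⟩
  · rintro θ ⟨z₁, z₂⟩ ⟨x₁, x₂⟩
    have e₁ := h₁ (θ, (z₁, x₂)) (x₁ - z₁)
    have e₂ := h₂ (θ, (z₁, z₂)) (x₂ - z₂)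
    simp only [add_sub_cancel, add_zero, smul_eq_mul] at e₁ e₂ ⊢
    rw [e₁, e₂]
    ring
  · intro θ h0 z x
    refine ⟨eq_zero_of_forall_smul_eq_zero (g := fun t => G₁ ((θ, (z.1, x.2)), t))
      (hG₁.continuous.comp (by fun_prop)) (fun t => ?_) _,
      eq_zero_of_forall_smul_eq_zero (g := fun t => G₂ ((θ, z), t))
      (hG₂.continuous.comp (by fun_prop)) (fun t => ?_) _⟩
    · simpa [h0] using (h₁ (θ, (z.1, x.2)) t).symm
    · simpa [h0] using (h₂ (θ, z) t).symm

theorem Filter.Eventually.forall_mem_of_nhdsSet_prod {X Y : Type*} [TopologicalSpace X]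
    [TopologicalSpace Y] {K : Set X} {B : Set Y} (hK : IsCompact K) (hB : IsCompact B)
    {p : X × Y → Prop} (h : ∀ᶠ w in 𝓝ˢ (K ×ˢ B), p w) : ∀ᶠ θ in 𝓝ˢ K, ∀ z ∈ B, p (θ, z) := by
  rw [hK.nhdsSet_prod_eq hB, eventually_prod_iff] at h
  obtain ⟨pa, ha, pb, hb, hab⟩ := h
  filter_upwards [ha] with θ hθ z hz
  exact hab hθ (hb.self_of_nhdsSet z hz)

theorem sum_succ_weight_mul_sub {α : Type*} {M : ℕ} (ℓ : Fin (M + 1) → ℝ) (z : Fin (M + 1) → α)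
    (u Q : α → ℝ) :
    ∑ i : Fin M, ℓ i.succ * (u (z i.succ) - u (z 0)) * Q (z i.succ)
      = ∑ i, ℓ i * (u (z i) * Q (z i)) - u (z 0) * ∑ i, ℓ i * Q (z i) := by
  trans ∑ i, ℓ i * (u (z i) - u (z 0)) * Q (z i)
  · rw [Fin.sum_univ_succ]
    simp
  · rw [Finset.mul_sum, ← Finset.sum_sub_distrib]
    exact Finset.sum_congr rfl fun i _ => by ring

/-- A weighted sum of values of a small smooth function at `M` points is controlled by the
moments of the weights of order less than `M`. -/
theorem eventually_abs_weighted_sum_le (M : ℕ) :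
    ∀ {X : Type} [NormedAddCommGroup X] [NormedSpace ℝ X] [FiniteDimensional ℝ X]
      {H : X × (ℝ × ℝ) → ℝ}, ContDiff ℝ (⊤ : ℕ∞) H → ∀ {K : Set X}, IsCompact K →
      (∀ θ ∈ K, ∀ x, H (θ, x) = 0) → ∀ {ε : ℝ}, 0 < ε → ∀ᶠ θ in 𝓝ˢ K,
      ∀ z : Fin M → ℝ × ℝ, (∀ i, z i ∈ closedBall (0 : ℝ × ℝ) 1) → ∀ (ℓ : Fin M → ℝ) (C : ℝ),
        0 ≤ C → (∀ a b : ℕ, a + b < M → |∑ i, ℓ i * ((z i).1 ^ a * (z i).2 ^ b)| ≤ C) →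
        |∑ i, ℓ i * H (θ, z i)| ≤ ε * C := by
  induction M with
  | zero =>
    intro X _ _ _ H _ K _ _ ε hε
    refine Eventually.of_forall fun θ z _ ℓ C hC _ => ?_
    simpa using mul_nonneg hε.le hC
  | succ M ih =>
    intro X _ _ _ H hH K hK h0 ε hε
    have hB : IsCompact (closedBall (0 : ℝ × ℝ) 1) := isCompact_closedBall 0 1
    obtain ⟨H₁, H₂, hH₁, hH₂, hexp, hvan⟩ := exists_two_variable_expansion hH
    have hK' := hK.prod hB
    have E₁ := (ih hH₁ hK' (fun w hw x => (hvan w.1 (h0 w.1 hw.1) w.2 x).1)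
      (show 0 < ε / 6 by positivity)).forall_mem_of_nhdsSet_prod hK hB
    have E₂ := (ih hH₂ hK' (fun w hw x => (hvan w.1 (h0 w.1 hw.1) w.2 x).2)
      (show 0 < ε / 6 by positivity)).forall_mem_of_nhdsSet_prod hK hB
    have E₀ : ∀ᶠ w in 𝓝ˢ (K ×ˢ closedBall (0 : ℝ × ℝ) 1), |H w| < ε / 3 := by
      refine IsOpen.mem_nhdsSet (isOpen_lt hH.continuous.abs continuous_const) |>.2 ?_
      intro w hw
      change |H (w.1, w.2)| < ε / 3
      rw [h0 w.1 hw.1 w.2, abs_zero]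
      positivity
    filter_upwards [E₁, E₂, E₀.forall_mem_of_nhdsSet_prod hK hB] with θ e₁ e₂ e₀
    intro z hz ℓ C hC hmom
    have hz0 : |(z 0).1| ≤ 1 ∧ |(z 0).2| ≤ 1 := by
      simpa [Prod.norm_def] using hz 0
    have bound : ∀ {c s t : ℝ}, |c| ≤ 1 → |s| ≤ C → |t| ≤ C → |s - c * t| ≤ 2 * C := by
      intro c s t hc hs ht
      calc |s - c * t| ≤ |s| + |c| * |t| := by rw [← abs_mul]; exact abs_sub _ _
        _ ≤ C + 1 * C := by gcongr
        _ = 2 * C := by ring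
    have m₁ : ∀ a b : ℕ, a + b < M → |∑ i : Fin M, ℓ i.succ * ((z i.succ).1 - (z 0).1)
        * ((z i.succ).1 ^ a * (z i.succ).2 ^ b)| ≤ 2 * C := by
      intro a b hab
      rw [sum_succ_weight_mul_sub ℓ z Prod.fst fun x => x.1 ^ a * x.2 ^ b]
      refine bound hz0.1 ?_ (hmom a b (by omega))
      simpa only [pow_succ', mul_assoc] using hmom (a + 1) b (by omega)
    have m₂ : ∀ a b : ℕ, a + b < M → |∑ i : Fin M, ℓ i.succ * ((z i.succ).2 - (z 0).2)
        * ((z i.succ).1 ^ a * (z i.succ).2 ^ b)| ≤ 2 * C := by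
      intro a b hab
      rw [sum_succ_weight_mul_sub ℓ z Prod.snd fun x => x.1 ^ a * x.2 ^ b]
      refine bound hz0.2 ?_ (hmom a b (by omega))
      simpa only [pow_succ', mul_left_comm] using hmom a (b + 1) (by omega)
    have hsum : ∑ i, ℓ i * H (θ, z i) = H (θ, z 0) * ∑ i, ℓ i
        + ∑ i : Fin M, ℓ i.succ * ((z i.succ).1 - (z 0).1) * H₁ ((θ, z 0), z i.succ)
        + ∑ i : Fin M, ℓ i.succ * ((z i.succ).2 - (z 0).2) * H₂ ((θ, z 0), z i.succ) := by
      rw [Fin.sum_univ_succ, Fin.sum_univ_succ ℓ, mul_add, Finset.mul_sum, add_assoc, add_assoc,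
        ← Finset.sum_add_distrib, ← Finset.sum_add_distrib, mul_comm]
      congr 1
      refine Finset.sum_congr rfl fun i _ => ?_
      rw [hexp θ (z 0) (z i.succ)]
      ring
    have b₀ : |∑ i, ℓ i| ≤ C := by simpa using hmom 0 0 (by omega)
    have b₁ := e₁ (z 0) (hz 0) (fun i => z i.succ) (fun i => hz _) _ (2 * C) (by positivity) m₁
    have b₂ := e₂ (z 0) (hz 0) (fun i => z i.succ) (fun i => hz _) _ (2 * C) (by positivity) m₂
    rw [hsum]
    calc _ ≤ |H (θ, z 0)| * |∑ i, ℓ i| + ε / 6 * (2 * C) + ε / 6 * (2 * C) := by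
          rw [← abs_mul]
          exact (abs_add_three _ _ _).trans (by gcongr)
      _ ≤ ε / 3 * C + ε / 6 * (2 * C) + ε / 6 * (2 * C) := by
          gcongr
          exact (e₀ (z 0) (hz 0)).le
      _ = ε * C := by ring

/-- Weights on `M` distinct points are determined by their moments of order less than `M`. -/
theorem weights_eq_zero_of_moments_eq_zero (M : ℕ) : ∀ {z : Fin M → ℝ × ℝ},
    Function.Injective z → ∀ {ℓ : Fin M → ℝ},
    (∀ a b : ℕ, a + b < M → ∑ i, ℓ i * ((z i).1 ^ a * (z i).2 ^ b) = 0) → ℓ = 0 := by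
  induction M with
  | zero => exact fun _ _ _ => Subsingleton.elim _ _
  | succ M ih =>
    intro z hz ℓ hmom
    have hz' : Function.Injective fun i : Fin M => z i.succ := hz.comp (Fin.succ_injective M)
    have h₁ : (fun i : Fin M => ℓ i.succ * ((z i.succ).1 - (z 0).1)) = 0 := by
      refine ih hz' fun a b hab => ?_
      rw [sum_succ_weight_mul_sub ℓ z Prod.fst fun x => x.1 ^ a * x.2 ^ b,
        hmom a b (by omega), mul_zero, sub_zero]
      simpa only [pow_succ', mul_assoc] using hmom (a + 1) b (by omega)
    have h₂ : (fun i : Fin M => ℓ i.succ * ((z i.succ).2 - (z 0).2)) = 0 := by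
      refine ih hz' fun a b hab => ?_
      rw [sum_succ_weight_mul_sub ℓ z Prod.snd fun x => x.1 ^ a * x.2 ^ b,
        hmom a b (by omega), mul_zero, sub_zero]
      simpa only [pow_succ', mul_left_comm] using hmom a (b + 1) (by omega)
    have hsucc : ∀ i : Fin M, ℓ i.succ = 0 := by
      intro i
      by_contra hi
      refine Fin.succ_ne_zero i (hz (Prod.ext ?_ ?_))
      · exact sub_eq_zero.1 ((mul_eq_zero.1 (congrFun h₁ i)).resolve_left hi)
      · exact sub_eq_zero.1 ((mul_eq_zero.1 (congrFun h₂ i)).resolve_left hi)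
    have h0 : ℓ 0 = 0 := by simpa [Fin.sum_univ_succ, hsucc] using hmom 0 0 (by omega)
    exact funext (Fin.cases h0 hsucc)

theorem exists_weights_moments_eq_zero {D M : ℕ} (hM : D * (D + 1) / 2 < M)
    (z : Fin M → ℝ × ℝ) : ∃ ℓ : Fin M → ℝ, ℓ ≠ 0 ∧
      ∀ a b : ℕ, a + b < D → ∑ i, ℓ i * ((z i).1 ^ a * (z i).2 ^ b) = 0 := by
  let I := (Finset.range D).sigma fun d => Finset.HasAntidiagonal.antidiagonal d
  let T : (Fin M → ℝ) →ₗ[ℝ] (I → ℝ) := LinearMap.pi fun w =>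
    ∑ i, ((z i).1 ^ w.1.2.1 * (z i).2 ^ w.1.2.2) • LinearMap.proj i
  have hcard : I.card = D * (D + 1) / 2 := by
    rw [Finset.card_sigma]
    simp only [Finset.Nat.card_antidiagonal]
    have := Finset.sum_range_id (D + 1)
    rw [Finset.sum_range_succ', add_zero, Nat.add_sub_cancel, mul_comm] at this
    exact this
  have hker : LinearMap.ker T ≠ ⊥ := LinearMap.ker_ne_bot_of_finrank_lt (by simpa [hcard] using hM)
  obtain ⟨ℓ, hℓ, h0⟩ := Submodule.exists_mem_ne_zero_of_ne_bot hker
  refine ⟨ℓ, h0, fun a b hab => ?_⟩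
  have := congrFun (LinearMap.mem_ker.1 hℓ) ⟨⟨a + b, (a, b)⟩, by simp [I, hab]⟩
  simpa [T, mul_comm] using this

/-- If the monomials of degree `D` lie in the ideal generated by `f₁` and `f₂`, then nearby pairs
of functions have at most `D (D + 1) / 2` common zeros in the unit square. -/
theorem eventually_card_common_zeros_le {X : Type} [NormedAddCommGroup X] [NormedSpace ℝ X]
    [FiniteDimensional ℝ X] {F₁ F₂ : X × (ℝ × ℝ) → ℝ} (hF₁ : ContDiff ℝ (⊤ : ℕ∞) F₁)
    (hF₂ : ContDiff ℝ (⊤ : ℕ∞) F₂) {f₁ f₂ : ℝ × ℝ → ℝ} (hf₁ : ContDiff ℝ (⊤ : ℕ∞) f₁)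
    (hf₂ : ContDiff ℝ (⊤ : ℕ∞) f₂) {K : Set X} (hK : IsCompact K)
    (h₁ : ∀ θ ∈ K, ∀ x, F₁ (θ, x) = f₁ x) (h₂ : ∀ θ ∈ K, ∀ x, F₂ (θ, x) = f₂ x) {D : ℕ}
    (hD : ∀ a b : ℕ, a + b = D → ∃ q q' : ℝ × ℝ → ℝ, ContDiff ℝ (⊤ : ℕ∞) q ∧
      ContDiff ℝ (⊤ : ℕ∞) q' ∧ ∀ x : ℝ × ℝ, x.1 ^ a * x.2 ^ b = q x * f₁ x + q' x * f₂ x) :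
    ∀ᶠ θ in 𝓝ˢ K, ∀ t : Finset (ℝ × ℝ), (∀ x ∈ t, x ∈ closedBall (0 : ℝ × ℝ) 1) →
      (∀ x ∈ t, F₁ (θ, x) = 0 ∧ F₂ (θ, x) = 0) → t.card ≤ D * (D + 1) / 2 := by
  set M := D * (D + 1) / 2 + 1 with hMdef
  have hH : ∀ w : ℕ × ℕ, D ≤ w.1 + w.2 → ∃ H : X × (ℝ × ℝ) → ℝ, ContDiff ℝ (⊤ : ℕ∞) H ∧
      (∀ θ ∈ K, ∀ x, H (θ, x) = 0) ∧ ∀ θ x, F₁ (θ, x) = 0 → F₂ (θ, x) = 0 →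
        H (θ, x) = x.1 ^ w.1 * x.2 ^ w.2 := by
    rintro ⟨a, b⟩ hab
    obtain ⟨a', b', ha, hb, hab'⟩ : ∃ a' b' : ℕ, a' ≤ a ∧ b' ≤ b ∧ a' + b' = D :=
      ⟨min a D, D - min a D, by omega, by omega, by omega⟩
    obtain ⟨q, q', hq, hq', hqq⟩ := hD a' b' hab'
    refine ⟨fun y => y.2.1 ^ (a - a') * y.2.2 ^ (b - b') * (q y.2 * (f₁ y.2 - F₁ y)
      + q' y.2 * (f₂ y.2 - F₂ y)), by fun_prop, fun θ hθ x => ?_, fun θ x e₁ e₂ => ?_⟩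
    · simp [h₁ θ hθ, h₂ θ hθ]
    · simp only [e₁, e₂, sub_zero, ← hqq]
      obtain ⟨c, rfl⟩ := Nat.exists_eq_add_of_le ha
      obtain ⟨d, rfl⟩ := Nat.exists_eq_add_of_le hb
      simp only [Nat.add_sub_cancel_left]
      ring
  choose! H hHs hH0 hHe using hH
  have hev : ∀ w ∈ (Finset.range M ×ˢ Finset.range M).filter fun w => D ≤ w.1 + w.2,
      ∀ᶠ θ in 𝓝ˢ K, ∀ z : Fin M → ℝ × ℝ, (∀ i, z i ∈ closedBall (0 : ℝ × ℝ) 1) →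
        ∀ (ℓ : Fin M → ℝ) (C : ℝ), 0 ≤ C →
        (∀ a b : ℕ, a + b < M → |∑ i, ℓ i * ((z i).1 ^ a * (z i).2 ^ b)| ≤ C) →
        |∑ i, ℓ i * H w (θ, z i)| ≤ 1 / 2 * C := fun w hw =>
    eventually_abs_weighted_sum_le M (hHs w (Finset.mem_filter.1 hw).2) hK
      (hH0 w (Finset.mem_filter.1 hw).2) (by norm_num)
  filter_upwards [(Filter.eventually_all_finset _).2 hev] with θ hθ t ht htF
  by_contra! hcard
  obtain ⟨s, hst, hs⟩ := Finset.exists_subset_card_eq (show M ≤ t.card from hcard)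
  let z : Fin M → ℝ × ℝ := fun i => (s.equivFinOfCardEq hs).symm i
  have hzinj : Function.Injective z :=
    Subtype.val_injective.comp (s.equivFinOfCardEq hs).symm.injective
  have hzt : ∀ i, z i ∈ t := fun i => hst ((s.equivFinOfCardEq hs).symm i).2
  obtain ⟨ℓ, hℓ, hlow⟩ := exists_weights_moments_eq_zero (show D * (D + 1) / 2 < M by omega) z
  let μ : ℕ × ℕ → ℝ := fun w => |∑ i, ℓ i * ((z i).1 ^ w.1 * (z i).2 ^ w.2)|
  obtain ⟨w, hw, hmax⟩ := ((Finset.range M ×ˢ Finset.range M).filter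
    fun w => w.1 + w.2 < M).exists_max_image μ ⟨(0, 0), by simp [M]⟩
  have hmax' : ∀ a b : ℕ, a + b < M → μ (a, b) ≤ μ w := fun a b hab =>
    hmax (a, b) (by simp only [Finset.mem_filter, Finset.mem_product, Finset.mem_range]; omega)
  have hw0 : μ w ≤ 0 := by
    rcases lt_or_ge (w.1 + w.2) D with hwD | hwD
    · simp [μ, hlow _ _ hwD]
    · have := hθ w (Finset.mem_filter.2 ⟨(Finset.mem_filter.1 hw).1, hwD⟩) z
        (fun i => ht _ (hzt i)) ℓ (μ w) (abs_nonneg _) hmax'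
      have e : ∀ i, H w (θ, z i) = (z i).1 ^ w.1 * (z i).2 ^ w.2 := fun i =>
        hHe w hwD θ (z i) (htF _ (hzt i)).1 (htF _ (hzt i)).2
      simp only [e] at this
      change μ w ≤ _ at this
      linarith
  exact hℓ (weights_eq_zero_of_moments_eq_zero M hzinj fun a b hab =>
    abs_nonpos_iff.1 ((hmax' a b hab).trans hw0))

end Interpolation

section BlowUp

variable {E F : Type} [NormedAddCommGroup E] [NormedSpace ℝ E] [NormedAddCommGroup F]
  [NormedSpace ℝ F]

theorem iteratedDeriv_pow_smul_zero (j : ℕ) : ∀ {g : ℝ → F}, ContDiff ℝ (⊤ : ℕ∞) g →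
    iteratedDeriv j (fun r => r ^ j • g r) 0 = (j.factorial : ℝ) • g 0 := by
  induction j with
  | zero => intro g _; simp
  | succ j ih =>
    intro g hg
    have hd : deriv (fun r : ℝ => r ^ (j + 1) • g r)
        = fun r => r ^ j • (((j : ℝ) + 1) • g r + r • deriv g r) := by
      funext r
      have h := ((hasDerivAt_id r).pow (j + 1)).smul
        (hg.differentiable (by simp) r).hasDerivAt
      refine h.deriv.trans ?_
      simp only [id, Pi.pow_apply, Nat.add_sub_cancel, mul_one, smul_add, smul_smul, pow_succ]
      push_cast
      rw [add_comm, mul_comm (_ + _)]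
    have hg' : ContDiff ℝ (⊤ : ℕ∞) (deriv g) := (contDiff_infty_iff_deriv.1 hg).2
    rw [iteratedDeriv_succ', hd, ih (g := fun r => ((j : ℝ) + 1) • g r + r • deriv g r)
      ((contDiff_const.smul hg).add (contDiff_id.smul hg'))]
    simp [Nat.factorial_succ, smul_smul, mul_comm]

theorem iteratedDeriv_comp_add_smul {φ : E → F} (hφ : ContDiff ℝ (⊤ : ℕ∞) φ) (p x : E) (j : ℕ) :
    iteratedDeriv j (fun r : ℝ => φ (p + r • x))
      = fun r => iteratedFDeriv ℝ j φ (p + r • x) fun _ => x := by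
  induction j with
  | zero => funext r; simp
  | succ j ih =>
    rw [iteratedDeriv_succ, ih]
    funext r
    have hl : HasDerivAt (fun r : ℝ => p + r • x) x r := by
      simpa using ((hasDerivAt_id r).smul_const x).const_add p
    have hD := ((hφ.differentiable_iteratedFDeriv (m := j)
      (by exact_mod_cast WithTop.coe_lt_top _)) (p + r • x)).hasFDerivAt.comp_hasDerivAt r hl
    have := (ContinuousMultilinearMap.apply ℝ (fun _ : Fin j => E) F
      fun _ => x).hasFDerivAt.comp_hasDerivAt
      r hD
    exact this.deriv

theorem exists_smooth_blow_up [FiniteDimensional ℝ E] [CompleteSpace F] {φ : E → F}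
    (hφ : ContDiff ℝ (⊤ : ℕ∞) φ) (p : E) (k : ℕ)
    (hvan : ∀ m < k, iteratedFDeriv ℝ m φ p = 0) :
    ∃ ψ : E × ℝ → F, ContDiff ℝ (⊤ : ℕ∞) ψ ∧ (∀ x r, φ (p + r • x) = r ^ k • ψ (x, r)) ∧
      ∀ x, (k.factorial : ℝ) • ψ (x, 0) = iteratedFDeriv ℝ k φ p fun _ => x := by
  have hval : ∀ {j : ℕ} {ψ : E × ℝ → F}, ContDiff ℝ (⊤ : ℕ∞) ψ →
      (∀ x r, φ (p + r • x) = r ^ j • ψ (x, r)) → ∀ x,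
      (j.factorial : ℝ) • ψ (x, 0) = iteratedFDeriv ℝ j φ p fun _ => x := by
    intro j ψ hψ h x
    rw [← iteratedDeriv_pow_smul_zero j (g := fun r => ψ (x, r)) (hψ.comp (by fun_prop)),
      ← funext (h x), iteratedDeriv_comp_add_smul hφ]
    simp
  suffices ∀ j ≤ k, ∃ ψ : E × ℝ → F, ContDiff ℝ (⊤ : ℕ∞) ψ ∧
      ∀ x r, φ (p + r • x) = r ^ j • ψ (x, r) by
    obtain ⟨ψ, hψ, h⟩ := this k le_rfl
    exact ⟨ψ, hψ, h, hval hψ h⟩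
  intro j
  induction j with
  | zero => exact fun _ => ⟨fun w => φ (p + w.2 • w.1), hφ.comp (by fun_prop), by simp⟩
  | succ j ih =>
    intro hj
    obtain ⟨ψ, hψ, h⟩ := ih (by omega)
    obtain ⟨g, hg, hgψ⟩ := exists_hadamard_quotient hψ
    refine ⟨g, hg, fun x r => ?_⟩
    have h0 : ψ (x, 0) = 0 := by
      have := hval hψ h x
      rw [hvan j (by omega)] at this
      exact (smul_eq_zero.1 this).resolve_left (by positivity)
    rw [h, hgψ, h0, zero_add, smul_smul, pow_succ]

theorem ContDiff.iteratedFDeriv_comp_adjacent_swap {φ : E → F} (hφ : ContDiff ℝ (⊤ : ℕ∞) φ)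
    (k : ℕ) : ∀ (p : E) (v : Fin (k + 1) → E) (i : Fin k),
      iteratedFDeriv ℝ (k + 1) φ p (v ∘ Equiv.swap i.castSucc i.succ)
        = iteratedFDeriv ℝ (k + 1) φ p v := by
  have hdiff : ∀ (m : ℕ) (y : E), DifferentiableAt ℝ (iteratedFDeriv ℝ m φ) y := fun m y =>
    hφ.differentiable_iteratedFDeriv (m := m) (by exact_mod_cast WithTop.coe_lt_top _) y
  induction k with
  | zero => exact fun _ _ i => i.elim0
  | succ k ih =>
    intro p v i
    rw [(hdiff (k + 1) p).iteratedFDeriv_succ_apply_left',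
      (hdiff (k + 1) p).iteratedFDeriv_succ_apply_left']
    refine Fin.cases ?_ (fun i => ?_) i
    · have hsnd : ∀ w : Fin (k + 2) → E,
          fderiv ℝ (fun y => iteratedFDeriv ℝ (k + 1) φ y (Fin.tail w)) p (w 0)
            = fderiv ℝ (fderiv ℝ fun y => iteratedFDeriv ℝ k φ y (Fin.tail (Fin.tail w))) p
              (w 0) (w 1) := by
        intro w
        have h1 : (fun y => iteratedFDeriv ℝ (k + 1) φ y (Fin.tail w))
            = fun y => fderiv ℝ (fun y => iteratedFDeriv ℝ k φ y (Fin.tail (Fin.tail w))) y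
              (w 1) := funext fun y => (hdiff k y).iteratedFDeriv_succ_apply_left'
        have hs : ContDiff ℝ (⊤ : ℕ∞)
            fun y => iteratedFDeriv ℝ k φ y (Fin.tail (Fin.tail w)) :=
          (ContinuousMultilinearMap.apply ℝ (fun _ : Fin k => E) F _).contDiff.comp
            (hφ.iteratedFDeriv_right (m := (⊤ : ℕ∞)) (by exact_mod_cast le_top))
        rw [h1, fderiv_clm_apply ((hs.fderiv_right (m := (⊤ : ℕ∞)) le_rfl).differentiable
          (by simp) p) (differentiableAt_const _)]
        simp
      rw [hsnd, hsnd]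
      have hs : ContDiff ℝ (⊤ : ℕ∞)
          fun y => iteratedFDeriv ℝ k φ y (Fin.tail (Fin.tail v)) :=
        (ContinuousMultilinearMap.apply ℝ (fun _ : Fin k => E) F _).contDiff.comp
          (hφ.iteratedFDeriv_right (m := (⊤ : ℕ∞)) (by exact_mod_cast le_top))
      have hsym := (hs.contDiffAt (x := p)).isSymmSndFDerivAt
        (by
          rw [minSmoothness_of_isRCLikeNormedField]
          exact WithTop.coe_le_coe.2 (le_top : (2 : ℕ∞) ≤ ⊤)) (v 0) (v 1)
      have ht : Fin.tail (Fin.tail (v ∘ Equiv.swap (Fin.castSucc (0 : Fin (k + 1))) (Fin.succ 0)))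
          = Fin.tail (Fin.tail v) := by
        funext l
        simp only [Fin.tail, Function.comp_apply]
        rw [Equiv.swap_apply_of_ne_of_ne]
        · exact Fin.succ_ne_zero _
        · exact fun h => Fin.succ_ne_zero _ (Fin.succ_injective _ h)
      rw [ht]
      simpa using hsym.symm
    · have h0 : (v ∘ Equiv.swap i.succ.castSucc i.succ.succ) 0 = v 0 := by
        rw [Function.comp_apply, Equiv.swap_apply_of_ne_of_ne]
        · rw [← Fin.succ_castSucc]
          exact (Fin.succ_ne_zero _).symm
        · exact (Fin.succ_ne_zero _).symm
      have ht : Fin.tail (v ∘ Equiv.swap i.succ.castSucc i.succ.succ)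
          = Fin.tail v ∘ Equiv.swap i.castSucc i.succ := by
        funext l
        simp only [Fin.tail, Function.comp_apply]
        rw [← Fin.succ_castSucc, (Fin.succ_injective _).swap_apply]
      rw [h0, ht]
      simp only [ih]

/-- The iterated derivatives of a smooth function are symmetric. -/
theorem ContDiff.iteratedFDeriv_comp_perm {φ : E → F} (hφ : ContDiff ℝ (⊤ : ℕ∞) φ) (p : E) {k : ℕ}
    (v : Fin k → E) (σ : Equiv.Perm (Fin k)) :
    iteratedFDeriv ℝ k φ p (v ∘ σ) = iteratedFDeriv ℝ k φ p v := by
  cases k with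
  | zero => exact congrArg _ (Subsingleton.elim _ _)
  | succ k =>
    have hσ : σ ∈ Submonoid.closure (Set.range fun i : Fin k => Equiv.swap i.castSucc i.succ) := by
      rw [Equiv.Perm.mclosure_swap_castSucc_succ]
      trivial
    induction hσ using Submonoid.closure_induction generalizing v with
    | mem τ hτ =>
      obtain ⟨i, rfl⟩ := hτ
      exact hφ.iteratedFDeriv_comp_adjacent_swap k p v i
    | one => rfl
    | mul τ τ' _ _ h h' =>
      rw [Equiv.Perm.coe_mul, ← Function.comp_assoc, h', h]

theorem exists_iteratedFDeriv_diag_ne_zero {φ : E → F} (hφ : ContDiff ℝ (⊤ : ℕ∞) φ) {p : E}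
    {k : ℕ} (h : iteratedFDeriv ℝ k φ p ≠ 0) : ∃ v, iteratedFDeriv ℝ k φ p (fun _ => v) ≠ 0 := by
  by_contra! h0
  refine h (ContinuousMultilinearMap.ext fun v => ?_)
  have := (iteratedFDeriv ℝ k φ p).iteratedFDeriv_comp_diagonal 0 v
  simp only [h0] at this
  have hs : ∀ σ : Equiv.Perm (Fin k), iteratedFDeriv ℝ k φ p (fun i => v (σ i))
    = iteratedFDeriv ℝ k φ p v := fun σ => hφ.iteratedFDeriv_comp_perm p v σ
  simp only [hs, Finset.sum_const] at this
  rw [iteratedFDeriv_fun_zero] at this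
  have h2 := this.symm
  rw [← Nat.cast_smul_eq_nsmul ℝ] at h2
  simpa [Fintype.card_perm, Nat.factorial_ne_zero] using h2

end BlowUp

section Symbol

variable {n N : ℕ}

/-- The leading part of a solution of a first-order system at a zero of finite order is in the
kernel of the principal symbol. -/
theorem sum_symbol_mulVec_iteratedFDeriv_eq_zero {φ : Euc n → Fin N → ℝ}
    (hφ : ContDiff ℝ (⊤ : ℕ∞) φ) {A : Fin n → Euc n → Matrix (Fin N) (Fin N) ℝ}
    {V : Euc n → (Fin N → ℝ) → Fin N → ℝ} {x₀ : Euc n} (hA : ∀ l, ContinuousAt (A l) x₀)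
    {C : ℝ} (hV : ∀ᶠ w in 𝓝 (x₀, (0 : Fin N → ℝ)), ‖V w.1 w.2‖ ≤ C * ‖w.2‖)
    (heq : ∀ᶠ x in 𝓝 x₀,
      (∑ l, (A l x).mulVec (fderiv ℝ φ x (EuclideanSpace.single l 1))) + V x (φ x) = 0)
    {j : ℕ} (hvan : ∀ m < j + 1, iteratedFDeriv ℝ m φ x₀ = 0) (v : Euc n) :
    ∑ l, (A l x₀).mulVec
      (iteratedFDeriv ℝ (j + 1) φ x₀ (Fin.cons (EuclideanSpace.single l 1) fun _ => v)) = 0 := by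
  let φ' : Fin n → Euc n → Fin N → ℝ := fun l x => fderiv ℝ φ x (EuclideanSpace.single l 1)
  have hfd : ContDiff ℝ (⊤ : ℕ∞) (fderiv ℝ φ) := hφ.fderiv_right (m := (⊤ : ℕ∞)) le_rfl
  have hφ' : ∀ l, ContDiff ℝ (⊤ : ℕ∞) (φ' l) := fun l => hfd.clm_apply contDiff_const
  have hit : ∀ l m (w : Fin m → Euc n), iteratedFDeriv ℝ m (φ' l) x₀ w
      = iteratedFDeriv ℝ (m + 1) φ x₀ (Fin.snoc w (EuclideanSpace.single l 1)) := by
    intro l m w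
    rw [iteratedFDeriv_succ_apply_right, Fin.init_snoc, Fin.snoc_last,
      iteratedFDeriv_clm_apply_const_apply (n := (⊤ : ℕ∞)) hfd (by exact_mod_cast le_top)]
  have hvan' : ∀ l, ∀ m < j, iteratedFDeriv ℝ m (φ' l) x₀ = 0 := fun l m hm =>
    ContinuousMultilinearMap.ext fun w => by rw [hit, hvan (m + 1) (by omega)]; rfl
  choose ψ' hψ' hr' h0' using fun l => exists_smooth_blow_up (hφ' l) x₀ j (hvan' l)
  obtain ⟨ψ, hψ, hr, -⟩ := exists_smooth_blow_up hφ x₀ (j + 1) hvan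
  have hline : Tendsto (fun r : ℝ => x₀ + r • v) (𝓝[≠] 0) (𝓝 x₀) := by
    have : Continuous fun r : ℝ => x₀ + r • v := by fun_prop
    simpa using (this.tendsto 0).mono_left nhdsWithin_le_nhds
  have hlim : Tendsto (fun r : ℝ => ∑ l, (A l (x₀ + r • v)).mulVec (ψ' l (v, r))) (𝓝[≠] 0)
      (𝓝 (∑ l, (A l x₀).mulVec (ψ' l (v, 0)))) := by
    refine tendsto_finsetSum _ fun l _ => ?_
    have hc : Continuous fun w : Matrix (Fin N) (Fin N) ℝ × (Fin N → ℝ) => w.1.mulVec w.2 :=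
      continuous_fst.matrix_mulVec continuous_snd
    have h2 : Tendsto (fun r : ℝ => ψ' l (v, r)) (𝓝[≠] 0) (𝓝 (ψ' l (v, 0))) :=
      (((hψ' l).continuous.comp (by fun_prop : Continuous fun r : ℝ => (v, r))).tendsto
        0).mono_left nhdsWithin_le_nhds
    exact (hc.tendsto (A l x₀, ψ' l (v, 0))).comp (((hA l).tendsto.comp hline).prodMk_nhds h2)
  have hψc : Tendsto (fun r : ℝ => ψ (v, r)) (𝓝[≠] 0) (𝓝 (ψ (v, 0))) :=
    ((hψ.continuous.comp (by fun_prop : Continuous fun r : ℝ => (v, r))).tendsto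
        0).mono_left nhdsWithin_le_nhds
  have hid : Tendsto (fun r : ℝ => r) (𝓝[≠] 0) (𝓝 0) := tendsto_id.mono_left nhdsWithin_le_nhds
  have hzero : Tendsto (fun r : ℝ => ∑ l, (A l (x₀ + r • v)).mulVec (ψ' l (v, r))) (𝓝[≠] 0)
      (𝓝 0) := by
    have hφ0 : Tendsto (fun r : ℝ => φ (x₀ + r • v)) (𝓝[≠] 0) (𝓝 0) := by
      have h0 : φ x₀ = 0 := by simpa using congrArg (fun T => T 0) (hvan 0 (by omega))
      simpa [h0, Function.comp_def] using (hφ.continuous.tendsto x₀).comp hline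
    have hb : Tendsto (fun r : ℝ => C * (|r| * ‖ψ (v, r)‖)) (𝓝[≠] 0) (𝓝 0) := by
      simpa using (hid.abs.mul hψc.norm).const_mul C
    refine squeeze_zero_norm' ?_ hb
    filter_upwards [hline.eventually heq, (hline.prodMk_nhds hφ0).eventually hV,
      self_mem_nhdsWithin] with r e hVr hr0
    have hr0 : r ≠ 0 := hr0
    have e1 : r ^ j • ∑ l, (A l (x₀ + r • v)).mulVec (ψ' l (v, r))
        = -V (x₀ + r • v) (φ (x₀ + r • v)) := by
      rw [← add_eq_zero_iff_eq_neg, ← e, Finset.smul_sum]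
      congr 1
      refine Finset.sum_congr rfl fun l _ => ?_
      rw [← Matrix.mulVec_smul, ← hr' l v r]
    have e2 : |r| ^ j * ‖∑ l, (A l (x₀ + r • v)).mulVec (ψ' l (v, r))‖
        ≤ |r| ^ j * (C * (|r| * ‖ψ (v, r)‖)) := by
      calc _ = ‖V (x₀ + r • v) (φ (x₀ + r • v))‖ := by
            rw [← norm_neg (V _ _), ← e1, norm_smul, norm_pow, Real.norm_eq_abs]
        _ ≤ C * ‖φ (x₀ + r • v)‖ := hVr
        _ = _ := by rw [hr, norm_smul, norm_pow, Real.norm_eq_abs]; ring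
    exact le_of_mul_le_mul_left e2 (by positivity)
  have hfin := tendsto_nhds_unique hlim hzero
  have hcons : ∀ l, iteratedFDeriv ℝ (j + 1) φ x₀ (Fin.cons (EuclideanSpace.single l 1) fun _ => v)
      = (j.factorial : ℝ) • ψ' l (v, 0) := by
    intro l
    rw [h0', hit, ← hφ.iteratedFDeriv_comp_perm x₀ _ (finRotate (j + 1))]
    congr 1
    funext i
    induction i using Fin.lastCases with
    | last => simp
    | cast i => simp [Fin.coeSucc_eq_succ]
  simp only [hcons, Matrix.mulVec_smul, ← Finset.smul_sum, hfin, smul_zero]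

theorem finrank_ker_le_of_sum_symbol_mulVec_eq_zero {B : Fin n → Matrix (Fin N) (Fin N) ℝ}
    (hB : ∀ ξ : Euc n, ξ ≠ 0 → IsUnit (∑ j, ξ j • B j)) {T : Euc n →L[ℝ] (Fin N → ℝ)}
    (hT : ∑ l, (B l).mulVec (T (EuclideanSpace.single l 1)) = 0) (hT0 : T ≠ 0) :
    Module.finrank ℝ (LinearMap.ker T.toLinearMap) ≤ n - 2 := by
  have hrn := LinearMap.finrank_range_add_finrank_ker T.toLinearMap
  rw [finrank_euclideanSpace_fin] at hrn
  by_contra! hlt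
  have hone : Module.finrank ℝ (LinearMap.range T.toLinearMap) ≤ 1 := by omega
  obtain ⟨u, hu⟩ := finrank_le_one_iff.1 hone
  choose ξ hξ using fun l : Fin n =>
    hu ⟨T (EuclideanSpace.single l 1), LinearMap.mem_range_self T.toLinearMap _⟩
  have hξ' : ∀ l, T (EuclideanSpace.single l 1) = ξ l • (u : Fin N → ℝ) := fun l =>
    (congrArg Subtype.val (hξ l)).symm
  have hsum : (∑ l, ξ l • B l).mulVec (u : Fin N → ℝ) = 0 := by
    rw [← hT, Matrix.sum_mulVec]
    exact Finset.sum_congr rfl fun l _ => by rw [hξ', Matrix.smul_mulVec, Matrix.mulVec_smul]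
  refine hT0 (ContinuousLinearMap.coe_injective
    ((EuclideanSpace.basisFun (Fin n) ℝ).toBasis.ext fun l => ?_))
  have hzero : ξ l • (u : Fin N → ℝ) = 0 := by
    by_cases h : WithLp.toLp 2 ξ = (0 : Euc n)
    · rw [show ξ l = 0 from congrFun (congrArg WithLp.ofLp h) l, zero_smul]
    · have := Matrix.mulVec_injective_of_isUnit (hB _ h) (hsum.trans (Matrix.mulVec_zero _).symm)
      rw [this, smul_zero]
  simpa [hξ'] using hzero

/-- Near a zero of order exactly `j + 1` of a solution, the zeros of order at least `j + 1` lie in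
the zero set of a map whose derivative has rank at least two. -/
theorem exists_hasStrictFDerivAt_finrank_ker_le {φ : Euc n → Fin N → ℝ}
    (hφ : ContDiff ℝ (⊤ : ℕ∞) φ) {x₀ : Euc n} {B : Fin n → Matrix (Fin N) (Fin N) ℝ}
    (hB : ∀ ξ : Euc n, ξ ≠ 0 → IsUnit (∑ j, ξ j • B j)) {j : ℕ}
    (hsymb : ∀ v : Euc n, ∑ l, (B l).mulVec
      (iteratedFDeriv ℝ (j + 1) φ x₀ (Fin.cons (EuclideanSpace.single l 1) fun _ => v)) = 0)
    (hne : iteratedFDeriv ℝ (j + 1) φ x₀ ≠ 0) :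
    ∃ (Ψ : Euc n → Fin N → ℝ) (T : Euc n →L[ℝ] (Fin N → ℝ)), HasStrictFDerivAt Ψ T x₀ ∧
      (∀ y, iteratedFDeriv ℝ j φ y = 0 → Ψ y = 0) ∧
      Module.finrank ℝ (LinearMap.ker T.toLinearMap) ≤ n - 2 := by
  obtain ⟨v, hv⟩ := exists_iteratedFDeriv_diag_ne_zero hφ hne
  let Ψ : Euc n → Fin N → ℝ := fun y => iteratedFDeriv ℝ j φ y fun _ => v
  have hdiff : DifferentiableAt ℝ (iteratedFDeriv ℝ j φ) x₀ :=
    hφ.differentiable_iteratedFDeriv (m := j) (by exact_mod_cast WithTop.coe_lt_top _) x₀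
  have hΨ : ContDiff ℝ (⊤ : ℕ∞) Ψ :=
    (ContinuousMultilinearMap.apply ℝ (fun _ : Fin j => Euc n) (Fin N → ℝ) _).contDiff.comp
      (hφ.iteratedFDeriv_right (m := (⊤ : ℕ∞)) (by exact_mod_cast le_top))
  have hT : ∀ w, fderiv ℝ Ψ x₀ w = iteratedFDeriv ℝ (j + 1) φ x₀ (Fin.cons w fun _ => v) :=
    fun w => (hdiff.iteratedFDeriv_succ_apply_left' (m := Fin.cons w fun _ => v)).symm
  refine ⟨Ψ, fderiv ℝ Ψ x₀, hΨ.contDiffAt.hasStrictFDerivAt (by simp),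
    fun y hy => by simp [Ψ, hy], finrank_ker_le_of_sum_symbol_mulVec_eq_zero hB ?_ fun h0 => hv ?_⟩
  · simpa only [hT] using hsymb v
  · rw [show (fun _ : Fin (j + 1) => v) = Fin.cons v fun _ => v from
      funext (Fin.cases rfl fun _ => rfl), ← hT, h0]
    rfl

end Symbol

section LeadingPart

variable {n N k : ℕ}

/-- The diagonal of a multilinear map, as a polynomial in the coordinates. -/
def diagPoly (T : ContinuousMultilinearMap ℝ (fun _ : Fin k => Euc n) (Fin N → ℝ)) (l : Fin N) :
    MvPolynomial (Fin n) ℝ :=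
  ∑ r : Fin k → Fin n,
    MvPolynomial.C (T (fun i => EuclideanSpace.single (r i) 1) l) * ∏ i, MvPolynomial.X (r i)

theorem isHomogeneous_diagPoly
    (T : ContinuousMultilinearMap ℝ (fun _ : Fin k => Euc n) (Fin N → ℝ)) (l : Fin N) :
    (diagPoly T l).IsHomogeneous k := by
  refine MvPolynomial.IsHomogeneous.sum _ _ _ fun r _ => ?_
  have h := (MvPolynomial.isHomogeneous_C (Fin n)
    (T (fun i => EuclideanSpace.single (r i) 1) l)).mul
    (MvPolynomial.IsHomogeneous.prod Finset.univ
      (fun i => (MvPolynomial.X (r i) : MvPolynomial (Fin n) ℝ)) (fun _ => 1)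
      fun i _ => MvPolynomial.isHomogeneous_X _ _)
  simpa using h

theorem polyFun_diagPoly
    (T : ContinuousMultilinearMap ℝ (fun _ : Fin k => Euc n) (Fin N → ℝ)) (l : Fin N)
    (x : Euc n) : polyFun (diagPoly T l) x = T (fun _ => x) l := by
  have hx : x = ∑ j, x j • EuclideanSpace.single j (1 : ℝ) := by
    simpa using ((EuclideanSpace.basisFun (Fin n) ℝ).sum_repr x).symm
  have hT : T (fun _ => x)
      = ∑ r : Fin k → Fin n, (∏ i, x (r i)) • T fun i => EuclideanSpace.single (r i) 1 := by
    conv_lhs => rw [hx]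
    rw [T.map_sum]
    exact Finset.sum_congr rfl fun r _ => T.map_smul_univ _ _
  rw [hT, polyFun, diagPoly, map_sum, Finset.sum_apply]
  exact Finset.sum_congr rfl fun r _ => by simp [mul_comm]

theorem fderiv_iteratedFDeriv_diag {F : Type} [NormedAddCommGroup F] [NormedSpace ℝ F]
    {φ : Euc n → F} (hφ : ContDiff ℝ (⊤ : ℕ∞) φ) (p : Euc n) (j : ℕ)
    (x w : Euc n) :
    fderiv ℝ (fun x => iteratedFDeriv ℝ (j + 1) φ p fun _ => x) x w
      = ((j : ℝ) + 1) • iteratedFDeriv ℝ (j + 1) φ p (Fin.cons w fun _ => x) := by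
  have hd : HasFDerivAt (fun (x : Euc n) (_ : Fin (j + 1)) => x)
      (ContinuousLinearMap.pi fun _ => ContinuousLinearMap.id ℝ (Euc n)) x :=
    (ContinuousLinearMap.pi fun _ : Fin (j + 1) => ContinuousLinearMap.id ℝ (Euc n)).hasFDerivAt
  have hm := (iteratedFDeriv ℝ (j + 1) φ p).hasFDerivAt fun _ => x
  have hc := hm.comp x hd
  rw [show (fun x => iteratedFDeriv ℝ (j + 1) φ p fun _ => x)
    = (iteratedFDeriv ℝ (j + 1) φ p) ∘ fun (x : Euc n) (_ : Fin (j + 1)) => x from rfl, hc.fderiv]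
  have hperm : ∀ i : Fin (j + 1),
      iteratedFDeriv ℝ (j + 1) φ p (Function.update (fun _ => x) i w)
        = iteratedFDeriv ℝ (j + 1) φ p (Fin.cons w fun _ => x) := by
    intro i
    rw [← hφ.iteratedFDeriv_comp_perm p _ (Equiv.swap 0 i)]
    congr 1
    rw [Function.update_comp_equiv, Equiv.symm_swap, Equiv.swap_apply_right]
    funext l
    induction l using Fin.cases with
    | zero => simp
    | succ l => simp
  simp only [ContinuousLinearMap.comp_apply, ContinuousMultilinearMap.linearDeriv_apply]
  simp [hperm, add_smul, Nat.cast_smul_eq_nsmul]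

/-- The leading part of a solution of an elliptic system at a zero of finite order admits two
components without a common factor. -/
theorem exists_isRelPrime_leading_pair {φ : Euc n → Fin N → ℝ}
    (hφ : ContDiff ℝ (⊤ : ℕ∞) φ) {p : Euc n} {B : Fin n → Matrix (Fin N) (Fin N) ℝ}
    (hB : ∀ ξ : Euc n, ξ ≠ 0 → IsUnit (∑ j, ξ j • B j)) {j : ℕ}
    (hsymb : ∀ v : Euc n, ∑ l, (B l).mulVec
      (iteratedFDeriv ℝ (j + 1) φ p (Fin.cons (EuclideanSpace.single l 1) fun _ => v)) = 0)
    (hne : iteratedFDeriv ℝ (j + 1) φ p ≠ 0) :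
    ∃ (α β : (Fin N → ℝ) →L[ℝ] ℝ) (f g : MvPolynomial (Fin n) ℝ),
      f.IsHomogeneous (j + 1) ∧ g.IsHomogeneous (j + 1) ∧ f ≠ 0 ∧ IsRelPrime f g ∧
      (∀ x, polyFun f x = α (iteratedFDeriv ℝ (j + 1) φ p fun _ => x)) ∧
      ∀ x, polyFun g x = β (iteratedFDeriv ℝ (j + 1) φ p fun _ => x) := by
  set T := iteratedFDeriv ℝ (j + 1) φ p with hTdef
  obtain ⟨v, hv⟩ := exists_iteratedFDeriv_diag_ne_zero hφ hne
  obtain ⟨m, hm⟩ := Function.ne_iff.1 hv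
  have hPm : diagPoly T m ≠ 0 := fun h => hm (by
    rw [← hTdef, ← polyFun_diagPoly, h]; simp [polyFun])
  have hdiff : ∀ x l w, fderiv ℝ (polyFun (diagPoly T l)) x w
      = ((j : ℝ) + 1) * T (Fin.cons w fun _ => x) l := by
    intro x l w
    have hTd : DifferentiableAt ℝ (fun x => T fun _ => x) x := by
      have : ContDiff ℝ (⊤ : ℕ∞) fun x : Euc n => T fun _ => x :=
        T.contDiff.comp (contDiff_pi.2 fun _ => contDiff_id)
      exact this.differentiable (by simp) x
    rw [show polyFun (diagPoly T l) = fun x => T (fun _ => x) l from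
      funext (polyFun_diagPoly T l)]
    have h := fderiv_apply hTd.hasFDerivAt.differentiableAt l
    rw [h, ContinuousLinearMap.comp_apply, fderiv_iteratedFDeriv_diag hφ]
    simp [hTdef]
  have hBP : ∀ i,
      ∑ q, ∑ l, MvPolynomial.C (B q i l) * MvPolynomial.pderiv q (diagPoly T l) = 0 := by
    intro i
    refine MvPolynomial.funext fun x => ?_
    have hx := congrFun (hsymb (WithLp.toLp 2 x)) i
    have hpd : ∀ q l, MvPolynomial.eval x (MvPolynomial.pderiv q (diagPoly T l))
        = ((j : ℝ) + 1) * T (Fin.cons (EuclideanSpace.single q 1) fun _ => WithLp.toLp 2 x) l :=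
      fun q l => by rw [← hdiff, fderiv_polyFun_single, polyFun]
    simp only [Finset.sum_apply, Matrix.mulVec, dotProduct, Pi.zero_apply] at hx
    simp only [map_sum, map_mul, MvPolynomial.eval_C, hpd, map_zero]
    rw [← mul_zero ((j : ℝ) + 1), ← hx, Finset.mul_sum]
    refine Finset.sum_congr rfl fun q _ => ?_
    rw [Finset.mul_sum]
    exact Finset.sum_congr rfl fun l _ => by ring
  obtain ⟨b, hb⟩ := exists_isRelPrime_linear_combination (diagPoly T) hPm fun h hd =>
    isUnit_of_dvd_elliptic_solution B hB (diagPoly T) (isHomogeneous_diagPoly T) hBP hPm hd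
  refine ⟨ContinuousLinearMap.proj m, ∑ l, b l • ContinuousLinearMap.proj l, diagPoly T m, _,
    isHomogeneous_diagPoly T m, ?_, hPm, hb, polyFun_diagPoly T m, fun x => ?_⟩
  · refine MvPolynomial.IsHomogeneous.sum _ _ _ fun l _ => ?_
    simpa using (MvPolynomial.isHomogeneous_C (Fin n) (b l)).mul (isHomogeneous_diagPoly T l)
  · simp only [polyFun, map_sum, map_mul, MvPolynomial.eval_C]
    rw [_root_.sum_apply]
    exact Finset.sum_congr rfl fun l _ => congrArg (b l * ·) (polyFun_diagPoly T l x)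

end LeadingPart

section SliceCount

variable {n : ℕ}

theorem norm_le_norm_of_forall_abs_le {x y : Euc n} (h : ∀ l, |x l| ≤ |y l|) : ‖x‖ ≤ ‖y‖ := by
  rw [EuclideanSpace.norm_eq, EuclideanSpace.norm_eq]
  exact Real.sqrt_le_sqrt (Finset.sum_le_sum fun l _ => by
    simpa using sq_le_sq.2 (h l))

/-- A two-dimensional coordinate slice through a small ball meets the zero set in at most
`k (2 k - 1)` points, provided the restriction of two components of the leading part to the
plane has no common projective zero. -/
theorem eventually_card_slice_le {F : Type} [NormedAddCommGroup F] [NormedSpace ℝ F]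
    [CompleteSpace F] {φ : Euc n → F} (hφ : ContDiff ℝ (⊤ : ℕ∞) φ) {p : Euc n} {k : ℕ}
    (hk : 1 ≤ k) (hvan : ∀ m < k, iteratedFDeriv ℝ m φ p = 0) {α β : F →L[ℝ] ℝ}
    {f g : MvPolynomial (Fin n) ℝ} (hf : f.IsHomogeneous k) (hg : g.IsHomogeneous k)
    (hfα : ∀ x, polyFun f x = α (iteratedFDeriv ℝ k φ p fun _ => x))
    (hgβ : ∀ x, polyFun g x = β (iteratedFDeriv ℝ k φ p fun _ => x))
    (L : Euc n →L[ℝ] Euc n) {i j : Fin n} (hij : i ≠ j)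
    (hres : (lineRestrict (L (EuclideanSpace.single i 1)).ofLp
        (L (EuclideanSpace.single j 1)).ofLp f).resultant
      (lineRestrict (L (EuclideanSpace.single i 1)).ofLp
        (L (EuclideanSpace.single j 1)).ofLp g) k k ≠ 0) :
    ∀ᶠ ρ in 𝓝[>] (0 : ℝ), ∀ t : Finset (Euc n), (∀ y ∈ t, y ∈ ball 0 ρ ∧ φ (p + L y) = 0) →
      (∀ y ∈ t, ∀ y' ∈ t, ∀ l, l ≠ i → l ≠ j → y l = y' l) → t.card ≤ k * (2 * k - 1) := by
  obtain ⟨ψ, hψ, hr, h0⟩ := exists_smooth_blow_up hφ p k hvan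
  let e : Fin n → Euc n := fun l => EuclideanSpace.single l 1
  let pt : (ℝ × Euc n) × (ℝ × ℝ) → Euc n :=
    fun w => w.1.1 • w.1.2 + w.2.1 • e i + w.2.2 • e j
  have hpt : ContDiff ℝ (⊤ : ℕ∞) fun w : (ℝ × Euc n) × (ℝ × ℝ) => ψ (L (pt w), w.1.1) := by
    refine hψ.comp (ContDiff.prodMk (L.contDiff.comp ?_) (by fun_prop))
    fun_prop
  have hcoe : ∀ z : ℝ × ℝ, (L (z.1 • e i + z.2 • e j)).ofLp
      = z.1 • (L (e i)).ofLp + z.2 • (L (e j)).ofLp := fun z => by simp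
  have hlim : ∀ (γ : F →L[ℝ] ℝ) (h : MvPolynomial (Fin n) ℝ),
      (∀ x, polyFun h x = γ (iteratedFDeriv ℝ k φ p fun _ => x)) →
      ∀ θ ∈ ({0} : Set ℝ) ×ˢ closedBall (0 : Euc n) 1, ∀ z : ℝ × ℝ,
        (k.factorial : ℝ) * γ (ψ (L (pt (θ, z)), θ.1))
          = polyFun h (L (z.1 • e i + z.2 • e j)) := by
    rintro γ h hh ⟨r, η⟩ hθ z
    obtain rfl : r = 0 := hθ.1
    rw [hh, ← h0, map_smul, smul_eq_mul]
    simp [pt]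
  have hsm : ∀ h : MvPolynomial (Fin n) ℝ,
      ContDiff ℝ (⊤ : ℕ∞) fun z : ℝ × ℝ => polyFun h (L (z.1 • e i + z.2 • e j)) := fun h =>
    (contDiff_polyFun h).comp (L.contDiff.comp (by fun_prop))
  have hev := eventually_card_common_zeros_le
    (F₁ := fun w => (k.factorial : ℝ) * α (ψ (L (pt w), w.1.1)))
    (F₂ := fun w => (k.factorial : ℝ) * β (ψ (L (pt w), w.1.1)))
    (contDiff_const.mul (α.contDiff.comp hpt)) (contDiff_const.mul (β.contDiff.comp hpt))
    (hsm f) (hsm g) (isCompact_singleton.prod (isCompact_closedBall (0 : Euc n) 1))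
    (hlim α f hfα) (hlim β g hgβ) (D := 2 * k - 1) fun a b hab => by
      obtain ⟨q, q', hq, hq', h⟩ := exists_mul_add_mul_eq_monomial hf hg hres a b (by omega)
      refine ⟨q, q', hq, hq', fun z => ?_⟩
      rw [h z, polyFun, polyFun, hcoe]
  have hev' := Filter.Eventually.forall_mem_of_nhdsSet_prod isCompact_singleton
    (isCompact_closedBall (0 : Euc n) 1) hev
  rw [nhdsSet_singleton] at hev'
  have hsqrt : Tendsto Real.sqrt (𝓝[>] 0) (𝓝 0) := by
    simpa using (Real.continuous_sqrt.tendsto 0).mono_left nhdsWithin_le_nhds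
  filter_upwards [hsqrt.eventually hev', self_mem_nhdsWithin,
    nhdsWithin_le_nhds (Iio_mem_nhds one_pos)] with ρ hρ hρ0 hρ1 t ht hslice
  have hρ0 : 0 < ρ := hρ0
  have hρ1 : ρ < 1 := hρ1
  set r := Real.sqrt ρ with hrdef
  have hr0 : 0 < r := Real.sqrt_pos.2 hρ0
  have hrr : r * r = ρ := Real.mul_self_sqrt hρ0.le
  rcases t.eq_empty_or_nonempty with rfl | ⟨y₀, hy₀⟩
  · simp
  let z : Euc n := WithLp.toLp 2 fun l => if l = i ∨ l = j then 0 else y₀ l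
  have hz : ‖ρ⁻¹ • z‖ ≤ 1 := by
    have h1 : ‖z‖ ≤ ‖y₀‖ := norm_le_norm_of_forall_abs_le fun l => by
      by_cases h : l = i ∨ l = j <;> simp [z, h]
    have h2 : ‖y₀‖ < ρ := by simpa using (ht y₀ hy₀).1
    rw [norm_smul, Real.norm_eq_abs, abs_of_pos (by positivity), inv_mul_le_one₀ hρ0]
    exact h1.trans h2.le
  have hdec : ∀ y ∈ t, y = r • pt ((r, ρ⁻¹ • z), (y i / r, y j / r)) := by
    intro y hy
    have h1 : r • pt ((r, ρ⁻¹ • z), (y i / r, y j / r)) = z + y i • e i + y j • e j := by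
      have h2 : r * (r * ρ⁻¹) = 1 := by rw [← mul_assoc, hrr, mul_inv_cancel₀ hρ0.ne']
      simp only [pt, smul_add, smul_smul, h2, one_smul, mul_div_cancel₀ _ hr0.ne']
    rw [h1]
    ext l
    by_cases hli : l = i
    · subst hli; simp [z, e, hij]
    by_cases hlj : l = j
    · subst hlj; simp [z, e, hli]
    simp [z, e, hli, hlj, hslice y hy y₀ hy₀ l hli hlj]
  let π : Euc n → ℝ × ℝ := fun y => (y i / r, y j / r)
  have hinj : Set.InjOn π t := fun y hy y' hy' h => by
    rw [hdec y hy, hdec y' hy']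
    exact congrArg (fun w => r • pt ((r, ρ⁻¹ • z), w)) h
  have hcoord : ∀ y ∈ t, ∀ l, |y l / r| ≤ 1 := fun y hy l => by
    have h1 : |y l| ≤ ‖y‖ := by simpa using PiLp.norm_apply_le y l
    have h2 : ‖y‖ < ρ := by simpa using (ht y hy).1
    have h3 : r ≤ 1 := Real.sqrt_le_one.2 hρ1.le
    rw [abs_div, abs_of_pos hr0, div_le_one hr0]
    nlinarith
  have hψ0 : ∀ y ∈ t, ψ (L (pt ((r, ρ⁻¹ • z), π y)), r) = 0 := fun y hy => by
    have h1 := (ht y hy).2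
    rw [hdec y hy, map_smul, hr] at h1
    exact (smul_eq_zero.1 h1).resolve_left (pow_ne_zero _ hr0.ne')
  have hcard := hρ (ρ⁻¹ • z) (by simpa using hz) (t.image π) (by
      intro w hw
      obtain ⟨y, hy, rfl⟩ := Finset.mem_image.1 hw
      simp only [mem_closedBall, dist_zero_right, Prod.norm_def, sup_le_iff]
      exact ⟨hcoord y hy i, hcoord y hy j⟩) (by
      intro w hw
      obtain ⟨y, hy, rfl⟩ := Finset.mem_image.1 hw
      simp [hψ0 y hy])
  rw [Finset.card_image_of_injOn hinj] at hcard
  refine hcard.trans_eq ?_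
  rw [show (2 * k - 1) * (2 * k - 1 + 1) = 2 * (k * (2 * k - 1)) by
    rw [Nat.sub_add_cancel (by omega)]; ring]
  exact Nat.mul_div_cancel_left _ two_pos

end SliceCount

section LocalMeasure

variable {n N : ℕ}

theorem exists_pair_forall_mem_range (hn : 2 ≤ n) (f : Fin (n - 2) ↪ Fin n) :
    ∃ i j : Fin n, i ≠ j ∧ ∀ l, l ≠ i → l ≠ j → l ∈ Set.range f := by
  have hcard : ((Finset.univ.map f)ᶜ : Finset (Fin n)).card = 2 := by
    rw [Finset.card_compl, Finset.card_map, Finset.card_fin, Fintype.card_fin]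
    omega
  obtain ⟨i, j, hij, h⟩ := Finset.card_eq_two.1 hcard
  refine ⟨i, j, hij, fun l hi hj => ?_⟩
  have hl : l ∉ (Finset.univ.map f)ᶜ := by simp [h, hi, hj]
  simpa using hl

theorem finrank_ker_comp_equiv_le {E E' F : Type} [NormedAddCommGroup E] [NormedSpace ℝ E]
    [NormedAddCommGroup E'] [NormedSpace ℝ E'] [FiniteDimensional ℝ E'] [NormedAddCommGroup F]
    [NormedSpace ℝ F] (T : E' →L[ℝ] F) (L : E ≃L[ℝ] E') :
    Module.finrank ℝ (LinearMap.ker (T.comp (L : E →L[ℝ] E')).toLinearMap)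
      ≤ Module.finrank ℝ (LinearMap.ker T.toLinearMap) := by
  rw [← LinearEquiv.finrank_map_eq L.toLinearEquiv]
  refine Submodule.finrank_mono ?_
  rintro _ ⟨x, hx, rfl⟩
  exact hx

/-- A slice bound for the zero set of a solution near a zero of finite order gives a bound for
its Hausdorff measure. -/
theorem eventually_factorial_mul_hausdorffMeasure_le (hn : 2 ≤ n) {φ : Euc n → Fin N → ℝ}
    (hφ : ContDiff ℝ (⊤ : ℕ∞) φ) {p : Euc n} {k : ℕ}
    (hsymb : ∀ᶠ x in 𝓝 p, ∃ B : Fin n → Matrix (Fin N) (Fin N) ℝ,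
      (∀ ξ : Euc n, ξ ≠ 0 → IsUnit (∑ j, ξ j • B j)) ∧
      ∀ j, (∀ m < j + 1, iteratedFDeriv ℝ m φ x = 0) → ∀ v : Euc n, ∑ l, (B l).mulVec
        (iteratedFDeriv ℝ (j + 1) φ x (Fin.cons (EuclideanSpace.single l 1) fun _ => v)) = 0)
    (hne : iteratedFDeriv ℝ k φ p ≠ 0) (L : Euc n ≃L[ℝ] Euc n) {M : ℕ}
    (hM : ∀ i j : Fin n, i ≠ j → ∀ᶠ ρ in 𝓝[>] (0 : ℝ), ∀ t : Finset (Euc n),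
      (∀ y ∈ t, y ∈ ball 0 ρ ∧ φ (p + L y) = 0) →
      (∀ y ∈ t, ∀ y' ∈ t, ∀ l, l ≠ i → l ≠ j → y l = y' l) → t.card ≤ M) :
    ∀ᶠ ρ in 𝓝[>] (0 : ℝ), ((n - 2).factorial : ℝ≥0∞) *
        μH[((n - 2 : ℕ) : ℝ)] {y | y ∈ ball (0 : Euc n) ρ ∧ φ (p + L y) = 0}
      ≤ (n.descFactorial (n - 2) : ℝ≥0∞) *
        (M * μH[((n - 2 : ℕ) : ℝ)] (ball (0 : Euc (n - 2)) ρ)) := by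
  have hcD : ∀ m, Continuous (iteratedFDeriv ℝ m φ) := fun m =>
    hφ.continuous_iteratedFDeriv (by exact_mod_cast le_top)
  have hL : Continuous fun y : Euc n => p + L y := by fun_prop
  have hgood : ∀ᶠ y in 𝓝 (0 : Euc n), iteratedFDeriv ℝ k φ (p + L y) ≠ 0 ∧
      ∃ B : Fin n → Matrix (Fin N) (Fin N) ℝ,
      (∀ ξ : Euc n, ξ ≠ 0 → IsUnit (∑ j, ξ j • B j)) ∧
      ∀ j, (∀ m < j + 1, iteratedFDeriv ℝ m φ (p + L y) = 0) → ∀ v : Euc n,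
        ∑ l, (B l).mulVec (iteratedFDeriv ℝ (j + 1) φ (p + L y)
          (Fin.cons (EuclideanSpace.single l 1) fun _ => v)) = 0 := by
    have ht : Tendsto (fun y : Euc n => p + L y) (𝓝 0) (𝓝 p) := by
      simpa using hL.tendsto 0
    exact ht.eventually (((hcD k).continuousAt.eventually_ne hne).and hsymb)
  obtain ⟨ε, hε, hball⟩ := Metric.eventually_nhds_iff_ball.1 hgood
  have hM' : ∀ᶠ ρ in 𝓝[>] (0 : ℝ), ∀ i j : Fin n, i ≠ j → ∀ t : Finset (Euc n),
      (∀ y ∈ t, y ∈ ball 0 ρ ∧ φ (p + L y) = 0) →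
      (∀ y ∈ t, ∀ y' ∈ t, ∀ l, l ≠ i → l ≠ j → y l = y' l) → t.card ≤ M :=
    eventually_all.2 fun i => eventually_all.2 fun j => eventually_imp_distrib_left.2 (hM i j)
  filter_upwards [hM', nhdsWithin_le_nhds (Iio_mem_nhds hε)] with ρ hρM hρε
  have hρε : ρ < ε := hρε
  have hgoodρ := fun y (hy : y ∈ ball (0 : Euc n) ρ) => hball y (ball_subset_ball hρε.le hy)
  let S : ℕ → Set (Euc n) := fun j => {y | y ∈ ball (0 : Euc n) ρ ∧
    iteratedFDeriv ℝ (j + 1) φ (p + L y) ≠ 0} ∩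
    {y | ∀ m < j + 1, iteratedFDeriv ℝ m φ (p + L y) = 0}
  have hlc : ∀ j, IsLocallyClosed (S j) := fun j => by
    refine ⟨_, _, ?_, ?_, rfl⟩
    · exact isOpen_ball.inter (isOpen_ne_fun ((hcD _).comp hL) continuous_const)
    · simp only [ofPred_forall]
      exact isClosed_iInter fun m => isClosed_iInter fun _ =>
        isClosed_eq ((hcD m).comp hL) continuous_const
  have hdisj : Pairwise (Function.onFun Disjoint S) := by
    have key : ∀ i j, i < j → Disjoint (S i) (S j) := fun i j hij =>
      Set.disjoint_left.2 fun y hi hj => hi.1.2 (hj.2 (i + 1) (by omega))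
    intro i j hij
    rcases lt_or_gt_of_ne hij with h | h
    · exact key i j h
    · exact (key j i h).symm
  have htan : ∀ j, ∀ x ∈ S j, ∃ ι : Euc (n - 2) →ₗᵢ[ℝ] Euc n, HasTangentPlane (S j) x ι := by
    intro j x hx
    obtain ⟨-, B, hB, hs⟩ := hgoodρ x hx.1.1
    obtain ⟨Ψ, T, hΨ, hz, hker⟩ :=
      exists_hasStrictFDerivAt_finrank_ker_le hφ hB (hs j hx.2) hx.1.2
    have hLs : HasStrictFDerivAt (fun y : Euc n => p + L y) (L : Euc n →L[ℝ] Euc n) x :=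
      (L : Euc n →L[ℝ] Euc n).hasStrictFDerivAt.const_add p
    exact exists_hasTangentPlane (Nat.sub_le n 2) (hΨ.comp x hLs)
      (fun y hy => hz _ (hy.2 j j.lt_succ_self)) ((finrank_ker_comp_equiv_le T L).trans hker)
  have hzero : ∀ y, φ (p + L y) = 0 ↔ iteratedFDeriv ℝ 0 φ (p + L y) = 0 := fun y => by
    rw [← norm_eq_zero, ← norm_iteratedFDeriv_zero (𝕜 := ℝ), norm_eq_zero]
  have hunion : ⋃ j, S j = {y | y ∈ ball (0 : Euc n) ρ ∧ φ (p + L y) = 0} := by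
    ext y
    simp only [mem_iUnion, mem_ofPred_eq]
    constructor
    · rintro ⟨j, hj⟩
      exact ⟨hj.1.1, (hzero y).2 (hj.2 0 j.succ_pos)⟩
    · rintro ⟨hy, h0⟩
      have hex : ∃ m, iteratedFDeriv ℝ m φ (p + L y) ≠ 0 := ⟨k, (hgoodρ y hy).1⟩
      classical
      obtain ⟨j, hj⟩ : ∃ j, Nat.find hex = j + 1 :=
        Nat.exists_eq_succ_of_ne_zero fun h => by
          have := Nat.find_spec hex
          rw [h] at this
          exact this ((hzero y).1 h0)
      refine ⟨j, ⟨hy, hj ▸ Nat.find_spec hex⟩, fun m hm => ?_⟩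
      exact not_not.1 (Nat.find_min hex (hj ▸ hm))
  have hfin := factorial_mul_hausdorffMeasure_le S hlc hdisj htan M ρ (fun j y hy => hy.1.1) ?_
  · rwa [hunion] at hfin
  · intro f c t ht hc
    obtain ⟨i, j, hij, hr⟩ := exists_pair_forall_mem_range hn f
    refine hρM i j hij t (fun y hy => ?_) fun y hy y' hy' l hi hj => ?_
    · have := ht hy
      rwa [hunion] at this
    · obtain ⟨a, rfl⟩ := hr l hi hj
      rw [← coordProj_apply, ← coordProj_apply, hc y hy, hc y' hy']

end LocalMeasure

section NearIdentity

variable {n N : ℕ}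

theorem eventually_hausdorffMeasure_zeros_le (hn : 2 ≤ n) {φ : Euc n → Fin N → ℝ}
    (hφ : ContDiff ℝ (⊤ : ℕ∞) φ) {p : Euc n} {k : ℕ} (hk : 1 ≤ k)
    (hsymb : ∀ᶠ x in 𝓝 p, ∃ B : Fin n → Matrix (Fin N) (Fin N) ℝ,
      (∀ ξ : Euc n, ξ ≠ 0 → IsUnit (∑ j, ξ j • B j)) ∧
      ∀ j, (∀ m < j + 1, iteratedFDeriv ℝ m φ x = 0) → ∀ v : Euc n, ∑ l, (B l).mulVec
        (iteratedFDeriv ℝ (j + 1) φ x (Fin.cons (EuclideanSpace.single l 1) fun _ => v)) = 0)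
    (hvan : ∀ m < k, iteratedFDeriv ℝ m φ p = 0) (hne : iteratedFDeriv ℝ k φ p ≠ 0)
    {ε : ℝ} (hε : 0 < ε) (hε1 : ε < 1) :
    ∀ᶠ ρ in 𝓝[>] (0 : ℝ), μH[((n - 2 : ℕ) : ℝ)] {x | x ∈ ball p ρ ∧ φ x = 0} ≤
      ENNReal.ofReal (((1 + ε) / (1 - ε)) ^ (n - 2)) *
        (((n.choose 2 * (k * (2 * k - 1)) : ℕ) : ℝ≥0∞) * ENNReal.ofReal ((2 * ρ) ^ (n - 2))) := by
  obtain ⟨j, rfl⟩ : ∃ j, k = j + 1 := ⟨k - 1, by omega⟩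
  obtain ⟨B, hB, hs⟩ := hsymb.self_of_nhds
  obtain ⟨α, β, f, g, hf, hg, hf0, hfg, hfα, hgβ⟩ :=
    exists_isRelPrime_leading_pair hφ hB (hs j hvan) hne
  let toL : Matrix (Fin n) (Fin n) ℝ →ₗ[ℝ] (Euc n →L[ℝ] Euc n) :=
    (Matrix.toEuclideanCLM (n := Fin n) (𝕜 := ℝ)).toAlgEquiv.toLinearMap
  have htoL1 : toL 1 = 1 := map_one (Matrix.toEuclideanCLM (n := Fin n) (𝕜 := ℝ))
  have hU : {Q | ‖toL Q - 1‖ < ε} ∈ 𝓝 (1 : Matrix (Fin n) (Fin n) ℝ) := by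
    have hc : Continuous toL := toL.continuous_of_finiteDimensional
    refine (isOpen_lt (hc.sub continuous_const).norm continuous_const).mem_nhds ?_
    simp [htoL1, hε]
  obtain ⟨Q, hQ, hres⟩ := exists_matrix_resultant_ne_zero hf hg hf0 hfg hU
  have hcol : ∀ i, (toL Q (EuclideanSpace.single i 1)).ofLp = Q.col i := fun i => by
    ext l; simp [toL]
  have hdist : ∀ y, ‖toL Q y - y‖ ≤ ε * ‖y‖ := fun y =>
    ((toL Q - 1).le_opNorm y).trans (by gcongr; exact hQ.le)
  have hlow : ∀ y, (1 - ε) * ‖y‖ ≤ ‖toL Q y‖ := fun y => by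
    have h1 := norm_sub_norm_le y (toL Q y)
    have h2 := hdist y
    rw [norm_sub_rev] at h2
    linarith
  have hupp : ∀ y, ‖toL Q y‖ ≤ (1 + ε) * ‖y‖ := fun y => by
    have h1 := norm_sub_norm_le (toL Q y) y
    have h2 := hdist y
    linarith
  have hinj : Function.Injective (toL Q).toLinearMap := by
    rw [← LinearMap.ker_eq_bot, LinearMap.ker_eq_bot']
    intro y hy
    have h := hlow y
    rw [show toL Q y = 0 from hy, norm_zero] at h
    exact norm_le_zero_iff.1 (nonpos_of_mul_nonpos_right h (by linarith))
  let L : Euc n ≃L[ℝ] Euc n := (LinearEquiv.ofInjectiveEndo _ hinj).toContinuousLinearEquiv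
  have hLQ : ∀ y, L y = toL Q y := fun _ => rfl
  have hslice := eventually_factorial_mul_hausdorffMeasure_le hn hφ hsymb hne L
    (M := (j + 1) * (2 * (j + 1) - 1)) fun a b hab => by
      refine eventually_card_slice_le hφ hk hvan hf hg hfα hgβ (L : Euc n →L[ℝ] Euc n) hab ?_
      have := hres a b hab
      rwa [← hcol, ← hcol] at this
  have hscale : Tendsto (fun ρ : ℝ => ρ / (1 - ε)) (𝓝[>] 0) (𝓝[>] 0) := by
    refine tendsto_nhdsWithin_iff.2 ⟨?_, ?_⟩
    · have : Continuous fun ρ : ℝ => ρ / (1 - ε) := by fun_prop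
      simpa using (this.tendsto 0).mono_left nhdsWithin_le_nhds
    · filter_upwards [self_mem_nhdsWithin] with ρ hρ
      exact div_pos (show (0 : ℝ) < ρ from hρ) (by linarith)
  filter_upwards [hscale.eventually hslice, self_mem_nhdsWithin] with ρ hρ hρ0
  have hρ0 : 0 < ρ := hρ0
  set ρ' := ρ / (1 - ε) with hρ'
  have hρ'0 : 0 < ρ' := div_pos hρ0 (by linarith)
  have hsub : {x | x ∈ ball p ρ ∧ φ x = 0} ⊆
      (fun y => p + L y) '' {y | y ∈ ball (0 : Euc n) ρ' ∧ φ (p + L y) = 0} := by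
    rintro x ⟨hx, hx0⟩
    have hx' : p + L (L.symm (x - p)) = x := by simp
    refine ⟨L.symm (x - p), ⟨?_, by rwa [hx']⟩, hx'⟩
    have h := hlow (L.symm (x - p))
    rw [← hLQ, L.apply_symm_apply] at h
    rw [mem_ball_zero_iff, hρ', lt_div_iff₀ (by linarith), mul_comm]
    exact h.trans_lt (by rwa [mem_ball, dist_eq_norm] at hx)
  have hLip : LipschitzWith (Real.toNNReal (1 + ε)) fun y => p + L y :=
    LipschitzWith.of_dist_le_mul fun y y' => by
      rw [dist_add_left, dist_eq_norm, dist_eq_norm, ← map_sub, Real.coe_toNNReal _ (by linarith)]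
      exact hupp _
  have hfac : μH[((n - 2 : ℕ) : ℝ)] {y | y ∈ ball (0 : Euc n) ρ' ∧ φ (p + L y) = 0}
      ≤ ((n.choose 2 * ((j + 1) * (2 * (j + 1) - 1)) : ℕ) : ℝ≥0∞) *
        ENNReal.ofReal ((2 * ρ') ^ (n - 2)) := by
    have hf0 : ((n - 2).factorial : ℝ≥0∞) ≠ 0 := by exact_mod_cast (n - 2).factorial_ne_zero
    refine (ENNReal.mul_le_mul_iff_right hf0 (ENNReal.natCast_ne_top _)).1 (hρ.trans ?_)
    rw [Nat.descFactorial_eq_factorial_mul_choose, Nat.choose_symm hn]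
    calc _ ≤ ((((n - 2).factorial * n.choose 2 : ℕ) : ℝ≥0∞)) *
          ((((j + 1) * (2 * (j + 1) - 1) : ℕ) : ℝ≥0∞) *
            ENNReal.ofReal ((2 * ρ') ^ (n - 2))) := by
          gcongr
          exact hausdorffMeasure_ball_le _ hρ'0
      _ = _ := by push_cast; ring
  calc μH[((n - 2 : ℕ) : ℝ)] {x | x ∈ ball p ρ ∧ φ x = 0}
      ≤ _ := measure_mono hsub
    _ ≤ _ := hLip.hausdorffMeasure_image_le (Nat.cast_nonneg _) _
    _ ≤ ENNReal.ofReal ((1 + ε) ^ (n - 2)) * _ := by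
      rw [ENNReal.rpow_natCast, ENNReal.ofReal_pow (by linarith)]
      exact mul_le_mul_right hfac _
    _ = _ := by
      rw [mul_left_comm, mul_left_comm (ENNReal.ofReal (((1 + ε) / (1 - ε)) ^ (n - 2))),
        ← ENNReal.ofReal_mul (by positivity),
        ← ENNReal.ofReal_mul (pow_nonneg (div_nonneg (by linarith) (by linarith)) _),
        ← mul_pow, ← mul_pow, hρ']
      congr 3
      ring

end NearIdentity

theorem ContDiffOn.exists_contDiff_eventuallyEq {n : ℕ} {F : Type} [NormedAddCommGroup F]
    [NormedSpace ℝ F] {φ : Euc n → F} {U : Set (Euc n)} (hφ : ContDiffOn ℝ (⊤ : ℕ∞) φ U)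
    (hU : IsOpen U) {p : Euc n} (hp : p ∈ U) :
    ∃ φ' : Euc n → F, ContDiff ℝ (⊤ : ℕ∞) φ' ∧ φ' =ᶠ[𝓝 p] φ := by
  obtain ⟨ε, hε, hball⟩ := Metric.isOpen_iff.1 hU p hp
  let χ : ContDiffBump p := ⟨ε / 4, ε / 2, by positivity, by linarith⟩
  refine ⟨fun x => χ x • φ x, ?_, ?_⟩
  · refine contDiff_iff_contDiffAt.2 fun x => ?_
    by_cases hx : x ∈ tsupport χ
    · rw [χ.tsupport_eq] at hx
      have hxU : x ∈ U := hball (closedBall_subset_ball (half_lt_self hε) hx)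
      exact χ.contDiff.contDiffAt.smul (hφ.contDiffAt (hU.mem_nhds hxU))
    · have h0 : (fun x => χ x • φ x) =ᶠ[𝓝 x] fun _ => 0 := by
        filter_upwards [notMem_tsupport_iff_eventuallyEq.1 hx] with y hy
        simp [hy]
      exact contDiffAt_const.congr_of_eventuallyEq h0
  · filter_upwards [χ.eventuallyEq_one] with x hx
    simp [hx]

theorem eventually_norm_le_mul_norm_snd {E F G : Type} [NormedAddCommGroup E] [NormedSpace ℝ E]
    [NormedAddCommGroup F] [NormedSpace ℝ F] [NormedAddCommGroup G] [NormedSpace ℝ G]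
    {V : E → F → G} {x : E} (hV : ContDiffAt ℝ 1 (fun w : E × F => V w.1 w.2) (x, 0))
    (hV0 : ∀ᶠ y in 𝓝 x, V y 0 = 0) :
    ∃ C : ℝ, ∀ᶠ w in 𝓝 (x, (0 : F)), ‖V w.1 w.2‖ ≤ C * ‖w.2‖ := by
  obtain ⟨K, t, ht, hK⟩ := hV.exists_lipschitzOnWith
  refine ⟨K, ?_⟩
  have h1 : Tendsto (fun w : E × F => (w.1, (0 : F))) (𝓝 (x, 0)) (𝓝 (x, 0)) :=
    (by fun_prop : Continuous fun w : E × F => (w.1, (0 : F))).tendsto (x, 0)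
  have h2 : Tendsto (fun w : E × F => w.1) (𝓝 (x, 0)) (𝓝 x) := continuous_fst.tendsto (x, 0)
  filter_upwards [ht, h1 ht, h2.eventually hV0] with w hw hw' hw0
  have := hK.dist_le_mul w hw _ hw'
  simpa [hw0, Prod.dist_eq] using this

/-- The symbol condition on leading parts holds at every point near a point of the domain. -/
theorem eventually_symbol_leading_part {n N : ℕ} {U : Set (Euc n)} (hU : IsOpen U)
    {A : Fin n → Euc n → Matrix (Fin N) (Fin N) ℝ}
    (hA : ∀ j i l, ContDiffOn ℝ (⊤ : ℕ∞) (fun x => A j x i l) U)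
    (hell : ∀ x ∈ U, ∀ ξ : Euc n, ξ ≠ 0 → IsUnit (∑ j, ξ j • A j x))
    {V : Euc n → (Fin N → ℝ) → Fin N → ℝ}
    (hV : ContDiffOn ℝ (⊤ : ℕ∞) (fun w : Euc n × (Fin N → ℝ) => V w.1 w.2) (U ×ˢ univ))
    (hV0 : ∀ x ∈ U, V x 0 = 0) {φ φ' : Euc n → Fin N → ℝ}
    (heq : ∀ x ∈ U,
      (∑ j, (A j x).mulVec (fderiv ℝ φ x (EuclideanSpace.single j 1))) + V x (φ x) = 0)
    (hφ' : ContDiff ℝ (⊤ : ℕ∞) φ') {p : Euc n} (hp : p ∈ U) (hφφ' : φ' =ᶠ[𝓝 p] φ) :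
    ∀ᶠ x in 𝓝 p, ∃ B : Fin n → Matrix (Fin N) (Fin N) ℝ,
      (∀ ξ : Euc n, ξ ≠ 0 → IsUnit (∑ j, ξ j • B j)) ∧
      ∀ j, (∀ m < j + 1, iteratedFDeriv ℝ m φ' x = 0) → ∀ v : Euc n, ∑ l, (B l).mulVec
        (iteratedFDeriv ℝ (j + 1) φ' x (Fin.cons (EuclideanSpace.single l 1) fun _ => v)) = 0 := by
  filter_upwards [hφφ'.eventuallyEq_nhds, hU.mem_nhds hp] with x hx hxU
  refine ⟨fun l => A l x, hell x hxU, fun j hvan v => ?_⟩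
  have hAc : ∀ l, ContinuousAt (A l) x := fun l =>
    continuousAt_pi.2 fun i => continuousAt_pi.2 fun i' =>
      (hA l i i').continuousOn.continuousAt (hU.mem_nhds hxU)
  obtain ⟨C, hC⟩ := eventually_norm_le_mul_norm_snd (V := V) (x := x)
    ((hV.contDiffAt ((hU.prod isOpen_univ).mem_nhds ⟨hxU, mem_univ _⟩)).of_le (by
      exact_mod_cast le_top))
    (by filter_upwards [hU.mem_nhds hxU] with y hy using hV0 y hy)
  refine sum_symbol_mulVec_iteratedFDeriv_eq_zero hφ' hAc hC ?_ hvan v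
  filter_upwards [hx.eventuallyEq_nhds, hU.mem_nhds hxU] with y hy hyU
  rw [hy.fderiv_eq, hy.self_of_nhds]
  exact heq y hyU

theorem choose_two_mul_le_rpow_bound {n k : ℕ} (hn : 2 ≤ n) (hk : 1 ≤ k) :
    ((n.choose 2 * (k * (2 * k - 1)) : ℕ) : ℝ≥0∞) * 2 ^ (n - 2) ≤
      (2 : ℝ≥0∞) ^ ((n : ℝ) - 3) * n * ((n : ℝ≥0∞) - 1) * k ^ 3 := by
  have hpow : (2 : ℝ≥0∞) ^ (n - 2) = 2 * (2 : ℝ≥0∞) ^ ((n : ℝ) - 3) := by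
    rw [← ENNReal.rpow_natCast, Nat.cast_sub hn,
      show (n : ℝ) - (2 : ℕ) = 1 + ((n : ℝ) - 3) by push_cast; ring,
      ENNReal.rpow_add _ _ two_ne_zero ENNReal.ofNat_ne_top, ENNReal.rpow_one]
  have hsub : (n : ℝ≥0∞) - 1 = ((n - 1 : ℕ) : ℝ≥0∞) := by
    rw [ENNReal.natCast_sub, Nat.cast_one]
  have hnat : 2 * (n.choose 2 * (k * (2 * k - 1))) ≤ n * (n - 1) * k ^ 3 := by
    have h1 : 2 * n.choose 2 = n * (n - 1) := by
      rw [Nat.choose_two_right]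
      exact Nat.mul_div_cancel' (Nat.even_mul_pred_self n).two_dvd
    have h2 : k * (2 * k - 1) ≤ k ^ 3 := by
      have : 2 * k - 1 ≤ k * k := by
        obtain ⟨j, rfl⟩ : ∃ j, k = j + 1 := ⟨k - 1, by omega⟩
        rw [show 2 * (j + 1) - 1 = 2 * j + 1 by omega]
        nlinarith
      calc k * (2 * k - 1) ≤ k * (k * k) := Nat.mul_le_mul_left _ this
        _ = k ^ 3 := by ring
    calc 2 * (n.choose 2 * (k * (2 * k - 1))) = n * (n - 1) * (k * (2 * k - 1)) := by
          rw [← h1]; ring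
      _ ≤ _ := Nat.mul_le_mul_left _ h2
  rw [hpow, hsub]
  calc _ = (2 : ℝ≥0∞) ^ ((n : ℝ) - 3) * ((2 * (n.choose 2 * (k * (2 * k - 1))) : ℕ) : ℝ≥0∞) := by
        push_cast; ring
    _ ≤ (2 : ℝ≥0∞) ^ ((n : ℝ) - 3) * ((n * (n - 1) * k ^ 3 : ℕ) : ℝ≥0∞) := by
        gcongr
    _ = _ := by push_cast; ring

/-- A family of bounds with constants tending to one passes to the upper density. -/
theorem limsup_div_le_of_forall_eventually_le {m : ℕ} {ν : ℝ → ℝ≥0∞} {b a c : ℝ≥0∞}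
    (ha : a ≠ 0) (ha' : a ≠ ∞)
    (h : ∀ ε : ℝ, 0 < ε → ε < 1 → ∀ᶠ ρ in 𝓝[>] (0 : ℝ), ν ρ ≤
      ENNReal.ofReal (((1 + ε) / (1 - ε)) ^ m) * (b * ENNReal.ofReal ((2 * ρ) ^ m)))
    (hc : b * 2 ^ m ≤ c) :
    limsup (fun ρ => ν ρ / (a * ENNReal.ofReal (ρ ^ m))) (𝓝[>] (0 : ℝ)) ≤ c / a := by
  have hlim : Tendsto (fun ε : ℝ => ENNReal.ofReal (((1 + ε) / (1 - ε)) ^ m) * (c / a))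
      (𝓝[>] 0) (𝓝 (c / a)) := by
    have h1 : Tendsto (fun ε : ℝ => ENNReal.ofReal (((1 + ε) / (1 - ε)) ^ m)) (𝓝[>] 0) (𝓝 1) := by
      have : ContinuousAt (fun ε : ℝ => ((1 + ε) / (1 - ε)) ^ m) 0 := by
        refine ContinuousAt.pow (ContinuousAt.div ?_ ?_ (by norm_num)) m <;> fun_prop
      simpa using (ENNReal.tendsto_ofReal this.tendsto).mono_left nhdsWithin_le_nhds
    simpa using ENNReal.Tendsto.mul_const h1 (Or.inl one_ne_zero)
  refine ge_of_tendsto hlim ?_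
  filter_upwards [self_mem_nhdsWithin, nhdsWithin_le_nhds (Iio_mem_nhds one_pos)] with ε hε hε1
  refine limsup_le_of_le (h := ?_)
  filter_upwards [h ε hε hε1, self_mem_nhdsWithin] with ρ hρ hρ0
  have hρ0 : 0 < ρ := hρ0
  have hρm : ENNReal.ofReal (ρ ^ m) ≠ 0 := by simpa using pow_pos hρ0 m
  have h2 : ENNReal.ofReal ((2 * ρ) ^ m) = 2 ^ m * ENNReal.ofReal (ρ ^ m) := by
    rw [mul_pow, ENNReal.ofReal_mul (by positivity), ENNReal.ofReal_pow (by norm_num)]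
    simp
  refine ENNReal.div_le_of_le_mul ?_
  calc ν ρ ≤ _ := hρ
    _ ≤ ENNReal.ofReal (((1 + ε) / (1 - ε)) ^ m) * (c * ENNReal.ofReal (ρ ^ m)) := by
        rw [h2, ← mul_assoc b]
        gcongr
    _ = ENNReal.ofReal (((1 + ε) / (1 - ε)) ^ m) * (c / a * a * ENNReal.ofReal (ρ ^ m)) := by
        rw [ENNReal.div_mul_cancel ha ha']
    _ = _ := by ring

/-- If `φ` solves a semilinear elliptic first-order system respecting the
zero section on an open connected `U ⊆ ℝⁿ`, `n ≥ 2`, and `φ` vanishes at `p ∈ U` to order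
exactly `k ≥ 1`, then the `(n−2)`-dimensional upper Hausdorff density of the zero set of `φ`
at `p` is at most `2^{n−3} n (n−1) k³ / α(n−2)`. -/
theorem upper_hausdorff_density_bound_at_finite_order_zero
    (n N : ℕ) (hn : 2 ≤ n) (hN : 1 ≤ N)
    (U : Set (Euc n)) (hUopen : IsOpen U) (hUconn : IsConnected U)
    (A : Fin n → Euc n → Matrix (Fin N) (Fin N) ℝ)
    (hA : ∀ j i l, ContDiffOn ℝ (⊤ : ℕ∞) (fun x => A j x i l) U)
    (hell : IsElliptic A U)
    (V : Euc n → (Fin N → ℝ) → (Fin N → ℝ))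
    (hV : ContDiffOn ℝ (⊤ : ℕ∞) (fun p : Euc n × (Fin N → ℝ) => V p.1 p.2) (U ×ˢ univ))
    (hV0 : ∀ x ∈ U, V x 0 = 0)
    (φ : Euc n → (Fin N → ℝ)) (hφ : ContDiffOn ℝ (⊤ : ℕ∞) φ U)
    (heq : ∀ x ∈ U, semilinApply A V φ x = 0)
    (p : Euc n) (hp : p ∈ U) (k : ℕ) (hk : 1 ≤ k)
    (hvan : ∀ m < k, iteratedFDeriv ℝ m φ p = 0)
    (hord : iteratedFDeriv ℝ k φ p ≠ 0) :
    upperHausdorffDensity (n - 2) {x ∈ U | φ x = 0} p ≤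
      (2 : ℝ≥0∞) ^ ((n : ℝ) - 3) * n * ((n : ℝ≥0∞) - 1) * k ^ 3 / unitBallVol (n - 2) := by
  obtain ⟨φ', hφ', hφφ'⟩ := hφ.exists_contDiff_eventuallyEq hUopen hp
  have hsymb := eventually_symbol_leading_part hUopen hA hell hV hV0 heq hφ' hp hφφ'
  have hD : ∀ m, iteratedFDeriv ℝ m φ' p = iteratedFDeriv ℝ m φ p := fun m =>
    (hφφ'.iteratedFDeriv ℝ m).self_of_nhds
  obtain ⟨δ, hδ, hball⟩ := Metric.eventually_nhds_iff_ball.1 hφφ'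
  refine limsup_div_le_of_forall_eventually_le (measure_ball_pos _ _ one_pos).ne'
    measure_ball_lt_top.ne (fun ε hε hε1 => ?_) (choose_two_mul_le_rpow_bound hn hk)
  filter_upwards [eventually_hausdorffMeasure_zeros_le hn hφ' hk hsymb
      (fun m hm => (hD m).trans (hvan m hm)) (hD k ▸ hord) hε hε1,
    nhdsWithin_le_nhds (Iio_mem_nhds hδ)] with ρ hρ hρδ
  refine (measure_mono ?_).trans hρ
  rintro x ⟨⟨-, hx0⟩, hx⟩
  exact ⟨hx, (hball x (ball_subset_ball (le_of_lt hρδ) hx)).trans hx0⟩
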